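/- Let (a_ℓ)_{ℓ≥1} be a sequence of positive integers and let α = [0; a_1, a_2, …] be the value of the corresponding infinite continued fraction. If there exists a rational number w ≥ 2 such that (a_ℓ)_{ℓ≥1} satisfies Condition (*)_w, then α is transcendental. -/

import Mathlib

open Filter Topology

/-- Denominators of the convergents of the continued fraction `[0; a 0, a 1, ...]`,
where `a i` denotes the `(i+1)`-st partial quotient `a_{i+1}` of the paper:
`q_0 = 1`, `q_1 = a_1`, `q_{ℓ+1} = a_{ℓ+1} q_ℓ + q_{ℓ-1}`. -/
def cfQ (a : ℕ → ℕ) : ℕ → ℕ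
  | 0 => 1
  | 1 => a 0
  | n + 2 => a (n + 1) * cfQ a (n + 1) + cfQ a n

/-- Numerators of the convergents of the continued fraction `[0; a 0, a 1, ...]`:
`p_0 = 0`, `p_1 = 1`, `p_{ℓ+1} = a_{ℓ+1} p_ℓ + p_{ℓ-1}`. -/
def cfP (a : ℕ → ℕ) : ℕ → ℕ
  | 0 => 0
  | 1 => 1
  | n + 2 => a (n + 1) * cfP a (n + 1) + cfP a n

/-- An infinite word is eventually periodic. -/
def EventuallyPeriodic {A : Type*} (x : ℕ → A) : Prop :=
  ∃ k p : ℕ, 0 < p ∧ ∀ n, k ≤ n → x (n + p) = x n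

/-- The infinite word `x` begins with `V^w`: its prefix of length `⌈w·|V|⌉`
coincides with the prefix of the same length of the periodic word `VVV⋯`. -/
def BeginsWithPow {A : Type*} (x : ℕ → A) (V : List A) (w : ℝ) : Prop :=
  ∀ i < ⌈w * V.length⌉₊, V[i % V.length]? = some (x i)

/-- Condition `(*)_w`: `x` is not eventually periodic and there is a sequence of
nonempty finite words `V n` with strictly increasing lengths such that `x` begins
with `(V n)^w` for every `n`. -/
def ConditionStar {A : Type*} (x : ℕ → A) (w : ℝ) : Prop :=
  ¬ EventuallyPeriodic x ∧
    ∃ V : ℕ → List A, (∀ n, V n ≠ []) ∧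
      (StrictMono fun n => (V n).length) ∧
      ∀ n, BeginsWithPow x (V n) w



namespace RS
open MvPolynomial

section wnorm
variable {σ : Type*} [Fintype σ] {S : Type*} [CommRing S]

/-- weighted l1 norm of a polynomial. -/
noncomputable def wnorm (N : RingSeminorm S) (x : σ → ℝ) (p : MvPolynomial σ S) : ℝ :=
  ∑ s ∈ p.support, N (coeff s p) * ∏ i, x i ^ s i

variable (N : RingSeminorm S) (x : σ → ℝ)

theorem wnorm_eq_of_subset (p : MvPolynomial σ S) (F : Finset (σ →₀ ℕ)) (h : p.support ⊆ F) :
    wnorm N x p = ∑ s ∈ F, N (coeff s p) * ∏ i, x i ^ s i := by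
  unfold wnorm
  refine Finset.sum_subset h ?_
  intro s _ hs
  rw [MvPolynomial.notMem_support_iff.mp hs, map_zero, zero_mul]

theorem wnorm_nonneg (hx : ∀ i, 0 ≤ x i) (p : MvPolynomial σ S) : 0 ≤ wnorm N x p :=
  Finset.sum_nonneg fun s _ => mul_nonneg (apply_nonneg N _)
    (Finset.prod_nonneg fun i _ => pow_nonneg (hx i) _)

theorem wnorm_zero : wnorm N x (0 : MvPolynomial σ S) = 0 := by simp [wnorm]

theorem wnorm_add_le (hx : ∀ i, 0 ≤ x i) (p q : MvPolynomial σ S) :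
    wnorm N x (p + q) ≤ wnorm N x p + wnorm N x q := by
  classical
  rw [wnorm_eq_of_subset N x (p + q) (p.support ∪ q.support) MvPolynomial.support_add,
    wnorm_eq_of_subset N x p (p.support ∪ q.support) Finset.subset_union_left,
    wnorm_eq_of_subset N x q (p.support ∪ q.support) Finset.subset_union_right,
    ← Finset.sum_add_distrib]
  refine Finset.sum_le_sum fun s _ => ?_
  rw [← add_mul, coeff_add]
  exact mul_le_mul_of_nonneg_right (map_add_le_add N _ _)
    (Finset.prod_nonneg fun i _ => pow_nonneg (hx i) _)

theorem wnorm_sum_le (hx : ∀ i, 0 ≤ x i) {ι : Type*} (t : Finset ι) (f : ι → MvPolynomial σ S) :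
    wnorm N x (∑ i ∈ t, f i) ≤ ∑ i ∈ t, wnorm N x (f i) := by
  classical
  induction t using Finset.induction_on with
  | empty => simp [wnorm_zero]
  | insert a t ha ih =>
    rw [Finset.sum_insert ha, Finset.sum_insert ha]
    exact (wnorm_add_le N x hx _ _).trans (by gcongr)

theorem wnorm_monomial (s : σ →₀ ℕ) (a : S) :
    wnorm N x (monomial s a) = N a * ∏ i, x i ^ s i := by
  classical
  rw [wnorm_eq_of_subset N x _ {s} MvPolynomial.support_monomial_subset]
  simp

theorem wnorm_mul_le (hx : ∀ i, 0 ≤ x i) (p q : MvPolynomial σ S) :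
    wnorm N x (p * q) ≤ wnorm N x p * wnorm N x q := by
  classical
  have h : p * q = ∑ s ∈ p.support, ∑ t ∈ q.support,
      monomial (s + t) (coeff s p * coeff t q) := by
    conv_lhs => rw [p.as_sum, q.as_sum, Finset.sum_mul_sum]
    simp only [monomial_mul]
  rw [h]
  refine (wnorm_sum_le N x hx _ _).trans ?_
  unfold wnorm
  rw [Finset.sum_mul_sum]
  refine Finset.sum_le_sum fun s _ => ?_
  refine (wnorm_sum_le N x hx _ _).trans ?_
  refine Finset.sum_le_sum fun t _ => ?_
  rw [wnorm_monomial]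
  have e : ∏ i, x i ^ (s + t) i = (∏ i, x i ^ s i) * ∏ i, x i ^ t i := by
    rw [← Finset.prod_mul_distrib]
    exact Finset.prod_congr rfl fun i _ => by rw [Finsupp.add_apply, pow_add]
  rw [e]
  have h1 : 0 ≤ ∏ i, x i ^ s i := Finset.prod_nonneg fun i _ => pow_nonneg (hx i) _
  have h2 : 0 ≤ ∏ i, x i ^ t i := Finset.prod_nonneg fun i _ => pow_nonneg (hx i) _
  calc N (coeff s p * coeff t q) * ((∏ i, x i ^ s i) * ∏ i, x i ^ t i)
      ≤ (N (coeff s p) * N (coeff t q)) * ((∏ i, x i ^ s i) * ∏ i, x i ^ t i) :=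
        mul_le_mul_of_nonneg_right (map_mul_le_mul N _ _) (mul_nonneg h1 h2)
    _ = _ := by ring

theorem wnorm_one_le (h1 : N 1 ≤ 1) : wnorm N x (1 : MvPolynomial σ S) ≤ 1 := by
  have : (1 : MvPolynomial σ S) = monomial 0 1 := rfl
  rw [this, wnorm_monomial]
  simpa using h1

theorem wnorm_prod_le (h1 : N 1 ≤ 1) (hx : ∀ i, 0 ≤ x i) {ι : Type*} (t : Finset ι)
    (f : ι → MvPolynomial σ S) :
    wnorm N x (∏ i ∈ t, f i) ≤ ∏ i ∈ t, wnorm N x (f i) := by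
  classical
  induction t using Finset.induction_on with
  | empty => simpa using wnorm_one_le N x h1
  | insert a t ha ih =>
    rw [Finset.prod_insert ha, Finset.prod_insert ha]
    exact (wnorm_mul_le N x hx _ _).trans
      (mul_le_mul_of_nonneg_left ih (wnorm_nonneg N x hx _))

theorem wnorm_pow_le (h1 : N 1 ≤ 1) (hx : ∀ i, 0 ≤ x i) (p : MvPolynomial σ S) (n : ℕ) :
    wnorm N x (p ^ n) ≤ wnorm N x p ^ n := by
  simpa using wnorm_prod_le N x h1 hx (Finset.range n) (fun _ => p)

theorem wnorm_CX_le (hx : ∀ i, 0 ≤ x i) (a : S) (j : σ) :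
    wnorm N x (C a * X j) = N a * x j := by
  classical
  rw [C_mul_X_eq_monomial, wnorm_monomial]
  congr 1
  rw [Finset.prod_eq_single j]
  · simp
  · intro b _ hb; simp [Finsupp.single_apply, Ne.symm hb]
  · simp

theorem coeff_le_wnorm (hx : ∀ i, 0 ≤ x i) (p : MvPolynomial σ S) (s : σ →₀ ℕ) :
    N (coeff s p) * ∏ i, x i ^ s i ≤ wnorm N x p := by
  by_cases hs : s ∈ p.support
  · exact Finset.single_le_sum (f := fun s => N (coeff s p) * ∏ i, x i ^ s i)
      (fun s _ => mul_nonneg (apply_nonneg N _)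
        (Finset.prod_nonneg fun i _ => pow_nonneg (hx i) _)) hs
  · rw [MvPolynomial.notMem_support_iff.mp hs, map_zero, zero_mul]
    exact wnorm_nonneg N x hx p

theorem wnorm_neg (p : MvPolynomial σ S) : wnorm N x (-p) = wnorm N x p := by
  unfold wnorm
  rw [MvPolynomial.support_neg]
  refine Finset.sum_congr rfl fun s _ => ?_
  rw [coeff_neg, map_neg_eq_map]

end wnorm
end RS

namespace RS
set_option linter.unusedSectionVars false
set_option linter.unusedSimpArgs false
open MvPolynomial

section hasse
variable {σ : Type*} [Fintype σ] {R : Type*} [CommRing R]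

/-- product of binomials -/
def mbin (t μ : σ →₀ ℕ) : ℕ := ∏ i, (t i).choose (μ i)

/-- Hasse derivative -/
noncomputable def hD (μ : σ →₀ ℕ) : MvPolynomial σ R →ₗ[R] MvPolynomial σ R :=
  (basisMonomials σ R).constr R (fun t => monomial (t - μ) (mbin t μ : R))

theorem hD_monomial (μ t : σ →₀ ℕ) (a : R) :
    hD μ (monomial t a) = monomial (t - μ) ((mbin t μ : R) * a) := by
  have : monomial t a = a • (basisMonomials σ R t) := by
    rw [coe_basisMonomials, smul_monomial, smul_eq_mul, mul_one]
  rw [this, map_smul, hD, Module.Basis.constr_basis, smul_monomial, smul_eq_mul, mul_comm]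

theorem coeff_hD (μ t : σ →₀ ℕ) (P : MvPolynomial σ R) :
    coeff t (hD μ P) = (mbin (t + μ) μ : R) * coeff (t + μ) P := by
  classical
  induction P using MvPolynomial.induction_on' with
  | add p q hp hq => rw [map_add, coeff_add, hp, hq, coeff_add, mul_add]
  | monomial s a =>
    rw [hD_monomial, coeff_monomial, coeff_monomial]
    by_cases h : s = t + μ
    · subst h; simp
    · rw [if_neg h, mul_zero]
      split_ifs with h2
      · have : ∃ i, s i < μ i := by
          by_contra hc
          push Not at hc
          apply h
          rw [← h2]
          ext i
          simp [hc i]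
        obtain ⟨i, hi⟩ := this
        have : mbin s μ = 0 := Finset.prod_eq_zero (Finset.mem_univ i) (Nat.choose_eq_zero_of_lt hi)
        simp [this]
      · rfl

theorem hD_zero (P : MvPolynomial σ R) : hD 0 P = P := by
  ext t; rw [coeff_hD]; simp [mbin]

theorem coeff_zero_hD (μ : σ →₀ ℕ) (P : MvPolynomial σ R) : coeff 0 (hD μ P) = coeff μ P := by
  rw [coeff_hD]; simp [mbin]

theorem hD_map {S : Type*} [CommRing S] (f : R →+* S) (μ : σ →₀ ℕ) (P : MvPolynomial σ R) :
    hD μ (map f P) = map f (hD μ P) := by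
  ext t; simp [coeff_hD, coeff_map]

theorem pderiv_hD (i : σ) (μ : σ →₀ ℕ) (P : MvPolynomial σ R) :
    pderiv i (hD μ P) = (μ i + 1) • hD (μ + Finsupp.single i 1) P := by
  classical
  ext t
  rw [coeff_pderiv, coeff_hD, coeff_smul, coeff_hD]
  have e : t + Finsupp.single i 1 + μ = t + (μ + Finsupp.single i 1) := by
    rw [add_assoc, add_comm (Finsupp.single i 1)]
  rw [e, nsmul_eq_mul, ← mul_assoc, mul_right_comm]
  congr 1
  have key : mbin (t + (μ + Finsupp.single i 1)) μ * (t i + 1)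
      = (μ i + 1) * mbin (t + (μ + Finsupp.single i 1)) (μ + Finsupp.single i 1) := by
    unfold mbin
    rw [← Finset.mul_prod_erase _ _ (Finset.mem_univ i), ← Finset.mul_prod_erase _ _ (Finset.mem_univ i)]
    have : ∏ x ∈ Finset.univ.erase i, ((t + (μ + Finsupp.single i 1) : σ →₀ ℕ) x).choose (μ x)
      = ∏ x ∈ Finset.univ.erase i, ((t + (μ + Finsupp.single i 1) : σ →₀ ℕ) x).choose ((μ + Finsupp.single i 1 : σ →₀ ℕ) x) := by
      refine Finset.prod_congr rfl fun x hx => ?_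
      have : x ≠ i := Finset.ne_of_mem_erase hx
      simp [Finsupp.single_apply, Ne.symm this]
    rw [this]
    simp only [Finsupp.add_apply, Finsupp.single_eq_same]
    have h := Nat.choose_succ_right_eq (t i + (μ i + 1)) (μ i)
    have h3 : t i + (μ i + 1) - μ i = t i + 1 := by omega
    rw [h3] at h
    rw [mul_right_comm, ← h]; ring
  have := congrArg (Nat.cast : ℕ → R) key
  push_cast at this ⊢
  exact this

end hasse

section shift
variable {σ : Type*} [Fintype σ] {K : Type*} [Field K] [CharZero K]

/-- translation -/
noncomputable def Tr (ξ : σ → K) : MvPolynomial σ K →ₐ[K] MvPolynomial σ K :=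
  aeval (fun i => X i + C (ξ i))

theorem pderiv_Tr (ξ : σ → K) (i : σ) (P : MvPolynomial σ K) :
    pderiv i (Tr ξ P) = Tr ξ (pderiv i P) := by
  classical
  induction P using MvPolynomial.induction_on with
  | C a => simp [Tr]
  | add p q hp hq => simp [hp, hq]
  | mul_X p j hp =>
    rw [map_mul, Derivation.leibniz, Derivation.leibniz, hp]
    simp only [Tr, aeval_X, map_add, pderiv_X, pderiv_C, smul_eq_mul, map_mul, add_zero]
    congr 2
    by_cases h : i = j
    · subst h; simp
    · simp [Pi.single_apply, Ne.symm h]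

theorem hD_Tr (ξ : σ → K) (μ : σ →₀ ℕ) (P : MvPolynomial σ K) :
    hD μ (Tr ξ P) = Tr ξ (hD μ P) := by
  classical
  induction hn : μ.degree generalizing μ with
  | zero =>
    have : μ = 0 := (Finsupp.degree_eq_zero_iff μ).mp hn
    subst this; simp [hD_zero]
  | succ n ih =>
    have h0 : μ ≠ 0 := by rintro rfl; simp at hn
    obtain ⟨i, hi⟩ := Finsupp.ne_iff.mp h0
    have hi' : 1 ≤ μ i := Nat.one_le_iff_ne_zero.mpr (by simpa using hi)
    obtain ⟨ν, rfl⟩ : ∃ ν, μ = ν + Finsupp.single i 1 := by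
      refine ⟨μ - Finsupp.single i 1, ?_⟩
      rw [tsub_add_cancel_of_le]
      simpa using hi'
    have hν : ν.degree = n := by
      rw [map_add, Finsupp.degree_single] at hn; omega
    have h1 := pderiv_hD i ν (Tr ξ P)
    rw [ih ν hν, pderiv_Tr, pderiv_hD, map_nsmul] at h1
    rw [nsmul_eq_mul, nsmul_eq_mul] at h1
    have hne : ((ν i + 1 : ℕ) : MvPolynomial σ K) ≠ 0 := Nat.cast_ne_zero.mpr (Nat.succ_ne_zero (ν i))
    exact (mul_left_cancel₀ hne h1).symm

theorem coeff_zero_Tr (ξ : σ → K) (P : MvPolynomial σ K) : coeff 0 (Tr ξ P) = eval ξ P := by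
  rw [← constantCoeff_eq]
  have : (constantCoeff : MvPolynomial σ K →+* K).comp (Tr ξ).toRingHom = eval ξ := by
    apply MvPolynomial.ringHom_ext <;> simp [Tr]
  exact congrArg (fun f => f P) this

theorem coeff_Tr (ξ : σ → K) (μ : σ →₀ ℕ) (P : MvPolynomial σ K) :
    coeff μ (Tr ξ P) = eval ξ (hD μ P) := by
  rw [← coeff_zero_hD, hD_Tr, coeff_zero_Tr]

theorem Tr_injective (ξ : σ → K) : Function.Injective (Tr ξ) := by
  have : (Tr (-ξ)).comp (Tr ξ) = AlgHom.id K _ := by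
    apply MvPolynomial.algHom_ext
    intro i
    simp [Tr]
  exact Function.LeftInverse.injective (g := Tr (-ξ)) fun P => congrArg (fun f => f P) this

end shift
end RS

namespace RS
open MvPolynomial

section wronsk
variable {R : Type*} [CommRing R] [IsDomain R] [Algebra ℚ R] {ι : Type*} [Fintype ι] [DecidableEq ι]

/-- embed vector into fraction field -/
noncomputable def fe (v : ι → R) : ι → FractionRing R := fun j => algebraMap R _ (v j)

theorem fe_add (v w : ι → R) : fe (v + w) = fe v + fe w := by ext; simp [fe]
theorem fe_smul (b : R) (v : ι → R) : fe (b • v) = algebraMap R (FractionRing R) b • fe v := by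
  ext; simp [fe]
theorem fe_zero : fe (0 : ι → R) = 0 := by ext; simp [fe]
theorem fe_inj : Function.Injective (fe : (ι → R) → _) := by
  intro v w h
  ext j
  exact IsFractionRing.injective R (FractionRing R) (congrFun h j)

theorem span_deriv (d : Derivation ℚ R R) (A : Set (ι → R))
    (S : Submodule (FractionRing R) (ι → FractionRing R))
    (hS : S = Submodule.span _ (fe '' A))
    (hA : ∀ v ∈ A, fe (fun j => d (v j)) ∈ S) (v : ι → R) (hv : fe v ∈ S) :
    fe (fun j => d (v j)) ∈ S := by
  set K := FractionRing R
  have key : ∀ w ∈ Submodule.span K (fe '' A), ∃ b : R, b ≠ 0 ∧ ∃ u : ι → R,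
      algebraMap R K b • w = fe u ∧ fe u ∈ S ∧ fe (fun j => d (u j)) ∈ S := by
    intro w hw
    induction hw using Submodule.span_induction with
    | mem x hx =>
      obtain ⟨u, hu, rfl⟩ := hx
      refine ⟨1, one_ne_zero, u, by simp, ?_, hA u hu⟩
      rw [hS]; exact Submodule.subset_span ⟨u, hu, rfl⟩
    | zero =>
      refine ⟨1, one_ne_zero, 0, by simp [fe_zero], by simp [fe_zero], ?_⟩
      have : (fun j : ι => d ((0 : ι → R) j)) = 0 := by ext; simp
      rw [this, fe_zero]; exact S.zero_mem
    | add x y _ _ hx hy =>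
      obtain ⟨b1, h1, u1, e1, m1, n1⟩ := hx
      obtain ⟨b2, h2, u2, e2, m2, n2⟩ := hy
      refine ⟨b1 * b2, mul_ne_zero h1 h2, b2 • u1 + b1 • u2, ?_, ?_, ?_⟩
      · rw [fe_add, fe_smul, fe_smul, ← e1, ← e2, map_mul, smul_add, smul_smul, smul_smul, mul_comm]
      · rw [fe_add, fe_smul, fe_smul]
        exact S.add_mem (S.smul_mem _ m1) (S.smul_mem _ m2)
      · have : (fun j => d ((b2 • u1 + b1 • u2) j)) =
          (b2 • (fun j => d (u1 j)) + d b2 • u1) + (b1 • (fun j => d (u2 j)) + d b1 • u2) := by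
          ext j; simp [Derivation.leibniz]; ring
        rw [this]
        simp only [fe_add, fe_smul]
        exact S.add_mem (S.add_mem (S.smul_mem _ n1) (S.smul_mem _ m1))
          (S.add_mem (S.smul_mem _ n2) (S.smul_mem _ m2))
    | smul a x _ hx =>
      obtain ⟨b, hb, u, e, m, n⟩ := hx
      obtain ⟨p, q, rfl⟩ := IsLocalization.exists_mk'_eq (nonZeroDivisors R) a
      have hq : (q : R) ≠ 0 := nonZeroDivisors.coe_ne_zero q
      refine ⟨b * q, mul_ne_zero hb hq, p • u, ?_, ?_, ?_⟩
      · rw [fe_smul, ← e, map_mul, smul_smul, smul_smul]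
        congr 1
        rw [mul_assoc, mul_comm (algebraMap R K q), IsLocalization.mk'_spec, mul_comm]
      · rw [fe_smul]; exact S.smul_mem _ m
      · have : (fun j => d ((p • u) j)) = p • (fun j => d (u j)) + d p • u := by
          ext j; simp [Derivation.leibniz]; ring
        rw [this, fe_add, fe_smul, fe_smul]
        exact S.add_mem (S.smul_mem _ n) (S.smul_mem _ m)
  obtain ⟨b, hb, u, e, m, n⟩ := key (fe v) (hS ▸ hv)
  rw [← fe_smul] at e
  have e' := fe_inj e
  have h1 : (fun j => d (u j)) = b • (fun j => d (v j)) + d b • v := by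
    rw [← e']; ext j; simp [Derivation.leibniz]; ring
  rw [h1, fe_add, fe_smul, fe_smul] at n
  have h2 := S.sub_mem n (S.smul_mem (algebraMap R K (d b)) hv)
  rw [add_sub_cancel_right] at h2
  have hb' : algebraMap R K b ≠ 0 := by
    simpa using hb
  have := S.smul_mem (algebraMap R K b)⁻¹ h2
  rwa [smul_smul, inv_mul_cancel₀ hb', one_smul] at this

theorem wronskian {σ : Type*} [Fintype σ] (D : (σ →₀ ℕ) → R →ₗ[ℚ] R)
    (dd : σ → Derivation ℚ R R)
    (hdd : ∀ i μ f, dd i (D μ f) = (μ i + 1) • D (μ + Finsupp.single i 1) f)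
    {Y : Type*} (ev : Y → R →ₐ[ℚ] ℚ) (hev : ∀ f, f ≠ 0 → ∃ x, ev x f ≠ 0)
    (hsep : ∀ x f, (∀ μ, ev x (D μ f) = 0) → f = 0)
    (φ : ι → R) (hφ : LinearIndependent ℚ φ) :
    ∃ μ : ι → (σ →₀ ℕ), (∀ i, (μ i).degree < Fintype.card ι) ∧
      (Matrix.of fun i j => D (μ i) (φ j)).det ≠ 0 := by
  classical
  set K := FractionRing R
  set r : (σ →₀ ℕ) → ι → R := fun μ j => D μ (φ j) with hr
  set A : ℕ → Set (ι → R) := fun N => {v | ∃ μ : σ →₀ ℕ, μ.degree < N ∧ v = r μ} with hA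
  set S : ℕ → Submodule K (ι → K) := fun N => Submodule.span K (fe '' A N) with hS
  have Smono : Monotone S := by
    intro N M h
    refine Submodule.span_mono (Set.image_mono ?_)
    rintro v ⟨μ, h1, h2⟩
    exact ⟨μ, h1.trans_le h, h2⟩
  have rmem : ∀ μ N, μ.degree < N → fe (r μ) ∈ S N := fun μ N h =>
    Submodule.subset_span ⟨r μ, ⟨μ, h, rfl⟩, rfl⟩
  -- stability
  have stab : ∀ N, S (N + 1) ≤ S N → ∀ μ, fe (r μ) ∈ S N := by
    intro N hN μ
    induction hn : μ.degree generalizing μ with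
    | zero =>
      exact hN (rmem μ _ (by omega))
    | succ n ih =>
      have h0 : μ ≠ 0 := by rintro rfl; simp at hn
      obtain ⟨i, hi⟩ := Finsupp.ne_iff.mp h0
      have hi' : 1 ≤ μ i := Nat.one_le_iff_ne_zero.mpr (by simpa using hi)
      obtain ⟨ν, rfl⟩ : ∃ ν, μ = ν + Finsupp.single i 1 := by
        refine ⟨μ - Finsupp.single i 1, ?_⟩
        rw [tsub_add_cancel_of_le]
        simpa using hi'
      have hν : ν.degree = n := by
        rw [map_add, Finsupp.degree_single] at hn; omega
      have hd : ∀ ν : σ →₀ ℕ, fe (fun j => dd i (r ν j)) =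
          ((ν i + 1 : ℕ) : K) • fe (r (ν + Finsupp.single i 1)) := by
        intro ν; ext j
        simp [fe, hr, hdd]
      have := span_deriv (dd i) (A N) (S N) rfl (by
        rintro v ⟨lam, hl, rfl⟩
        rw [hd]
        refine (S N).smul_mem _ (hN (rmem _ _ ?_))
        rw [map_add, Finsupp.degree_single]; omega) (r ν) (ih ν hν)
      rw [hd] at this
      have hne : ((ν i + 1 : ℕ) : K) ≠ 0 := by
        haveI : CharZero R := algebraRat.charZero R
        haveI : CharZero K := IsFractionRing.charZero R
        exact Nat.cast_ne_zero.mpr (Nat.succ_ne_zero (ν i))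
      have := (S N).smul_mem (((ν i + 1 : ℕ) : K))⁻¹ this
      rwa [smul_smul, inv_mul_cancel₀ hne, one_smul] at this
  have top : S (Fintype.card ι) = ⊤ := by
    by_contra hne
    have : ∃ N, N < Fintype.card ι ∧ S (N + 1) ≤ S N := by
      by_contra hc
      push Not at hc
      have : ∀ N, N ≤ Fintype.card ι → N ≤ Module.finrank K (S N) := by
        intro N
        induction N with
        | zero => simp
        | succ N ih =>
          intro h
          have h1 := ih (by omega)
          have hlt : S N < S (N + 1) := lt_of_le_not_ge (Smono (Nat.le_succ N)) (hc N (by omega))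
          have := Submodule.finrank_lt_finrank_of_lt hlt
          omega
      have h2 := this _ le_rfl
      apply hne
      apply Submodule.eq_top_of_finrank_eq
      refine le_antisymm (Submodule.finrank_le _) ?_
      simpa using h2
    obtain ⟨N, hN, hle⟩ := this
    have hall := stab N hle
    have hlt : S N < ⊤ := lt_of_le_of_lt (Smono hN.le) (lt_top_iff_ne_top.mpr hne)
    obtain ⟨f, hf0, hf⟩ := Submodule.exists_le_ker_of_lt_top _ hlt
    obtain ⟨b, hb⟩ := IsLocalization.exist_integer_multiples_of_finite (nonZeroDivisors R)
      (fun j : ι => f (Pi.single j 1))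
    choose c hc using hb
    have hb0 : algebraMap R K b ≠ 0 := by
      simpa using nonZeroDivisors.coe_ne_zero b
    have hfv : ∀ v : ι → R, algebraMap R K (∑ j, c j * v j) = algebraMap R K b * f (fe v) := by
      intro v
      have : fe v = ∑ j, (algebraMap R K (v j)) • (Pi.single j (1 : K) : ι → K) := by
        ext i
        simp [fe, Pi.single_apply, Algebra.smul_def, K]
      rw [this, map_sum, map_sum, Finset.mul_sum]
      refine Finset.sum_congr rfl fun j _ => ?_
      rw [map_mul, hc, map_smul, Algebra.smul_def, smul_eq_mul]
      ring
    have hz : ∀ μ, ∑ j, c j * D μ (φ j) = 0 := by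
      intro μ
      apply IsFractionRing.injective R K
      have := hfv (r μ)
      rw [show f (fe (r μ)) = 0 from LinearMap.mem_ker.mp (hf (hall μ))] at this
      simpa using this
    have : ∃ j, c j ≠ 0 := by
      by_contra hcc
      push Not at hcc
      apply hf0
      apply LinearMap.pi_ext'
      intro j
      ext
      have := hc j
      rw [hcc j, map_zero, Algebra.smul_def] at this
      simpa [hb0] using this.symm
    obtain ⟨j0, hj0⟩ := this
    obtain ⟨x, hx⟩ := hev _ hj0
    have hfz : ∑ j, (ev x (c j)) • φ j = 0 := by
      apply hsep x
      intro μ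
      have := congrArg (ev x) (hz μ)
      simpa using this
    exact hx (Fintype.linearIndependent_iff.mp hφ _ hfz j0)
  -- extract basis
  obtain ⟨κ, a, ainj, aspan, ali⟩ := exists_linearIndependent' K
    (fun v : {μ : σ →₀ ℕ // μ.degree < Fintype.card ι} => fe (r v.1))
  have hsp : Submodule.span K (Set.range ((fun v : {μ : σ →₀ ℕ // μ.degree < Fintype.card ι} => fe (r v.1)) ∘ a)) = ⊤ := by
    rw [aspan, ← top]
    congr 1
    ext w
    constructor
    · rintro ⟨v, rfl⟩; exact ⟨_, ⟨v.1, v.2, rfl⟩, rfl⟩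
    · rintro ⟨_, ⟨μ, h, rfl⟩, rfl⟩; exact ⟨⟨μ, h⟩, rfl⟩
  let bas := Module.Basis.mk ali hsp.ge
  let e : ι ≃ κ := (Pi.basisFun K ι).indexEquiv bas
  refine ⟨fun i => (a (e i)).1, fun i => (a (e i)).2, ?_⟩
  intro hdet
  have hli : LinearIndependent K (fun i => fe (r (a (e i)).1)) := ali.comp e e.injective
  have hm : (Matrix.of fun i j => D (a (e i)).1 (φ j)).map (algebraMap R K) =
     Matrix.of (fun i => fe (r (a (e i)).1)) := by ext; rfl
  have h1 := Matrix.linearIndependent_rows_iff_isUnit (A := Matrix.of (fun i => fe (r (a (e i)).1)))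
  have h2 := h1.mp hli
  rw [Matrix.isUnit_iff_isUnit_det, ← hm, ← RingHom.mapMatrix_apply, ← RingHom.map_det, hdet, map_zero] at h2
  exact not_isUnit_zero h2

end wronsk
end RS

namespace RS
open MvPolynomial

section box
variable {n : ℕ} {R : Type*} [CommRing R]

/-- tensor product of a polynomial in the last variables and one in the first. -/
noncomputable def box (φ : MvPolynomial (Fin n) R) (ψ : Polynomial R) :
    MvPolynomial (Fin (n + 1)) R :=
  rename Fin.succ φ * Polynomial.aeval (X 0) ψ

theorem finSuccEquiv_box (φ : MvPolynomial (Fin n) R) (ψ : Polynomial R) :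
    finSuccEquiv R n (box φ ψ) = Polynomial.C φ * ψ.map C := by
  rw [box, map_mul]
  congr 1
  · have : ((finSuccEquiv R n).toAlgHom.toRingHom.comp (rename Fin.succ : _ →ₐ[R] _).toRingHom)
        = Polynomial.C := by
      apply MvPolynomial.ringHom_ext
      · intro r; simp [finSuccEquiv_apply]
      · intro i; simp [finSuccEquiv_X_succ]
    exact congrArg (fun f => f φ) this
  · induction ψ using Polynomial.induction_on' with
    | add p q hp hq => simp [hp, hq]
    | monomial m r =>
      rw [Polynomial.aeval_monomial, map_mul, map_pow, finSuccEquiv_X_zero, Polynomial.map_monomial,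
        ← Polynomial.C_mul_X_pow_eq_monomial]
      congr 1
      simp [algebraMap_eq, finSuccEquiv_apply]

theorem coeff_box (φ : MvPolynomial (Fin n) R) (ψ : Polynomial R) (a : ℕ) (s : Fin n →₀ ℕ) :
    coeff (Finsupp.cons a s) (box φ ψ) = coeff s φ * ψ.coeff a := by
  rw [← finSuccEquiv_coeff_coeff, finSuccEquiv_box, Polynomial.coeff_C_mul, Polynomial.coeff_map,
    mul_comm, coeff_C_mul, mul_comm]

theorem ext_cons {P Q : MvPolynomial (Fin (n + 1)) R}
    (h : ∀ a s, coeff (Finsupp.cons a s) P = coeff (Finsupp.cons a s) Q) : P = Q := by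
  ext t
  rw [← Finsupp.cons_tail t]
  exact h _ _

theorem cons_add (a b : ℕ) (s t : Fin n →₀ ℕ) :
    Finsupp.cons a s + Finsupp.cons b t = Finsupp.cons (a + b) (s + t) := by
  ext i
  refine Fin.cases ?_ (fun j => ?_) i <;> simp

theorem mbin_cons (a b : ℕ) (s t : Fin n →₀ ℕ) :
    mbin (Finsupp.cons a s) (Finsupp.cons b t) = a.choose b * mbin s t := by
  simp [mbin, Fin.prod_univ_succ]

theorem hD_box (ν : ℕ) (μ : Fin n →₀ ℕ) (φ : MvPolynomial (Fin n) R) (ψ : Polynomial R) :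
    hD (Finsupp.cons ν μ) (box φ ψ) = box (hD μ φ) (Polynomial.hasseDeriv ν ψ) := by
  apply ext_cons
  intro a s
  rw [coeff_hD, cons_add, mbin_cons, coeff_box, coeff_box, coeff_hD, Polynomial.hasseDeriv_coeff]
  push_cast
  ring

theorem Tr_box {K : Type*} [Field K] [CharZero K] (ξ : Fin (n + 1) → K) (φ : MvPolynomial (Fin n) K)
    (ψ : Polynomial K) :
    Tr ξ (box φ ψ) = box (Tr (fun i => ξ i.succ) φ) (Polynomial.taylor (ξ 0) ψ) := by
  unfold box
  rw [map_mul]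
  congr 1
  · have : (Tr ξ).comp (rename Fin.succ) = (rename Fin.succ).comp (Tr (fun i : Fin n => ξ i.succ)) := by
      apply MvPolynomial.algHom_ext
      intro i
      simp [Tr]
    exact congrArg (fun f => f φ) this
  · have : (Tr ξ).comp (Polynomial.aeval (X 0)) =
        (Polynomial.aeval (X 0)).comp (Polynomial.taylorAlgHom (ξ 0)) := by
      apply Polynomial.algHom_ext
      simp [Tr]
    exact congrArg (fun f => f ψ) this

theorem aeval_eq_eval' {n : ℕ} (x : Fin n → ℚ) (f : MvPolynomial (Fin n) ℚ) :
    aeval x f = eval x f := by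
  have := MvPolynomial.coe_aeval_eq_eval x
  exact congrArg (fun g : MvPolynomial (Fin n) ℚ →+* ℚ => g f) this

theorem wronskian_mv {n : ℕ} {ι : Type*} [Fintype ι] [DecidableEq ι]
    (φ : ι → MvPolynomial (Fin n) ℚ) (hφ : LinearIndependent ℚ φ) :
    ∃ μ : ι → (Fin n →₀ ℕ), (∀ i, (μ i).degree < Fintype.card ι) ∧
      (Matrix.of fun i j => hD (μ i) (φ j)).det ≠ 0 := by
  refine wronskian (σ := Fin n) hD (fun i => pderiv i) (fun i μ f => pderiv_hD i μ f)
    (Y := Fin n → ℚ) (fun x => aeval x) ?_ ?_ φ hφ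
  · intro f hf
    by_contra hc
    push Not at hc
    apply hf
    apply MvPolynomial.funext
    intro x
    have := hc x
    rw [aeval_eq_eval'] at this
    rw [map_zero]; exact this
  · intro x f h
    apply Tr_injective x
    rw [map_zero]
    ext μ
    rw [coeff_Tr, coeff_zero]
    have := h μ
    rw [aeval_eq_eval'] at this
    exact this

theorem wronskian_poly {ι : Type*} [Fintype ι] [DecidableEq ι]
    (ψ : ι → Polynomial ℚ) (hψ : LinearIndependent ℚ ψ) :
    ∃ ν : ι → ℕ, (∀ i, ν i < Fintype.card ι) ∧
      (Matrix.of fun i j => Polynomial.hasseDeriv (ν i) (ψ j)).det ≠ 0 := by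
  obtain ⟨μ, h1, h2⟩ := wronskian (σ := Unit) (fun μ => Polynomial.hasseDeriv (μ ()))
    (fun _ => Polynomial.derivative')
    (fun i μ f => by
      ext m
      simp only [Polynomial.derivative'_apply, Polynomial.coeff_derivative, Polynomial.hasseDeriv_coeff,
        Polynomial.coeff_smul]
      rw [nsmul_eq_mul]
      cases i
      have h := Nat.choose_succ_right_eq (m + 1 + μ ()) (μ ())
      have h3 : m + 1 + μ () - μ () = m + 1 := by omega
      rw [h3] at h
      have h' := congrArg (Nat.cast : ℕ → ℚ) h
      have e1 : (μ + Finsupp.single () 1 : Unit →₀ ℕ) () = μ () + 1 := by simp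
      rw [e1]
      have e2 : m + (μ () + 1) = m + 1 + μ () := by ring
      rw [e2]
      push_cast at h' ⊢
      linear_combination (-f.coeff (m + 1 + μ ())) * h')
    (Y := ℚ) (fun x => Polynomial.aeval x) (by
      intro f hf
      by_contra hc
      push Not at hc
      apply hf
      apply Polynomial.funext
      intro x
      simpa using hc x) (by
      intro x f h
      apply Polynomial.taylor_injective x
      rw [map_zero]
      ext m
      rw [Polynomial.taylor_coeff, Polynomial.coeff_zero]
      simpa using h (Finsupp.single () m)) ψ hψ
  refine ⟨fun i => μ i (), fun i => ?_, h2⟩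
  have := h1 i
  rwa [show (μ i).degree = μ i () by simp [Finsupp.degree_eq_sum]] at this

theorem decomp (Q : MvPolynomial (Fin (n + 1)) ℚ) (d0 : ℕ)
    (hd : ∀ s, coeff s Q ≠ 0 → s 0 ≤ d0) :
    ∃ (κ : Type) (_ : Fintype κ) (_ : DecidableEq κ) (φ : κ → MvPolynomial (Fin n) ℚ)
      (ψ : κ → Polynomial ℚ), Fintype.card κ ≤ d0 + 1 ∧ LinearIndependent ℚ φ ∧
      LinearIndependent ℚ ψ ∧ Q = ∑ j, box (φ j) (ψ j) := by
  classical
  set Pa : Fin (d0 + 1) → MvPolynomial (Fin n) ℚ := fun a => (finSuccEquiv ℚ n Q).coeff a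
  obtain ⟨κ, a, ainj, aspan, ali⟩ := exists_linearIndependent' ℚ Pa
  haveI : Finite κ := Finite.of_injective a ainj
  haveI := Fintype.ofFinite κ
  have hmem : ∀ b, Pa b ∈ Submodule.span ℚ (Set.range (Pa ∘ a)) := by
    intro b; rw [aspan]; exact Submodule.subset_span ⟨b, rfl⟩
  have hex : ∀ b, ∃ c : κ → ℚ, ∑ j, c j • (Pa ∘ a) j = Pa b := fun b =>
    (Submodule.mem_span_range_iff_exists_fun ℚ).mp (hmem b)
  choose c hc using hex
  have hdelta : ∀ j' j, c (a j') j = if j = j' then 1 else 0 := by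
    intro j' j
    have h1 := hc (a j')
    have h2 : ∑ j, (c (a j') j - if j = j' then 1 else 0) • (Pa ∘ a) j = 0 := by
      simp only [sub_smul, Finset.sum_sub_distrib, h1]
      simp
    have := Fintype.linearIndependent_iff.mp ali _ h2 j
    linarith
  set ψ : κ → Polynomial ℚ := fun j => ∑ b : Fin (d0 + 1), Polynomial.monomial b (c b j)
  have ψc : ∀ j (b : Fin (d0 + 1)), (ψ j).coeff b = c b j := by
    intro j b
    simp [ψ, Polynomial.finsetSum_coeff, Polynomial.coeff_monomial, Fin.val_inj]
  have ψc' : ∀ j (b : ℕ), d0 < b → (ψ j).coeff b = 0 := by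
    intro j b hb
    simp only [ψ, Polynomial.finsetSum_coeff, Polynomial.coeff_monomial]
    refine Finset.sum_eq_zero fun x _ => ?_
    rw [if_neg]; have := x.2; omega
  refine ⟨κ, inferInstance, inferInstance, Pa ∘ a, ψ, ?_, ali, ?_, ?_⟩
  · simpa using Fintype.card_le_of_injective a ainj
  · rw [Fintype.linearIndependent_iff]
    intro g hg j
    have := congrArg (fun p => Polynomial.coeff p (a j)) hg
    simp only [Polynomial.finsetSum_coeff, Polynomial.coeff_smul, ψc, hdelta] at this
    simpa using this
  · apply ext_cons
    intro b s
    rw [coeff_sum]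
    simp only [coeff_box]
    by_cases hb : b ≤ d0
    · have e : b = ((⟨b, by omega⟩ : Fin (d0 + 1)) : ℕ) := rfl
      rw [← finSuccEquiv_coeff_coeff]
      have := congrArg (coeff s) (hc ⟨b, by omega⟩)
      rw [coeff_sum] at this
      rw [show (finSuccEquiv ℚ n Q).coeff b = Pa ⟨b, by omega⟩ from rfl, ← this]
      refine Finset.sum_congr rfl fun j _ => ?_
      rw [coeff_smul, smul_eq_mul, mul_comm, ← ψc j ⟨b, by omega⟩]
    · rw [Finset.sum_eq_zero fun j _ => by rw [ψc' j b (by omega), mul_zero]]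
      by_contra hne
      have := hd _ hne
      rw [Finsupp.cons_zero] at this
      omega

end box

section idx
variable {σ : Type*} [Fintype σ] {R : Type*} [CommRing R]

/-- index at least `t`. -/
def Idx (d : σ → ℝ) (t : ℝ) (P : MvPolynomial σ R) : Prop :=
  ∀ k, coeff k P ≠ 0 → t ≤ ∑ h, (k h : ℝ) / d h

theorem Idx.mul {d : σ → ℝ} {t u : ℝ} {P Q : MvPolynomial σ R} (hP : Idx d t P) (hQ : Idx d u Q) :
    Idx d (t + u) (P * Q) := by
  classical
  intro k hk
  rw [coeff_mul] at hk
  obtain ⟨x, hx, hne⟩ := Finset.exists_ne_zero_of_sum_ne_zero hk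
  rw [Finset.HasAntidiagonal.mem_antidiagonal] at hx
  have h1 := hP x.1 (left_ne_zero_of_mul hne)
  have h2 := hQ x.2 (right_ne_zero_of_mul hne)
  rw [← hx]
  simp only [Finsupp.add_apply, Nat.cast_add, add_div, Finset.sum_add_distrib]
  linarith

theorem Idx.one {d : σ → ℝ} (hd : ∀ h, 0 ≤ d h) : Idx d 0 (1 : MvPolynomial σ R) :=
  fun k _ => Finset.sum_nonneg fun h _ => div_nonneg (Nat.cast_nonneg _) (hd h)

theorem Idx.max {d : σ → ℝ} (hd : ∀ h, 0 ≤ d h) {t : ℝ} {P : MvPolynomial σ R} (hP : Idx d t P) :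
    Idx d (max 0 t) P :=
  fun k hk => max_le (Finset.sum_nonneg fun h _ => div_nonneg (Nat.cast_nonneg _) (hd h)) (hP k hk)

theorem Idx.mono {d : σ → ℝ} {t u : ℝ} {P : MvPolynomial σ R} (hP : Idx d t P) (h : u ≤ t) :
    Idx d u P := fun k hk => h.trans (hP k hk)

theorem Idx.prod {d : σ → ℝ} (hd : ∀ h, 0 ≤ d h) {ι : Type*} (s : Finset ι) (t : ι → ℝ)
    (f : ι → MvPolynomial σ R) (hf : ∀ i, Idx d (t i) (f i)) :
    Idx d (∑ i ∈ s, t i) (∏ i ∈ s, f i) := by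
  classical
  induction s using Finset.induction_on with
  | empty => simpa using Idx.one hd
  | insert a s ha ih =>
    rw [Finset.sum_insert ha, Finset.prod_insert ha]
    exact (hf a).mul ih

theorem Idx.sum {d : σ → ℝ} {ι : Type*} (s : Finset ι) (t : ℝ)
    (f : ι → MvPolynomial σ R) (hf : ∀ i, Idx d t (f i)) :
    Idx d t (∑ i ∈ s, f i) := by
  intro k hk
  rw [coeff_sum] at hk
  obtain ⟨x, hx, hne⟩ := Finset.exists_ne_zero_of_sum_ne_zero hk
  exact hf x k hne

theorem Idx.det {d : σ → ℝ} (hd : ∀ h, 0 ≤ d h) {ι : Type*} [Fintype ι] [DecidableEq ι] (t : ι → ℝ)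
    (M : Matrix ι ι (MvPolynomial σ R)) (hM : ∀ i j, Idx d (t j) (M i j)) :
    Idx d (∑ j, t j) M.det := by
  rw [Matrix.det_apply]
  refine Idx.sum _ _ _ fun τ => ?_
  have := Idx.prod hd Finset.univ t (fun j => M (τ j) j) (fun j => hM _ _)
  intro k hk
  apply this k
  intro h0
  apply hk
  rw [coeff_smul, h0, smul_zero]

theorem Idx.hD {d : σ → ℝ} {t : ℝ} {P : MvPolynomial σ R} (hP : Idx d t P) (μ : σ →₀ ℕ) :
    Idx d (t - ∑ h, (μ h : ℝ) / d h) (hD μ P) := by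
  intro k hk
  rw [coeff_hD] at hk
  have := hP _ (right_ne_zero_of_mul hk)
  simp only [Finsupp.add_apply, Nat.cast_add, add_div, Finset.sum_add_distrib] at this
  linarith

end idx
end RS

namespace RS
open MvPolynomial

section norms
variable {n : ℕ}

theorem nrs_apply (a : ℤ) : normRingSeminorm ℤ a = |(a : ℝ)| := Int.norm_eq_abs a

/-- sum of absolute values of the coefficients -/
noncomputable def wn (P : MvPolynomial (Fin n) ℤ) : ℝ :=
  wnorm (normRingSeminorm ℤ) (fun _ => 1) P

theorem wn_eq (P : MvPolynomial (Fin n) ℤ) : wn P = ∑ s ∈ P.support, |((coeff s P : ℤ) : ℝ)| := by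
  unfold wn wnorm
  refine Finset.sum_congr rfl fun s _ => ?_
  rw [nrs_apply]; simp

theorem coeff_le_wn (P : MvPolynomial (Fin n) ℤ) (s : Fin n →₀ ℕ) : |((coeff s P : ℤ) : ℝ)| ≤ wn P := by
  have := coeff_le_wnorm (normRingSeminorm ℤ) (fun _ : Fin n => (1 : ℝ)) (fun _ => zero_le_one) P s
  rw [nrs_apply] at this
  simpa [wn] using this

theorem succ_le_two_pow (d : ℕ) : d + 1 ≤ 2 ^ d := Nat.lt_two_pow_self

theorem wn_le_of_bound (P : MvPolynomial (Fin n) ℤ) (d : Fin n → ℕ) (B : ℝ) (hB : 0 ≤ B)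
    (h1 : ∀ s, |((coeff s P : ℤ) : ℝ)| ≤ B) (h2 : ∀ s, coeff s P ≠ 0 → ∀ h, s h ≤ d h) :
    wn P ≤ 2 ^ (∑ h, d h) * B := by
  classical
  rw [wn_eq]
  have hc : P.support.card ≤ 2 ^ (∑ h, d h) := by
    calc P.support.card ≤ (Fintype.piFinset fun h => Finset.range (d h + 1)).card := by
          apply Finset.card_le_card_of_injOn (fun s : Fin n →₀ ℕ => (⇑s : Fin n → ℕ))
          · intro s hs
            simp only [Finset.mem_coe, mem_support_iff] at hs
            simp only [Finset.mem_coe, Fintype.mem_piFinset, Finset.mem_range]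
            intro h; have := h2 s hs h; omega
          · intro s _ t _ h; exact DFunLike.coe_injective h
      _ = ∏ h, (d h + 1) := by simp
      _ ≤ ∏ h, 2 ^ d h := Finset.prod_le_prod' fun h _ => succ_le_two_pow _
      _ = _ := by rw [Finset.prod_pow_eq_pow_sum]
  calc _ ≤ ∑ s ∈ P.support, B := Finset.sum_le_sum fun s _ => h1 s
    _ = P.support.card * B := by simp
    _ ≤ _ := by
      gcongr
      exact_mod_cast hc

theorem mbin_le (s μ : Fin n →₀ ℕ) (d : Fin n → ℕ) (h : ∀ i, s i ≤ d i) :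
    mbin s μ ≤ 2 ^ (∑ h, d h) := by
  rw [← Finset.prod_pow_eq_pow_sum]
  refine Finset.prod_le_prod' fun i _ => ?_
  exact (Nat.choose_le_two_pow _ _).trans (Nat.pow_le_pow_right (by norm_num) (h i))

theorem wn_hD (P : MvPolynomial (Fin n) ℤ) (d : Fin n → ℕ) (μ : Fin n →₀ ℕ)
    (h2 : ∀ s, coeff s P ≠ 0 → ∀ h, s h ≤ d h) :
    wn (hD μ P) ≤ 2 ^ (∑ h, d h) * wn P := by
  have e : hD μ P = ∑ s ∈ P.support, monomial (s - μ) ((mbin s μ : ℤ) * coeff s P) := by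
    conv_lhs => rw [P.as_sum]
    rw [map_sum]
    simp only [hD_monomial]
    try rfl
  rw [e, wn]
  refine (wnorm_sum_le _ _ (fun _ => zero_le_one) _ _).trans ?_
  rw [wn_eq, Finset.mul_sum]
  refine Finset.sum_le_sum fun s hs => ?_
  rw [wnorm_monomial]
  simp only [one_pow, Finset.prod_const_one, mul_one]
  change ‖((mbin s μ : ℤ) * coeff s P)‖ ≤ _
  rw [Int.norm_eq_abs]
  push_cast
  rw [abs_mul, Nat.abs_cast]
  gcongr
  exact_mod_cast mbin_le s μ d (h2 s (mem_support_iff.mp hs))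

theorem wn_det {ι : Type*} [Fintype ι] [DecidableEq ι] (M : Matrix ι ι (MvPolynomial (Fin n) ℤ))
    (c : ℝ) (hM : ∀ i j, wn (M i j) ≤ c) :
    wn M.det ≤ (Fintype.card ι).factorial * c ^ Fintype.card ι := by
  rw [Matrix.det_apply, wn]
  refine (wnorm_sum_le _ _ (fun _ => zero_le_one) _ _).trans ?_
  have : ∀ τ : Equiv.Perm ι, wnorm (normRingSeminorm ℤ) (fun _ : Fin n => (1 : ℝ))
      (Equiv.Perm.sign τ • ∏ i, M (τ i) i) ≤ c ^ Fintype.card ι := by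
    intro τ
    have h1 : wnorm (normRingSeminorm ℤ) (fun _ : Fin n => (1 : ℝ)) (∏ i, M (τ i) i) ≤ c ^ Fintype.card ι := by
      refine (wnorm_prod_le _ _ (by rw [nrs_apply]; simp) (fun _ => zero_le_one) _ _).trans ?_
      refine (Finset.prod_le_prod (fun i _ => wnorm_nonneg _ _ (fun _ => zero_le_one) _)
        (fun i _ => hM (τ i) i)).trans ?_
      simp
    rcases Int.units_eq_one_or (Equiv.Perm.sign τ) with h | h
    · rw [h, one_smul]; exact h1
    · rw [h, Units.neg_smul, one_smul, wnorm_neg]; exact h1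
  refine (Finset.sum_le_sum fun τ _ => this τ).trans ?_
  simp [Fintype.card_perm]

theorem degreeOf_det {R : Type*} [CommRing R] {ι : Type*} [Fintype ι] [DecidableEq ι]
    (M : Matrix ι ι (MvPolynomial (Fin n) R))
    (h : Fin n) (c : ℕ) (hM : ∀ i j, degreeOf h (M i j) ≤ c) :
    degreeOf h M.det ≤ Fintype.card ι * c := by
  rw [Matrix.det_apply]
  refine (degreeOf_sum_le _ _ _).trans (Finset.sup_le fun τ _ => ?_)
  have h1 : degreeOf h (∏ i, M (τ i) i) ≤ Fintype.card ι * c := by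
    refine (degreeOf_prod_le _ _ _).trans ?_
    refine (Finset.sum_le_sum fun i _ => hM (τ i) i).trans ?_
    simp
  rcases Int.units_eq_one_or (Equiv.Perm.sign τ) with h | h
  · rw [h, one_smul]; exact h1
  · rw [h, Units.neg_smul, one_smul, degreeOf_neg]; exact h1

theorem degreeOf_hD {R : Type*} [CommRing R] (P : MvPolynomial (Fin n) R) (d : ℕ) (μ : Fin n →₀ ℕ) (h : Fin n)
    (h2 : ∀ s, coeff s P ≠ 0 → s h ≤ d) : degreeOf h (hD μ P) ≤ d := by
  rw [degreeOf_le_iff]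
  intro s hs
  rw [mem_support_iff, coeff_hD] at hs
  have := h2 _ (right_ne_zero_of_mul hs)
  simp at this
  omega

theorem gauss (F : Polynomial ℤ) (hF : F ≠ 0) (p : ℤ) (q : ℕ) (hq : 0 < q)
    (hpq : IsCoprime p (q : ℤ)) (i : ℕ)
    (hi : ∀ j < i, (Polynomial.taylor ((p : ℚ) / q) (F.map (Int.castRingHom ℚ))).coeff j = 0) :
    q ^ i ≤ F.leadingCoeff.natAbs := by
  set ξ : ℚ := (p : ℚ) / q
  have hq' : (q : ℚ) ≠ 0 := by positivity
  set L : Polynomial ℤ := Polynomial.C (q : ℤ) * Polynomial.X + Polynomial.C (-p) with hL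
  have hLp : L.IsPrimitive := by
    intro r hr
    rw [Polynomial.C_dvd_iff_dvd_coeff] at hr
    have h0 := hr 0
    have h1 := hr (0 + 1)
    simp only [hL, Polynomial.coeff_add, Polynomial.coeff_C_mul, Polynomial.coeff_X_zero, Polynomial.coeff_X_one, Polynomial.coeff_C_zero, Polynomial.coeff_C_succ, mul_zero, zero_add, mul_one, add_zero, dvd_neg] at h0 h1
    exact hpq.isUnit_of_dvd' h0 h1
  have hX : (Polynomial.X : Polynomial ℚ) ^ i ∣ Polynomial.taylor ξ (F.map (Int.castRingHom ℚ)) :=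
    Polynomial.X_pow_dvd_iff.mpr hi
  have hX2 : (Polynomial.X - Polynomial.C ξ) ^ i ∣ F.map (Int.castRingHom ℚ) := by
    have := map_dvd (Polynomial.taylorAlgHom (-ξ)) hX
    rw [map_pow] at this
    change (Polynomial.taylor (-ξ) _) ^ i ∣ Polynomial.taylor (-ξ) (Polynomial.taylor ξ _) at this
    rw [Polynomial.taylor_taylor] at this
    simpa [sub_eq_add_neg] using this
  have hLm : L.map (Int.castRingHom ℚ) = Polynomial.C (q : ℚ) * (Polynomial.X - Polynomial.C ξ) := by
    rw [mul_sub, ← Polynomial.C_mul]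
    have : (q : ℚ) * ξ = p := by simp only [ξ]; field_simp
    rw [this]
    simp [hL, sub_eq_add_neg]
  have hdv : L ^ i ∣ F := by
    have hLi : ∀ i : ℕ, (L ^ i).IsPrimitive := by
      intro i
      induction i with
      | zero => rw [pow_zero]; exact Polynomial.isPrimitive_one
      | succ i ih => rw [pow_succ]; exact ih.mul hLp
    rw [Polynomial.IsPrimitive.Int.dvd_iff_map_cast_dvd_map_cast _ _ (hLi i)]
    rw [Polynomial.map_pow, hLm, mul_pow, ← Polynomial.C_pow]
    have hu : IsUnit (Polynomial.C ((q : ℚ) ^ i)) := Polynomial.isUnit_C.mpr (by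
      rw [isUnit_iff_ne_zero]; positivity)
    exact (IsUnit.mul_left_dvd hu).mpr hX2
  have hlc : L.leadingCoeff = q := by
    rw [hL, Polynomial.leadingCoeff_linear]
    exact_mod_cast hq.ne'
  have := Polynomial.leadingCoeff_dvd_leadingCoeff hdv
  rw [Polynomial.leadingCoeff_pow, hlc] at this
  have h3 := Int.natAbs_dvd_natAbs.mpr this
  rw [Int.natAbs_pow, Int.natAbs_natCast] at h3
  exact Nat.le_of_dvd (Int.natAbs_pos.mpr (Polynomial.leadingCoeff_ne_zero.mpr hF)) h3

theorem sum_max_ge (θ : ℝ) (h0 : 0 < θ) (h1 : θ ≤ 1) (k d : ℕ) (hd : 0 < d) (hk : k ≤ d + 1) :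
    k * θ ^ 2 / 8 ≤ ∑ l ∈ Finset.range k, max 0 (θ - l / d) := by
  have hd' : (0 : ℝ) < d := by exact_mod_cast hd
  set m := min k (⌊θ * d / 2⌋₊ + 1)
  have hm : θ * k / 4 ≤ m := by
    have hk' : (k : ℝ) ≤ 2 * d := by exact_mod_cast (by omega : k ≤ 2 * d)
    rw [show (m : ℝ) = min (k : ℝ) (⌊θ * d / 2⌋₊ + 1 : ℝ) by simp [m]]
    apply le_min
    · have : (0 : ℝ) ≤ k := Nat.cast_nonneg k
      nlinarith
    · have := Nat.lt_floor_add_one (θ * d / 2)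
      nlinarith
  calc k * θ ^ 2 / 8 = (θ * k / 4) * (θ / 2) := by ring
    _ ≤ m * (θ / 2) := by gcongr
    _ = ∑ l ∈ Finset.range m, θ / 2 := by simp
    _ ≤ ∑ l ∈ Finset.range m, max 0 (θ - l / d) := by
      refine Finset.sum_le_sum fun l hl => le_max_of_le_right ?_
      rw [Finset.mem_range] at hl
      have : l ≤ ⌊θ * d / 2⌋₊ := by omega
      have h2 : (l : ℝ) ≤ θ * d / 2 := (Nat.le_floor_iff (by positivity)).mp this
      have : (l : ℝ) / d ≤ θ / 2 := by rw [div_le_iff₀ hd']; linarith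
      linarith
    _ ≤ _ := Finset.sum_le_sum_of_subset_of_nonneg
      (Finset.range_subset_range.mpr (min_le_left _ _)) fun _ _ _ => le_max_left _ _

end norms
end RS

namespace RS
open MvPolynomial

theorem slice1 {n : ℕ} (W : MvPolynomial (Fin (n + 1)) ℤ) (U : MvPolynomial (Fin n) ℚ)
    (V : Polynomial ℚ) (hW : map (Int.castRingHom ℚ) W = box U V) (s : Fin n →₀ ℕ) :
    ∃ F : Polynomial ℤ, F.map (Int.castRingHom ℚ) = Polynomial.C (coeff s U) * V ∧
      ∀ a, |(F.coeff a : ℝ)| ≤ wn W := by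
  set F : Polynomial ℤ := ∑ a ∈ Finset.range (degreeOf 0 W + 1),
    Polynomial.monomial a (coeff (Finsupp.cons a s) W)
  have hF : ∀ a, F.coeff a = coeff (Finsupp.cons a s) W := by
    intro a
    simp only [F, Polynomial.finsetSum_coeff, Polynomial.coeff_monomial, Finset.sum_ite_eq',
      Finset.mem_range]
    split_ifs with h
    · rfl
    · by_contra hne
      have := monomial_le_degreeOf (0 : Fin (n + 1)) (mem_support_iff.mpr (Ne.symm hne))
      rw [Finsupp.cons_zero] at this
      omega
  refine ⟨F, ?_, fun a => ?_⟩
  · ext a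
    rw [Polynomial.coeff_map, hF, Polynomial.coeff_C_mul, ← coeff_box, ← hW, coeff_map]
  · rw [hF]; exact coeff_le_wn W _

theorem slice2 {n : ℕ} (W : MvPolynomial (Fin (n + 1)) ℤ) (U : MvPolynomial (Fin n) ℚ)
    (V : Polynomial ℚ) (hW : map (Int.castRingHom ℚ) W = box U V) (a : ℕ) :
    ∃ G : MvPolynomial (Fin n) ℤ, map (Int.castRingHom ℚ) G = C (V.coeff a) * U ∧
      ∀ t, coeff t G = coeff (Finsupp.cons a t) W := by
  refine ⟨(finSuccEquiv ℤ n W).coeff a, ?_, fun t => finSuccEquiv_coeff_coeff _ _ _⟩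
  ext t
  rw [coeff_map, finSuccEquiv_coeff_coeff, coeff_C_mul, mul_comm, ← coeff_box, ← hW, coeff_map]

/-- Roth's lemma in `n` variables. -/
def RothProp (n : ℕ) : Prop := ∀ ε : ℝ, 0 < ε → ∃ ω : ℝ, 0 < ω ∧
  ∀ (d : Fin n → ℕ), (∀ h, 0 < d h) → (∀ i j, i < j → (d i : ℝ) ≤ ω * d j) →
  ∀ (p : Fin n → ℤ) (q : Fin n → ℕ), (∀ h, 0 < q h) → (∀ h, IsCoprime (p h) (q h : ℤ)) →
  ∀ (B : ℝ), 1 ≤ B → (∀ h, Real.log B + ∑ h, (d h : ℝ) ≤ ω * (d h * Real.log (q h))) →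
  ∀ P : MvPolynomial (Fin n) ℤ, P ≠ 0 → (∀ s, |((coeff s P : ℤ) : ℝ)| ≤ B) →
  (∀ s, coeff s P ≠ 0 → ∀ h, s h ≤ d h) →
  ∃ k, coeff k (Tr (fun h => (p h : ℚ) / q h) (map (Int.castRingHom ℚ) P)) ≠ 0 ∧
    ∑ h, (k h : ℝ) / d h < ε

theorem roth_zero : RothProp 0 := by
  intro ε hε
  refine ⟨1, one_pos, ?_⟩
  intro d _ _ p q _ _ B _ _ P hP _ _
  set T := Tr (fun h => (p h : ℚ) / q h) (map (Int.castRingHom ℚ) P)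
  have hT : T ≠ 0 := by
    intro h
    apply hP
    have h1 := Tr_injective _ (h.trans (map_zero _).symm)
    exact map_injective _ Int.cast_injective (h1.trans (map_zero _).symm)
  obtain ⟨k, hk⟩ := ne_zero_iff.mp hT
  exact ⟨k, hk, by simpa using hε⟩

theorem log8 : Real.log 8 ≤ 3 := by
  have : (8 : ℝ) = 2 ^ 3 := by norm_num
  rw [this, Real.log_pow]
  have := Real.log_two_lt_d9
  push_cast
  linarith

theorem roth_step (n : ℕ) (IH : RothProp n) : RothProp (n + 1) := by
  intro ε0 hε0
  -- wlog ε ≤ 1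
  obtain ⟨ε, hε, hε1, hεε⟩ : ∃ ε : ℝ, 0 < ε ∧ ε ≤ 1 ∧ ε ≤ ε0 :=
    ⟨min ε0 1, lt_min hε0 one_pos, min_le_right _ _, min_le_left _ _⟩
  obtain ⟨ω', hω', IH⟩ := IH (ε ^ 2 / 64) (by positivity)
  obtain ⟨ω, hω, hω1, hω2⟩ : ∃ ω : ℝ, 0 < ω ∧ 4 * ω ≤ ω' ∧ ω ≤ ε ^ 2 / 256 :=
    ⟨min (ω' / 4) (ε ^ 2 / 256), lt_min (by positivity) (by positivity),
      by have := min_le_left (ω' / 4) (ε ^ 2 / 256); linarith, min_le_right _ _⟩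
  refine ⟨ω, hω, ?_⟩
  intro d hd hrat p q hq hpq B hB hlog P hP hPB hPd
  by_contra hcon
  push Not at hcon
  set ξ : Fin (n + 1) → ℚ := fun h => (p h : ℚ) / q h with hξ
  set PQ := map (Int.castRingHom ℚ) P with hPQ
  have hdpos : ∀ h, (0 : ℝ) < d h := fun h => by exact_mod_cast hd h
  have hIdx : Idx (fun h => (d h : ℝ)) ε (Tr ξ PQ) := fun k hk => hεε.trans (hcon k hk)
  have hPQ0 : PQ ≠ 0 := fun h => hP (map_injective _ Int.cast_injective (h.trans (map_zero _).symm))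
  obtain ⟨κ, _, _, φ, ψ, hk, hφ, hψ, hdec⟩ := decomp PQ (d 0) (by
    intro s hs
    apply hPd s
    intro h0; apply hs; rw [hPQ, coeff_map, h0, map_zero])
  obtain ⟨μ, hμ, hU⟩ := wronskian_mv φ hφ
  obtain ⟨ν, hν, hV⟩ := wronskian_poly ψ hψ
  set k := Fintype.card κ with hkdef
  have hk0 : 0 < k := by
    rw [hkdef, Fintype.card_pos_iff]
    by_contra hem
    rw [not_nonempty_iff] at hem
    apply hPQ0; rw [hdec]; simp
  have hkpos : (0 : ℝ) < k := by exact_mod_cast hk0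
  set U := (Matrix.of fun i j => hD (μ i) (φ j)).det with hUdef
  set V := (Matrix.of fun i j => Polynomial.hasseDeriv (ν i) (ψ j)).det with hVdef
  set M : Matrix κ κ (MvPolynomial (Fin (n + 1)) ℤ) :=
    Matrix.of fun i l => hD (Finsupp.cons (ν l) (μ i)) P with hM
  set W := M.det with hWdef
  -- W = U ⊠ V
  have hMQ : (MvPolynomial.map (Int.castRingHom ℚ)).mapMatrix M =
      Matrix.of fun i l => hD (Finsupp.cons (ν l) (μ i)) PQ := by
    ext1 i l
    simp [hM, hPQ, hD_map]
  have hW : MvPolynomial.map (Int.castRingHom ℚ) W = box U V := by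
    rw [hWdef, RingHom.map_det, hMQ]
    have : (Matrix.of fun i l => hD (Finsupp.cons (ν l) (μ i)) PQ) =
        ((rename Fin.succ : _ →ₐ[ℚ] MvPolynomial (Fin (n + 1)) ℚ).toRingHom.mapMatrix
          (Matrix.of fun i j => hD (μ i) (φ j))) *
        ((Polynomial.aeval (X 0 : MvPolynomial (Fin (n + 1)) ℚ)).toRingHom.mapMatrix
          (Matrix.of fun i j => Polynomial.hasseDeriv (ν i) (ψ j)).transpose) := by
      ext1 i l
      rw [Matrix.mul_apply]
      simp only [Matrix.of_apply, hdec, map_sum, hD_box]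
      rfl
    rw [this, Matrix.det_mul, ← RingHom.map_det, ← RingHom.map_det, Matrix.det_transpose]
    rfl
  -- index lower bound
  have hTW : Tr ξ (map (Int.castRingHom ℚ) W) =
      (Matrix.of fun i l => hD (Finsupp.cons (ν l) (μ i)) (Tr ξ PQ)).det := by
    rw [hWdef, RingHom.map_det, hMQ]
    have := AlgHom.map_det (Tr ξ) (Matrix.of fun i l => hD (Finsupp.cons (ν l) (μ i)) PQ)
    rw [this]
    congr 1
    ext1 i l
    simp [hD_Tr]
  set θ := ε - ω with hθ
  have hωε : ω ≤ ε / 256 := by nlinarith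
  have hθ1 : ε / 2 ≤ θ := by rw [hθ]; linarith
  have hμd : ∀ i, ∑ h : Fin n, ((μ i) h : ℝ) / d h.succ ≤ ω := by
    intro i
    have h1 : ∀ h : Fin n, ((μ i) h : ℝ) / d h.succ ≤ (μ i) h * (ω / d 0) := by
      intro h
      rw [div_eq_mul_inv]
      gcongr
      rw [inv_eq_one_div, div_le_div_iff₀ (hdpos _) (hdpos _), one_mul]
      exact hrat 0 h.succ (Fin.succ_pos h)
    refine (Finset.sum_le_sum fun h _ => h1 h).trans ?_
    rw [← Finset.sum_mul]
    have h2 : ∑ h : Fin n, ((μ i) h : ℝ) ≤ d 0 := by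
      have := hμ i
      rw [Finsupp.degree_eq_sum] at this
      have h3 : ∑ h, (μ i) h ≤ d 0 := by omega
      exact_mod_cast h3
    calc _ ≤ (d 0 : ℝ) * (ω / d 0) := by gcongr
      _ = ω := by field_simp [(hdpos 0).ne']
  have hWI : Idx (fun h => (d h : ℝ)) (∑ l, max 0 (θ - ν l / d 0)) (Tr ξ (map (Int.castRingHom ℚ) W)) := by
    rw [hTW]
    apply Idx.det (fun h => (hdpos h).le)
    intro i l
    apply Idx.max (fun h => (hdpos h).le)
    refine (hIdx.hD (Finsupp.cons (ν l) (μ i))).mono ?_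
    rw [Fin.sum_univ_succ]
    simp only [Finsupp.cons_zero, Finsupp.cons_succ]
    have := hμd i
    rw [hθ]; linarith
  have hνinj : Function.Injective ν := by
    intro i j hij
    by_contra hne
    apply hV
    exact Matrix.det_zero_of_row_eq hne (by ext1 x; simp [hij])
  have hsum : k * θ ^ 2 / 8 ≤ ∑ l, max 0 (θ - ν l / d 0) := by
    have e1 : Finset.univ.image ν = Finset.range k := by
      apply Finset.eq_of_subset_of_card_le
      · intro x hx
        obtain ⟨i, _, rfl⟩ := Finset.mem_image.mp hx
        exact Finset.mem_range.mpr (hν i)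
      · rw [Finset.card_image_of_injective _ hνinj]; simp [hkdef]
    have e2 : ∑ l, max 0 (θ - ν l / d 0) = ∑ x ∈ Finset.range k, max 0 (θ - x / d 0) := by
      rw [← e1, Finset.sum_image (fun a _ b _ h => hνinj h)]
    rw [e2]
    exact sum_max_ge θ (by linarith) (by linarith) k (d 0) (hd 0) hk
  -- norm of W
  set D := ∑ h, d h with hDdef
  have hDr : ∑ h, (d h : ℝ) = D := by rw [hDdef]; push_cast; rfl
  have hD0 : d 0 ≤ D := Finset.single_le_sum (f := d) (fun _ _ => Nat.zero_le _) (Finset.mem_univ 0)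
  set B' : ℝ := (8 ^ D * B) ^ k with hB'
  have hwW : wn W ≤ B' := by
    have h1 : ∀ i l, wn (M i l) ≤ 4 ^ D * B := by
      intro i l
      refine (wn_hD P d _ hPd).trans ?_
      have := wn_le_of_bound P d B (by linarith) hPB hPd
      calc _ ≤ (2 : ℝ) ^ D * (2 ^ D * B) := by gcongr
        _ = _ := by rw [← mul_assoc, ← mul_pow]; norm_num
    refine (wn_det M _ h1).trans ?_
    rw [hB', ← hkdef]
    have h2 : ((k.factorial : ℕ) : ℝ) ≤ (2 ^ D) ^ k := by
      have h3 : k.factorial ≤ k ^ k := Nat.factorial_le_pow k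
      have h4 : k ≤ 2 ^ D := hk.trans ((succ_le_two_pow _).trans (Nat.pow_le_pow_right (by norm_num) hD0))
      exact_mod_cast h3.trans (Nat.pow_le_pow_left h4 k)
    calc _ ≤ ((2 : ℝ) ^ D) ^ k * (4 ^ D * B) ^ k := by gcongr
      _ = _ := by rw [← mul_pow, ← mul_assoc, ← mul_pow]; norm_num
  have hlogB' : Real.log B' = k * (D * Real.log 8 + Real.log B) := by
    rw [hB', Real.log_pow, Real.log_mul (by positivity) (by positivity), Real.log_pow]
  have hlogB0 : 0 ≤ Real.log B := Real.log_nonneg hB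
  have hB'1 : 1 ≤ B' := by
    rw [hB']
    apply one_le_pow₀
    have : (1 : ℝ) ≤ 8 ^ D := one_le_pow₀ (by norm_num)
    nlinarith
  have hlogB'le : Real.log B' + k * D ≤ k * (4 * (Real.log B + D)) := by
    rw [hlogB']
    have := log8
    have hD' : (0 : ℝ) ≤ D := Nat.cast_nonneg _
    have : (D : ℝ) * Real.log 8 ≤ D * 3 := by gcongr
    nlinarith
  -- V part
  have hV0 : V ≠ 0 := hV
  have hU0 : U ≠ 0 := hU
  have hTV : Polynomial.taylor (ξ 0) V ≠ 0 := by
    intro h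
    exact hV0 (Polynomial.taylor_injective (ξ 0) (h.trans (map_zero _).symm))
  have hexi : ∃ i, (Polynomial.taylor (ξ 0) V).coeff i ≠ 0 := by
    by_contra hc
    push Not at hc
    exact hTV (Polynomial.ext (by simpa using hc))
  classical
  obtain ⟨i, hi, himin⟩ : ∃ i, (Polynomial.taylor (ξ 0) V).coeff i ≠ 0 ∧
      ∀ j < i, (Polynomial.taylor (ξ 0) V).coeff j = 0 :=
    ⟨Nat.find hexi, Nat.find_spec hexi, fun j hj => by simpa using Nat.find_min hexi hj⟩
  have hibound : (i : ℝ) / d 0 ≤ k * (4 * ω) := by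
    obtain ⟨s, hs⟩ := ne_zero_iff.mp hU0
    obtain ⟨F, hF1, hF2⟩ := slice1 W U V hW s
    have hF0 : F ≠ 0 := by
      rintro rfl
      rw [Polynomial.map_zero] at hF1
      exact mul_ne_zero (Polynomial.C_ne_zero.mpr hs) hV0 hF1.symm
    have hg := gauss F hF0 (p 0) (q 0) (hq 0) (hpq 0) i (by
      intro j hj
      rw [hF1]
      have : Polynomial.taylor (ξ 0) (Polynomial.C (coeff s U) * V) =
        Polynomial.C (coeff s U) * Polynomial.taylor (ξ 0) V := by
        rw [Polynomial.taylor_mul, Polynomial.taylor_C]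
      change (Polynomial.taylor (ξ 0) (Polynomial.C (coeff s U) * V)).coeff j = 0
      rw [this, Polynomial.coeff_C_mul, himin j hj, mul_zero])
    have hg2 : ((q 0 : ℝ)) ^ i ≤ B' := by
      refine le_trans ?_ ((hF2 F.natDegree).trans hwW)
      have : ((q 0 ^ i : ℕ) : ℝ) ≤ (F.leadingCoeff.natAbs : ℝ) := by exact_mod_cast hg
      rw [Nat.cast_natAbs] at this
      push_cast at this
      exact this
    have hq0 : (0 : ℝ) < q 0 := by exact_mod_cast hq 0
    have hl := Real.log_le_log (by positivity) hg2
    rw [Real.log_pow] at hl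
    have hl0 := hlog 0
    rw [hDr] at hl0
    have hDpos : (0 : ℝ) < D := by exact_mod_cast lt_of_lt_of_le (hd 0) hD0
    have hlq : 0 < Real.log (q 0) := by
      by_contra hc
      push Not at hc
      have : ω * (d 0 * Real.log (q 0)) ≤ 0 :=
        mul_nonpos_of_nonneg_of_nonpos hω.le (mul_nonpos_of_nonneg_of_nonpos (hdpos 0).le hc)
      linarith
    rw [div_le_iff₀ (hdpos 0)]
    have h5 : (i : ℝ) * Real.log (q 0) ≤ (k * (4 * ω) * d 0) * Real.log (q 0) := by
      have : (0 : ℝ) ≤ k * D := by positivity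
      calc (i : ℝ) * Real.log (q 0) ≤ k * (4 * (Real.log B + D)) := by linarith
        _ ≤ k * (4 * (ω * (d 0 * Real.log (q 0)))) := by gcongr
        _ = _ := by ring
    exact le_of_mul_le_mul_right h5 hlq
  -- U part
  obtain ⟨a, ha⟩ : ∃ a, V.coeff a ≠ 0 := by
    by_contra hc
    push Not at hc
    exact hV0 (Polynomial.ext (by simpa using hc))
  obtain ⟨G, hG1, hG2⟩ := slice2 W U V hW a
  have hG0 : G ≠ 0 := by
    rintro rfl
    rw [map_zero] at hG1
    exact mul_ne_zero (by simpa using ha) hU0 hG1.symm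
  obtain ⟨t, ht, htlt⟩ := IH (fun h => k * d h.succ) (fun h => Nat.mul_pos hk0 (hd _))
    (by
      intro i j hij
      push_cast
      have := hrat i.succ j.succ (Fin.succ_lt_succ_iff.mpr hij)
      have h2 : ω * (d j.succ : ℝ) ≤ ω' * d j.succ := by
        apply mul_le_mul_of_nonneg_right _ (hdpos _).le
        linarith
      calc (k : ℝ) * d i.succ ≤ k * (ω' * d j.succ) := by gcongr; linarith
        _ = _ := by ring)
    (fun h => p h.succ) (fun h => q h.succ) (fun h => hq _) (fun h => hpq _) B' hB'1
    (by
      intro h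
      have hl0 := hlog h.succ
      rw [hDr] at hl0
      have h6 : ∑ h : Fin n, (((k * d h.succ : ℕ)) : ℝ) ≤ k * D := by
        rw [← hDr, Fin.sum_univ_succ]
        push_cast
        rw [← Finset.mul_sum, mul_add]
        have : (0 : ℝ) ≤ k * d 0 := by positivity
        linarith
      have h7 : 0 ≤ (d h.succ : ℝ) * Real.log (q h.succ) :=
        mul_nonneg (hdpos _).le (Real.log_natCast_nonneg _)
      push_cast at h6 ⊢
      calc _ ≤ (k : ℝ) * (4 * (Real.log B + D)) := by linarith
        _ ≤ k * (4 * (ω * (d h.succ * Real.log (q h.succ)))) := by gcongr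
        _ = (4 * ω) * (k * (d h.succ * Real.log (q h.succ))) := by ring
        _ ≤ ω' * (k * (d h.succ * Real.log (q h.succ))) := by gcongr
        _ = _ := by ring)
    G hG0
    (fun s => by rw [hG2]; exact (coeff_le_wn W _).trans hwW)
    (by
      intro s hs h
      rw [hG2] at hs
      have h1 := monomial_le_degreeOf h.succ (mem_support_iff.mpr hs)
      rw [Finsupp.cons_succ] at h1
      refine h1.trans ?_
      exact degreeOf_det M h.succ (d h.succ) (fun i l => degreeOf_hD P _ _ _ (fun s hs => hPd s hs _)))
  -- combine
  have hTG : coeff t (Tr (fun h : Fin n => ξ h.succ) U) ≠ 0 := by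
    intro h0
    apply ht
    rw [hG1, map_mul]
    have : Tr (fun h : Fin n => ((p h.succ : ℚ) / q h.succ)) (C (V.coeff a)) = C (V.coeff a) := by
      simp [Tr]
    rw [this, coeff_C_mul]
    change V.coeff a * coeff t (Tr (fun h : Fin n => ξ h.succ) U) = 0
    rw [h0, mul_zero]
  have hfin := hWI (Finsupp.cons i t) (by
    rw [hW, Tr_box, coeff_box]
    exact mul_ne_zero hTG hi)
  rw [Fin.sum_univ_succ] at hfin
  simp only [Finsupp.cons_zero, Finsupp.cons_succ] at hfin
  have h8 : ∑ h : Fin n, (t h : ℝ) / d h.succ < k * (ε ^ 2 / 64) := by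
    have : ∑ h : Fin n, (t h : ℝ) / d h.succ = k * ∑ h : Fin n, (t h : ℝ) / ((k * d h.succ : ℕ) : ℝ) := by
      rw [Finset.mul_sum]
      refine Finset.sum_congr rfl fun h _ => ?_
      push_cast
      have := hdpos h.succ
      field_simp
    rw [this]
    exact mul_lt_mul_of_pos_left htlt hkpos
  have h9 : k * (ε ^ 2 / 32) ≤ k * θ ^ 2 / 8 := by
    have : (ε / 2) ^ 2 ≤ θ ^ 2 := by gcongr
    rw [mul_div_assoc]
    apply mul_le_mul_of_nonneg_left _ hkpos.le
    nlinarith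
  have h10 : (k : ℝ) * (4 * ω) ≤ k * (ε ^ 2 / 64) := by gcongr; linarith
  have h11 : (k : ℝ) * (ε ^ 2 / 32) = k * (ε ^ 2 / 64) + k * (ε ^ 2 / 64) := by ring
  linarith

theorem roth (n : ℕ) : RothProp n := by
  induction n with
  | zero => exact roth_zero
  | succ n ih => exact roth_step n ih

end RS

namespace RS
open Finset

/-- exponents of degree `d` in three variables -/
def Del (d : ℕ) : Finset (Fin 3 → ℕ) := piAntidiag univ d

theorem mem_Del {d : ℕ} {x : Fin 3 → ℕ} : x ∈ Del d ↔ ∑ i, x i = d := by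
  simp [Del]

theorem sum_Del_perm (d : ℕ) (i j : Fin 3) : ∑ x ∈ Del d, x i = ∑ x ∈ Del d, x j := by
  refine sum_bij' (fun x _ => x ∘ Equiv.swap i j) (fun x _ => x ∘ Equiv.swap i j) ?_ ?_ ?_ ?_ ?_
  · intro x hx
    rw [mem_Del] at hx ⊢
    rw [← hx]
    exact Equiv.sum_comp (Equiv.swap i j) x
  · intro x hx
    rw [mem_Del] at hx ⊢
    rw [← hx]
    exact Equiv.sum_comp (Equiv.swap i j) x
  · intro x _; ext; simp
  · intro x _; ext; simp
  · intro x _; simp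

theorem mean_Del (d : ℕ) (hd : 0 < d) (i : Fin 3) :
    ∑ x ∈ Del d, ((x i : ℝ) / d - 1 / 3) = 0 := by
  have h1 : 3 * ∑ x ∈ Del d, x i = d * (Del d).card := by
    have : ∑ j : Fin 3, ∑ x ∈ Del d, x j = d * (Del d).card := by
      rw [sum_comm]
      rw [sum_congr rfl (fun x hx => mem_Del.mp hx)]
      simp [mul_comm]
    rw [← this, sum_congr rfl (fun j _ => sum_Del_perm d j i)]
    simp
  have h2 : (3 : ℝ) * ∑ x ∈ Del d, (x i : ℝ) = d * (Del d).card := by exact_mod_cast h1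
  have hd' : (0 : ℝ) < d := by exact_mod_cast hd
  rw [sum_sub_distrib, ← sum_div]
  simp only [sum_const, nsmul_eq_mul]
  field_simp
  linarith

theorem variance_pi {m : ℕ} {β : Type*} [DecidableEq β] (A : Fin m → Finset β) (f : Fin m → β → ℝ)
    (h0 : ∀ h, ∑ x ∈ A h, f h x = 0) (h1 : ∀ h, ∀ x ∈ A h, |f h x| ≤ 1) :
    ∑ s ∈ Fintype.piFinset A, (∑ h, f h (s h)) ^ 2 ≤ m * (Fintype.piFinset A).card := by
  have cross : ∀ h h', h ≠ h' → ∑ s ∈ Fintype.piFinset A, f h (s h) * f h' (s h') = 0 := by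
    intro h h' hne
    set g : Fin m → β → ℝ := fun x => if x = h then f h else if x = h' then f h' else 1
    have e : ∀ s : Fin m → β, f h (s h) * f h' (s h') = ∏ x, g x (s x) := by
      intro s
      rw [← mul_prod_erase _ _ (mem_univ h), ← mul_prod_erase _ _ (mem_erase.mpr ⟨hne.symm, mem_univ h'⟩)]
      rw [prod_eq_one]
      · simp [g, hne.symm]
      · intro x hx
        simp only [mem_erase] at hx
        simp [g, hx.1, hx.2.1]
    simp only [e]
    rw [← prod_univ_sum]
    apply prod_eq_zero (mem_univ h)
    simpa [g] using h0 h
  have e2 : ∑ s ∈ Fintype.piFinset A, (∑ h, f h (s h)) ^ 2 =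
      ∑ h, ∑ h', ∑ s ∈ Fintype.piFinset A, f h (s h) * f h' (s h') := by
    simp only [sq, sum_mul_sum]
    rw [sum_comm]
    refine sum_congr rfl fun h _ => ?_
    rw [sum_comm]
  rw [e2]
  have : ∀ h, ∑ h', ∑ s ∈ Fintype.piFinset A, f h (s h) * f h' (s h') ≤ (Fintype.piFinset A).card := by
    intro h
    rw [sum_eq_single h (fun h' _ hne => cross h h' hne.symm) (by simp)]
    calc _ ≤ ∑ s ∈ Fintype.piFinset A, (1 : ℝ) := by
          refine sum_le_sum fun s hs => ?_
          have := h1 h (s h) (Fintype.mem_piFinset.mp hs h)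
          rw [← sq, ← sq_abs]
          have h3 := abs_nonneg (f h (s h))
          nlinarith
      _ = _ := by simp
  refine (sum_le_sum fun h _ => this h).trans ?_
  simp

/-- all exponents -/
def Ind {m : ℕ} (d : Fin m → ℕ) : Finset (Fin m → Fin 3 → ℕ) := Fintype.piFinset fun h => Del (d h)

/-- good exponents -/
def Good {m : ℕ} (d : Fin m → ℕ) (ε : ℝ) (s : Fin m → Fin 3 → ℕ) : Prop :=
  ∀ i, |∑ h, (s h i : ℝ) / d h - m / 3| ≤ ε * m

open Classical in
theorem bad_count {m : ℕ} (hm : 0 < m) (d : Fin m → ℕ) (hd : ∀ h, 0 < d h) (ε : ℝ) (hε : 0 < ε) :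
    (((Ind d).filter fun s => ¬ Good d ε s).card : ℝ) * (ε ^ 2 * m) ≤ 3 * (Ind d).card := by
  have hm' : (0 : ℝ) < m := by exact_mod_cast hm
  have one : ∀ i : Fin 3, (((Ind d).filter fun s => ¬ |∑ h, (s h i : ℝ) / d h - m / 3| ≤ ε * m).card : ℝ)
      * (ε * m) ^ 2 ≤ m * (Ind d).card := by
    intro i
    have hv := variance_pi (fun h => Del (d h)) (fun h x => (x i : ℝ) / d h - 1 / 3)
      (fun h => mean_Del (d h) (hd h) i) (by
        intro h x hx
        have h1 : x i ≤ d h := by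
          rw [← mem_Del.mp hx]
          exact single_le_sum (f := x) (fun _ _ => Nat.zero_le _) (mem_univ i)
        have h2 : (x i : ℝ) ≤ d h := by exact_mod_cast h1
        have hdp : (0 : ℝ) < d h := by exact_mod_cast hd h
        have h3 : (x i : ℝ) / d h ≤ 1 := by rw [div_le_one hdp]; exact h2
        have h4 : 0 ≤ (x i : ℝ) / d h := by positivity
        rw [abs_le]; constructor <;> linarith)
    refine le_trans ?_ hv
    rw [← nsmul_eq_mul, ← sum_const]
    refine le_trans ?_ (sum_le_sum_of_subset_of_nonneg (filter_subset (fun s => ¬ |∑ h, (s h i : ℝ) / d h - m / 3| ≤ ε * m) (Ind d)) (fun _ _ _ => sq_nonneg _))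
    refine sum_le_sum fun s hs => ?_
    have h5 := (mem_filter.mp hs).2
    push Not at h5
    have e : ∑ h, ((s h i : ℝ) / d h - 1 / 3) = ∑ h, (s h i : ℝ) / d h - m / 3 := by
      rw [sum_sub_distrib]; simp; ring
    rw [e, ← sq_abs (_ - _)]
    have : 0 ≤ ε * m := by positivity
    gcongr
  have hsub : ((Ind d).filter fun s => ¬ Good d ε s) ⊆
      univ.biUnion fun i : Fin 3 => (Ind d).filter fun s => ¬ |∑ h, (s h i : ℝ) / d h - m / 3| ≤ ε * m := by
    intro s hs
    rw [mem_filter] at hs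
    unfold Good at hs
    push Not at hs
    obtain ⟨h1, i, hi⟩ := hs
    rw [mem_biUnion]
    exact ⟨i, mem_univ _, mem_filter.mpr ⟨h1, not_le.mpr hi⟩⟩
  have hc : (((Ind d).filter fun s => ¬ Good d ε s).card : ℝ) ≤
      ∑ i : Fin 3, (((Ind d).filter fun s => ¬ |∑ h, (s h i : ℝ) / d h - m / 3| ≤ ε * m).card : ℝ) := by
    exact_mod_cast (card_le_card hsub).trans card_biUnion_le
  have h6 : (((Ind d).filter fun s => ¬ Good d ε s).card : ℝ) * (ε * m) ^ 2 ≤ 3 * (m * (Ind d).card) := by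
    calc _ ≤ (∑ i : Fin 3, (((Ind d).filter fun s => ¬ |∑ h, (s h i : ℝ) / d h - m / 3| ≤ ε * m).card : ℝ)) * (ε * m) ^ 2 := by gcongr
      _ ≤ ∑ i : Fin 3, (m * (Ind d).card : ℝ) := by
        rw [sum_mul]; exact sum_le_sum fun i _ => one i
      _ = _ := by simp
  have h7 : m * ((((Ind d).filter fun s => ¬ Good d ε s).card : ℝ) * (ε ^ 2 * m)) ≤ m * (3 * (Ind d).card) := by
    calc _ = (((Ind d).filter fun s => ¬ Good d ε s).card : ℝ) * (ε * m) ^ 2 := by ring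
      _ ≤ _ := h6.trans (by linarith)
  exact le_of_mul_le_mul_left h7 hm'

theorem card_Ind_pos {m : ℕ} (d : Fin m → ℕ) : 0 < (Ind d).card := by
  rw [card_pos]
  refine ⟨fun h => ![d h, 0, 0], ?_⟩
  rw [Ind, Fintype.mem_piFinset]
  intro h
  rw [mem_Del]; simp [Fin.sum_univ_three]

theorem card_Ind_le {m : ℕ} (d : Fin m → ℕ) : (Ind d).card ≤ 4 ^ (∑ h, d h) := by
  rw [Ind, Fintype.card_piFinset, ← prod_pow_eq_pow_sum]
  refine prod_le_prod' fun h _ => ?_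
  have : (Del (d h)).card ≤ (range (d h + 1) ×ˢ range (d h + 1)).card := by
    apply card_le_card_of_injOn (fun x : Fin 3 → ℕ => (x 0, x 1))
    · intro x hx
      have := mem_Del.mp (mem_coe.mp hx)
      rw [Fin.sum_univ_three] at this
      simp only [coe_product, coe_range, Set.mem_prod, Set.mem_Iio]
      omega
    · intro x hx y hy hxy
      have h1 := mem_Del.mp (mem_coe.mp hx)
      have h2 := mem_Del.mp (mem_coe.mp hy)
      rw [Fin.sum_univ_three] at h1 h2
      simp only [Prod.mk.injEq] at hxy
      ext i
      fin_cases i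
      · exact hxy.1
      · exact hxy.2
      · simp; omega
  refine this.trans ?_
  rw [card_product, card_range]
  have := succ_le_two_pow (d h)
  calc _ ≤ 2 ^ d h * 2 ^ d h := Nat.mul_le_mul this this
    _ = _ := by rw [← mul_pow]; norm_num

end RS

namespace RS
open Finset MvPolynomial

/-- exponent vector of a family of triples -/
noncomputable def fs {m : ℕ} (s : Fin m → Fin 3 → ℕ) : (Fin m × Fin 3) →₀ ℕ :=
  Finsupp.equivFunOnFinite.symm (fun p => s p.1 p.2)

@[simp] theorem fs_apply {m : ℕ} (s : Fin m → Fin 3 → ℕ) (p) : fs s p = s p.1 p.2 := rfl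

theorem fs_injective {m : ℕ} : Function.Injective (fs (m := m)) := by
  intro s t h
  ext a b
  have := DFunLike.congr_fun h (a, b)
  simpa using this

theorem fs_curry {m : ℕ} (t : (Fin m × Fin 3) →₀ ℕ) : fs (fun h i => t (h, i)) = t := by
  ext p; simp

section Sub
variable {m : ℕ} {R R' : Type*} [CommRing R] [CommRing R']

/-- linear substitution in each block -/
noncomputable def Sub (M : Fin m → Matrix (Fin 3) (Fin 3) R) :
    MvPolynomial (Fin m × Fin 3) R →ₐ[R] MvPolynomial (Fin m × Fin 3) R :=
  aeval (fun p => ∑ j, C (M p.1 p.2 j) * X (p.1, j))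

theorem Sub_Sub (M N : Fin m → Matrix (Fin 3) (Fin 3) R) (P) :
    Sub N (Sub M P) = Sub (fun h => M h * N h) P := by
  suffices this : (Sub N).comp (Sub M) = Sub (fun h => M h * N h) by
    exact DFunLike.congr_fun this P
  apply MvPolynomial.algHom_ext
  intro p
  simp only [Sub, AlgHom.comp_apply, aeval_X, map_sum, map_mul, algHom_C, algebraMap_eq, Matrix.mul_apply,
    Finset.sum_mul, Finset.mul_sum]
  rw [sum_comm]
  simp [mul_assoc]

theorem Sub_map (f : R →+* R') (M : Fin m → Matrix (Fin 3) (Fin 3) R) (P) :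
    map f (Sub M P) = Sub (fun h => (M h).map f) (map f P) := by
  induction P using MvPolynomial.induction_on with
  | C a => simp [Sub]
  | add p q hp hq => simp [hp, hq]
  | mul_X p i hp => simp [hp]; congr 1; simp [Sub]

theorem wnorm_Sub_le (N : RingSeminorm R) (h1 : N 1 ≤ 1) (x : Fin m × Fin 3 → ℝ) (hx : ∀ p, 0 ≤ x p)
    (M : Fin m → Matrix (Fin 3) (Fin 3) R) (P) :
    wnorm N x (Sub M P) ≤ wnorm N (fun p => ∑ j, N (M p.1 p.2 j) * x (p.1, j)) P := by
  have key : Sub M P = ∑ s ∈ P.support, C (coeff s P) *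
      ∏ p, (∑ j, C (M p.1 p.2 j) * X (p.1, j)) ^ (s p) := by
    conv_lhs => rw [P.as_sum]
    rw [map_sum]
    refine sum_congr rfl fun s _ => ?_
    rw [Sub, aeval_monomial, algebraMap_eq, Finsupp.prod_fintype]
    simp
  rw [key]
  refine (wnorm_sum_le N x hx _ _).trans ?_
  unfold wnorm
  refine sum_le_sum fun s _ => ?_
  refine (wnorm_mul_le N x hx _ _).trans ?_
  have e : wnorm N x (C (coeff s P)) = N (coeff s P) := by
    rw [← monomial_zero', wnorm_monomial]; simp
  have := (wnorm_prod_le N x h1 hx univ fun p : Fin m × Fin 3 =>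
      (∑ j, C (M p.1 p.2 j) * X (p.1, j)) ^ (s p))
  unfold wnorm at e this ⊢
  rw [e]
  refine mul_le_mul_of_nonneg_left ?_ (apply_nonneg N _)
  refine this.trans ?_
  refine prod_le_prod (fun p _ => wnorm_nonneg N x hx _) fun p _ => ?_
  refine (wnorm_pow_le N x h1 hx _ _).trans ?_
  refine pow_le_pow_left₀ (wnorm_nonneg N x hx _) ?_ _
  refine (wnorm_sum_le N x hx _ _).trans ?_
  refine sum_le_sum fun j _ => ?_
  exact (wnorm_CX_le N x hx _ _).le

/-- multihomogeneous of multidegree d -/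
def MH (d : Fin m → ℕ) (P : MvPolynomial (Fin m × Fin 3) R) : Prop :=
  IsWeightedHomogeneous (fun p : Fin m × Fin 3 => (Pi.single p.1 1 : Fin m → ℕ)) P d

theorem weight_fs (s : Fin m × Fin 3 →₀ ℕ) (h : Fin m) :
    Finsupp.weight (fun p : Fin m × Fin 3 => (Pi.single p.1 1 : Fin m → ℕ)) s h = ∑ i, s (h, i) := by
  rw [Finsupp.weight_apply, Finsupp.sum_fintype _ _ (by simp)]
  simp only [Finset.sum_apply, Pi.smul_apply, smul_eq_mul]
  rw [Fintype.sum_prod_type, sum_eq_single h]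
  · simp
  · intro b _ hb
    refine sum_eq_zero fun i _ => ?_
    simp [Pi.single_apply, hb.symm]
  · simp

theorem MH_iff (d : Fin m → ℕ) (P : MvPolynomial (Fin m × Fin 3) R) :
    MH d P ↔ ∀ s, coeff s P ≠ 0 → (fun h i => s (h, i)) ∈ Ind d := by
  unfold MH IsWeightedHomogeneous
  refine forall_congr' fun s => imp_congr_right fun _ => ?_
  rw [Ind, Fintype.mem_piFinset]
  simp only [mem_Del]
  rw [funext_iff]
  simp only [weight_fs]

theorem MH_Sub (d : Fin m → ℕ) (M : Fin m → Matrix (Fin 3) (Fin 3) R) (P) (hP : MH d P) : MH d (Sub M P) := by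
  rw [P.as_sum, map_sum]
  refine IsWeightedHomogeneous.sum _ _ _ fun s hs => ?_
  rw [Sub, aeval_monomial, algebraMap_eq, Finsupp.prod]
  have hw := hP (mem_support_iff.mp hs)
  rw [← zero_add d]
  refine IsWeightedHomogeneous.mul (isWeightedHomogeneous_C _ _) ?_
  rw [← hw, Finsupp.weight_apply, Finsupp.sum]
  refine IsWeightedHomogeneous.prod _ _ _ fun p _ => ?_
  refine IsWeightedHomogeneous.pow ?_ _
  refine IsWeightedHomogeneous.sum _ _ _ fun j _ => ?_
  rw [← zero_add (Pi.single p.1 1)]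
  exact IsWeightedHomogeneous.mul (isWeightedHomogeneous_C _ _) (isWeightedHomogeneous_X R (fun p : Fin m × Fin 3 => (Pi.single p.1 1 : Fin m → ℕ)) (p.1, j))

end Sub
end RS

namespace RS
open Finset MvPolynomial

section Siegel
attribute [local instance] Matrix.seminormedAddCommGroup
variable {S : Type*} [CommRing S]

/-- bound for substitutions -/
noncomputable def C1of (N : RingSeminorm S) (Γ : Matrix (Fin 3) (Fin 3) S) : ℝ := 1 + ∑ i, ∑ j, N (Γ i j)

theorem one_le_C1of (N : RingSeminorm S) (Γ : Matrix (Fin 3) (Fin 3) S) : 1 ≤ C1of N Γ := by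
  unfold C1of
  have : 0 ≤ ∑ i, ∑ j, N (Γ i j) := sum_nonneg fun i _ => sum_nonneg fun j _ => apply_nonneg N _
  linarith

theorem sum_fs {m : ℕ} {d : Fin m → ℕ} {s : Fin m → Fin 3 → ℕ} (hs : s ∈ Ind d) :
    ∑ p, fs s p = ∑ h, d h := by
  rw [Fintype.sum_prod_type]
  refine sum_congr rfl fun h _ => ?_
  simpa using mem_Del.mp (Fintype.mem_piFinset.mp hs h)

theorem N_coeff_Sub_le {m : ℕ} (N : RingSeminorm S) (h1 : N 1 ≤ 1) (Γ : Matrix (Fin 3) (Fin 3) S)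
    (d : Fin m → ℕ) (κ) (hκ : κ ∈ Ind d) (t) :
    N (coeff t (Sub (fun _ => Γ) (monomial (fs κ) 1))) ≤ C1of N Γ ^ (∑ h, d h) := by
  have h0 : ∀ p : Fin m × Fin 3, (0:ℝ) ≤ (fun _ => 1 : Fin m × Fin 3 → ℝ) p := fun _ => zero_le_one
  have := coeff_le_wnorm N (fun _ => 1) h0 (Sub (fun _ : Fin m => Γ) (monomial (fs κ) 1)) t
  simp only [one_pow, prod_const_one, mul_one] at this
  refine this.trans ((wnorm_Sub_le N h1 _ h0 _ _).trans ?_)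
  rw [wnorm_monomial]
  calc _ ≤ 1 * ∏ p, C1of N Γ ^ (fs κ p) := by
        refine mul_le_mul h1 ?_ (prod_nonneg fun p _ => pow_nonneg (sum_nonneg fun j _ => by simp [apply_nonneg]) _) zero_le_one
        refine prod_le_prod (fun p _ => pow_nonneg (sum_nonneg fun j _ => by simp [apply_nonneg]) _) fun p _ => ?_
        refine pow_le_pow_left₀ (sum_nonneg fun j _ => by simp [apply_nonneg]) ?_ _
        have := single_le_sum (f := fun i => ∑ j, N (Γ i j)) (fun i _ => sum_nonneg fun j _ => apply_nonneg N _) (mem_univ p.2)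
        unfold C1of
        have this : ∑ j, N (Γ p.2 j) ≤ ∑ i, ∑ j, N (Γ i j) := this
        have e : ∑ j, N ((fun _ : Fin m => Γ) p.1 p.2 j) * 1 = ∑ j, N (Γ p.2 j) := by simp only [mul_one]
        rw [e]
        linarith
    _ = _ := by rw [one_mul, prod_pow_eq_pow_sum, sum_fs hκ]

open Classical in
theorem siegel {K : Type*} [Fintype K] [Nonempty K] (N : RingSeminorm S) (h1 : N 1 ≤ 1)
    (f : K → S →+ ℤ) (hinj : ∀ x, (∀ k, f k x = 0) → x = 0) (hf : ∀ k x, |(f k x : ℝ)| ≤ N x)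
    (Γ : Matrix (Fin 3) (Fin 3) S) {m : ℕ} (hm : 0 < m) (ε : ℝ) (hε : 0 < ε)
    (hmε : 6 * (Fintype.card K : ℝ) ≤ ε ^ 2 * m)
    (d : Fin m → ℕ) (hd : ∀ h, 0 < d h) :
    ∃ P : MvPolynomial (Fin m × Fin 3) ℤ, P ≠ 0 ∧ MH d P ∧
      (∀ s, |((coeff s P : ℤ) : ℝ)| ≤ (4 * C1of N Γ) ^ (∑ h, d h)) ∧
      ∀ s ∈ Ind d, ¬ Good d ε s → coeff (fs s) (Sub (fun _ => Γ) (map (Int.castRingHom S) P)) = 0 := by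
  set bad := (Ind d).filter fun s => ¬ Good d ε s with hbad
  have hC := one_le_C1of N Γ
  have hbig : (1:ℝ) ≤ (4 * C1of N Γ) ^ (∑ h, d h) := one_le_pow₀ (by linarith)
  -- it suffices to find coefficients
  suffices H : ∃ t : Ind d → ℤ, t ≠ 0 ∧ (∀ κ, |((t κ : ℤ) : ℝ)| ≤ (4 * C1of N Γ) ^ (∑ h, d h)) ∧
      ∀ s ∈ bad, ∀ k, ∑ κ : Ind d, f k (coeff (fs s) (Sub (fun _ => Γ) (monomial (fs κ.1) 1))) * t κ = 0 by
    obtain ⟨t, ht0, htb, hts⟩ := H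
    set P : MvPolynomial (Fin m × Fin 3) ℤ := ∑ κ : Ind d, monomial (fs κ.1) (t κ) with hP
    have hc : ∀ κ : Ind d, coeff (fs κ.1) P = t κ := by
      intro κ
      rw [hP, coeff_sum, sum_eq_single κ]
      · simp
      · intro b _ hb
        rw [coeff_monomial, if_neg]
        intro h
        exact hb (Subtype.ext (fs_injective h))
      · simp
    have hc0 : ∀ s, coeff s P ≠ 0 → ∃ κ : Ind d, fs κ.1 = s := by
      intro s hs
      by_contra hcon
      push Not at hcon
      apply hs
      rw [hP, coeff_sum]
      refine sum_eq_zero fun κ _ => ?_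
      rw [coeff_monomial, if_neg (hcon κ)]
    refine ⟨P, ?_, ?_, ?_, ?_⟩
    · intro h0
      apply ht0
      ext κ
      rw [← hc κ, h0]; simp
    · rw [MH_iff]
      intro s hs
      obtain ⟨κ, hκ⟩ := hc0 s hs
      rw [← hκ]
      exact κ.2
    · intro s
      by_cases hs : coeff s P = 0
      · rw [hs]; simp; linarith
      · obtain ⟨κ, hκ⟩ := hc0 s hs
        rw [← hκ, hc]
        exact htb κ
    · intro s hs hg
      apply hinj
      intro k
      rw [← hts s (mem_filter.mpr ⟨hs, hg⟩) k, hP, map_sum, map_sum, coeff_sum, map_sum]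
      refine sum_congr rfl fun κ _ => ?_
      have : map (Int.castRingHom S) (monomial (fs κ.1) (t κ)) = (t κ) • monomial (fs κ.1) (1:S) := by
        rw [map_monomial, smul_monomial]; simp
      rw [this, map_zsmul]
      have : coeff (fs s) (t κ • Sub (fun _ => Γ) (monomial (fs κ.1) (1:S))) =
        t κ • coeff (fs s) (Sub (fun _ => Γ) (monomial (fs κ.1) (1:S))) := by
        rw [← coeffAddMonoidHom_apply, map_zsmul]; rfl
      rw [this, map_zsmul, smul_eq_mul, mul_comm]
  have hcardI : Fintype.card (Ind d) = (Ind d).card := by simp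
  have hne : Nonempty (Ind d) := by
    obtain ⟨x, hx⟩ := card_pos.mp (card_Ind_pos d)
    exact ⟨⟨x, hx⟩⟩
  have hcnt := bad_count hm d hd ε hε
  rw [← hbad] at hcnt
  have h2 : (bad.card : ℝ) * Fintype.card K * 2 ≤ (Ind d).card := by
    have : (bad.card : ℝ) * (6 * Fintype.card K) ≤ bad.card * (ε ^ 2 * m) :=
      mul_le_mul_of_nonneg_left hmε (Nat.cast_nonneg _)
    linarith
  rcases bad.eq_empty_or_nonempty with hemp | hnonemp
  · refine ⟨fun _ => 1, ?_, ?_, ?_⟩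
    · intro h
      have := congrFun h (Classical.choice hne)
      simp at this
    · intro κ; simpa using hbig
    · rw [hemp]; simp
  have hcardA : Fintype.card (bad × K) = bad.card * Fintype.card K := by simp
  set A : Matrix (bad × K) (Ind d) ℤ := fun r κ => f r.2 (coeff (fs r.1.1) (Sub (fun _ => Γ) (monomial (fs κ.1) 1))) with hA
  have hpA : 0 < Fintype.card (bad × K) := by
    rw [hcardA]; exact Nat.mul_pos (card_pos.mpr hnonemp) Fintype.card_pos
  have h3 : 2 * Fintype.card (bad × K) ≤ Fintype.card (Ind d) := by
    rw [hcardA, hcardI]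
    have : 2 * (bad.card * Fintype.card K) ≤ (Ind d).card := by
      have h4 : (2:ℝ) * (bad.card * Fintype.card K) ≤ (Ind d).card := by linarith
      exact_mod_cast h4
    exact this
  obtain ⟨t, ht0, hAt, htn⟩ := Int.Matrix.exists_ne_zero_int_vec_norm_le A (by omega) hpA
  refine ⟨t, ht0, ?_, ?_⟩
  · intro κ
    have e1 : |((t κ : ℤ) : ℝ)| ≤ ‖t‖ := by
      rw [← Int.norm_eq_abs]; exact norm_le_pi_norm t κ
    refine e1.trans (htn.trans ?_)
    have hAn : ‖A‖ ≤ C1of N Γ ^ (∑ h, d h) := by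
      rw [Matrix.norm_le_iff (by positivity)]
      intro r κ
      rw [Int.norm_eq_abs]
      refine (hf _ _).trans (N_coeff_Sub_le N h1 Γ d κ.1 κ.2 _)
    have hn : ((Fintype.card (Ind d) : ℕ) : ℝ) ≤ 4 ^ (∑ h, d h) := by
      rw [hcardI]; exact_mod_cast card_Ind_le d
    have hbase : (Fintype.card (Ind d) : ℝ) * max 1 ‖A‖ ≤ (4 * C1of N Γ) ^ (∑ h, d h) := by
      rw [mul_pow]
      exact mul_le_mul hn (max_le (one_le_pow₀ hC) hAn) (by positivity) (by positivity)
    have h1n : (1:ℝ) ≤ Fintype.card (Ind d) := by exact_mod_cast Fintype.card_pos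
    have hbase1 : 1 ≤ (Fintype.card (Ind d) : ℝ) * max 1 ‖A‖ :=
      one_le_mul_of_one_le_of_one_le h1n (le_max_left _ _)
    calc _ ≤ ((Fintype.card (Ind d) : ℝ) * max 1 ‖A‖) ^ (1:ℝ) := by
          refine Real.rpow_le_rpow_of_exponent_le hbase1 ?_
          have h3' : (2:ℝ) * Fintype.card (bad × K) ≤ Fintype.card (Ind d) := by exact_mod_cast h3
          have hp' : (0:ℝ) < Fintype.card (bad × K) := by exact_mod_cast hpA
          rw [div_le_one (by linarith)]
          linarith
      _ ≤ _ := by rw [Real.rpow_one]; exact hbase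
  · intro s hs k
    have := congrFun hAt (⟨s, hs⟩, k)
    simpa [Matrix.mulVec, dotProduct, hA] using this

end Siegel

section Norm
variable (S : Type*) [CommRing S] [Nontrivial S] [Module.Free ℤ S] [Module.Finite ℤ S]

attribute [local instance] Matrix.linftyOpNormedRing in
theorem exists_norm : ∃ (N : RingSeminorm S) (K : Type) (_ : Fintype K) (_ : Nonempty K) (f : K → S →+ ℤ),
    N 1 ≤ 1 ∧ (∀ x, (∀ k, f k x = 0) → x = 0) ∧ (∀ k x, |(f k x : ℝ)| ≤ N x) := by
  classical
  let n := Module.finrank ℤ S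
  let b : Module.Basis (Fin n) ℤ S := Module.finBasis ℤ S
  let ψ := Algebra.leftMulMatrix b
  have hn : 0 < n := Module.finrank_pos
  haveI : Nonempty (Fin n) := ⟨⟨0, hn⟩⟩
  refine ⟨{ toFun := fun x => ‖ψ x‖
            map_zero' := by simp
            add_le' := fun x y => by rw [map_add]; exact norm_add_le _ _
            mul_le' := fun x y => by rw [map_mul]; exact norm_mul_le _ _
            neg' := fun x => by rw [map_neg, norm_neg] }, Fin n × Fin n, inferInstance, inferInstance,
        fun k => ((Matrix.entryAddMonoidHom ℤ k.1 k.2).comp ψ.toLinearMap.toAddMonoidHom : S →+ ℤ), ?_, ?_, ?_⟩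
  · change ‖ψ 1‖ ≤ 1
    rw [map_one]
    rw [Matrix.linfty_opNorm_def]
    have : (univ.sup fun i => ∑ j, ‖(1 : Matrix (Fin n) (Fin n) ℤ) i j‖₊) ≤ 1 := by
      refine Finset.sup_le fun i _ => ?_
      rw [sum_eq_single i]
      · simp
      · intro j _ hj
        rw [Matrix.one_apply_ne hj.symm]; simp
      · simp
    exact_mod_cast this
  · intro x hx
    apply Algebra.leftMulMatrix_injective b
    rw [map_zero]
    ext i j
    exact hx (i, j)
  · intro k x
    change |((ψ x k.1 k.2 : ℤ) : ℝ)| ≤ ‖ψ x‖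
    rw [Matrix.linfty_opNorm_def, ← Int.norm_eq_abs, ← coe_nnnorm, NNReal.coe_le_coe]
    refine le_trans ?_ (le_sup (mem_univ k.1))
    exact single_le_sum (f := fun j => ‖ψ x k.1 j‖₊) (fun _ _ => zero_le) (mem_univ k.2)

end Norm
end RS

namespace RS
open Finset MvPolynomial

/-- slice of an exponent vector -/
noncomputable def sl {m : ℕ} (j : Fin 3) (s : Fin m × Fin 3 →₀ ℕ) : Fin m →₀ ℕ :=
  Finsupp.equivFunOnFinite.symm (fun h => s (h, j))

@[simp] theorem sl_apply {m : ℕ} (j : Fin 3) (s : Fin m × Fin 3 →₀ ℕ) (h) : sl j s h = s (h, j) := rfl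

/-- the matrix with columns u, v, e0 -/
def Bmat {R : Type*} [CommRing R] (u v : Fin 3 → R) : Matrix (Fin 3) (Fin 3) R :=
  fun i j => if j = 0 then u i else if j = 1 then v i else if i = 0 then 1 else 0

theorem Bmat_map {R R' : Type*} [CommRing R] [CommRing R'] (f : R →+* R') (u v : Fin 3 → R) :
    (Bmat u v).map f = Bmat (fun i => f (u i)) (fun i => f (v i)) := by
  ext i j
  simp only [Bmat, Matrix.map_apply]
  split_ifs <;> simp

section slice
variable {m : ℕ}

theorem prod_sl {R : Type*} [CommRing R] (f : Fin m × Fin 3 → R) (s : Fin m × Fin 3 →₀ ℕ) :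
    (s.prod fun p n => f p ^ n) =
      (∏ h, f (h, 0) ^ s (h, 0)) * (∏ h, f (h, 1) ^ s (h, 1)) * (∏ h, f (h, 2) ^ s (h, 2)) := by
  rw [Finsupp.prod_fintype _ _ (by simp), Fintype.prod_prod_type]
  simp only [Fin.prod_univ_three, prod_mul_distrib]


/-- first evaluation map -/
noncomputable def Phi (u v : Fin m → Fin 3 → ℚ) (h0 : Fin m → ℚ) :
    MvPolynomial (Fin m × Fin 3) ℚ →ₐ[ℚ] MvPolynomial (Fin m) (MvPolynomial (Fin m) ℚ) :=
  aeval (fun p => if p.2 = 0 then C (C (v p.1 2 / h0 p.1)) - C (C (v p.1 1 / h0 p.1)) * X p.1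
    else if p.2 = 1 then - C (C (u p.1 2 / h0 p.1)) + C (C (u p.1 1 / h0 p.1)) * X p.1
    else C (X p.1))

/-- second evaluation map -/
noncomputable def Psi (z1 z2 : Fin m → ℚ) :
    MvPolynomial (Fin m × Fin 3) ℚ →ₐ[ℚ] MvPolynomial (Fin m) (MvPolynomial (Fin m) ℚ) :=
  aeval (fun p => if p.2 = 0 then C (X p.1 + C (- z1 p.1)) - C (C (z2 p.1)) * X p.1
    else if p.2 = 1 then 1 else X p.1)

theorem Phi_Sub (u v : Fin m → Fin 3 → ℚ) (h0 : Fin m → ℚ) (hh0 : ∀ h, h0 h = u h 1 * v h 2 - u h 2 * v h 1)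
    (hne : ∀ h, h0 h ≠ 0) (P) :
    Phi u v h0 (Sub (fun h => Bmat (u h) (v h)) P) =
      Psi (fun h => (u h 2 * v h 0 - u h 0 * v h 2) / h0 h) (fun h => (u h 0 * v h 1 - u h 1 * v h 0) / h0 h) P := by
  suffices this : (Phi u v h0).comp (Sub (fun h => Bmat (u h) (v h))) =
      Psi (fun h => (u h 2 * v h 0 - u h 0 * v h 2) / h0 h) (fun h => (u h 0 * v h 1 - u h 1 * v h 0) / h0 h) by
    exact DFunLike.congr_fun this P
  apply MvPolynomial.algHom_ext
  rintro ⟨h, i⟩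
  have key : ∀ a : ℚ, Phi u v h0 (C a) = C (C a) := fun a => by
    rw [Phi, algHom_C]; rfl
  have e1 : u h 1 * (v h 2 / h0 h) - v h 1 * (u h 2 / h0 h) = 1 := by
    field_simp [hne h]; rw [hh0]; ring
  have e2 : u h 2 * (v h 2 / h0 h) - v h 2 * (u h 2 / h0 h) = 0 := by ring
  have e4 : u h 1 * (v h 1 / h0 h) - v h 1 * (u h 1 / h0 h) = 0 := by ring
  have e3 : -(u h 2 * (v h 1 / h0 h)) + v h 2 * (u h 1 / h0 h) = 1 := by
    field_simp [hne h]; rw [hh0]; ring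
  rw [AlgHom.comp_apply, Sub, aeval_X, map_sum]
  simp only [map_mul, key, Fin.sum_univ_three]
  simp only [Phi, Psi, aeval_X, Bmat]
  have cc : ∀ a b : ℚ, (C (C (a * b)) : MvPolynomial (Fin m) (MvPolynomial (Fin m) ℚ)) = C (C a) * C (C b) := by simp
  have c1 := congrArg (fun a : ℚ => (C (C a) : MvPolynomial (Fin m) (MvPolynomial (Fin m) ℚ))) e1
  have c3 := congrArg (fun a : ℚ => (C (C a) : MvPolynomial (Fin m) (MvPolynomial (Fin m) ℚ))) e3
  have c2 := congrArg (fun a : ℚ => (C (C a) : MvPolynomial (Fin m) (MvPolynomial (Fin m) ℚ))) e2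
  have c4 := congrArg (fun a : ℚ => (C (C a) : MvPolynomial (Fin m) (MvPolynomial (Fin m) ℚ))) e4
  simp only [C_sub, C_add, C_neg, C_mul, C_1, C_0] at c1 c2 c3 c4
  fin_cases i
  · simp [div_eq_mul_inv]
    ring
  · simp
    linear_combination c1 - X h * c4
  · simp
    linear_combination (X h) * c3 + c2

theorem Idx_any {d : Fin m → ℝ} (hd : ∀ h, 0 ≤ d h) (P : MvPolynomial (Fin m) ℚ) : Idx d 0 P := by
  intro k _
  exact sum_nonneg fun h _ => div_nonneg (Nat.cast_nonneg _) (hd h)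

theorem Phi_Idx (u v : Fin m → Fin 3 → ℚ) (h0 : Fin m → ℚ) (d : Fin m → ℝ) (hd : ∀ h, 0 ≤ d h) (t : ℝ)
    (Q : MvPolynomial (Fin m × Fin 3) ℚ)
    (hQ : ∀ s, coeff s Q ≠ 0 → t ≤ ∑ h, (s (h, 2) : ℝ) / d h) (e : Fin m →₀ ℕ) :
    Idx d t (coeff e (Phi u v h0 Q)) := by
  rw [Q.as_sum, map_sum, coeff_sum]
  refine Idx.sum _ _ _ fun s => ?_
  by_cases hs : coeff s Q = 0
  · rw [hs, monomial_zero, map_zero, coeff_zero]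
    intro k hk; simp at hk
  rw [Phi, aeval_monomial, prod_sl]
  simp only [if_true, one_ne_zero, if_false, (by decide : (2 : Fin 3) ≠ 0), (by decide : (2 : Fin 3) ≠ 1)]
  have e1 : (∏ h : Fin m, (C (X h : MvPolynomial (Fin m) ℚ) : MvPolynomial (Fin m) (MvPolynomial (Fin m) ℚ)) ^ s (h, 2)) =
      C (monomial (sl 2 s) 1) := by
    rw [monomial_eq, Finsupp.prod_fintype _ _ (by simp)]
    simp
  rw [e1, mul_comm, mul_comm (_ * _) (C (monomial (sl 2 s) 1)), mul_assoc, coeff_C_mul]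
  rw [← add_zero t]
  refine Idx.mul ?_ (Idx_any hd _)
  intro k hk
  rw [coeff_monomial] at hk
  have : sl 2 s = k := by
    by_contra hc
    rw [if_neg hc] at hk; exact hk rfl
  rw [← this]
  simpa using hQ s hs

theorem coeff_Psi (z1 z2 : Fin m → ℚ) (P : MvPolynomial (Fin m × Fin 3) ℚ) (e : Fin m →₀ ℕ)
    (he : ∀ s, coeff s P ≠ 0 → sl 2 s ≤ e → sl 2 s = e) :
    coeff e (Psi z1 z2 P) = Tr (fun h => - z1 h)
      (∑ s ∈ P.support with sl 2 s = e, monomial (sl 0 s) (coeff s P)) := by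
  conv_lhs => rw [P.as_sum, map_sum, coeff_sum]
  rw [map_sum, sum_filter]
  refine sum_congr rfl fun s hs => ?_
  rw [Psi, aeval_monomial, prod_sl]
  simp only [if_true, one_ne_zero, if_false, (by decide : (2 : Fin 3) ≠ 0), (by decide : (2 : Fin 3) ≠ 1),
    one_pow, prod_const_one, mul_one]
  have e1 : (∏ h : Fin m, (X h : MvPolynomial (Fin m) (MvPolynomial (Fin m) ℚ)) ^ s (h, 2)) = monomial (sl 2 s) 1 := by
    rw [monomial_eq, Finsupp.prod_fintype _ _ (by simp)]
    simp
  rw [e1, ← mul_assoc, coeff_mul_monomial']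
  have hsP := mem_support_iff.mp hs
  by_cases h : sl 2 s = e
  · rw [if_pos h, if_pos h.le, h, tsub_self, mul_one]
    rw [← constantCoeff_eq, map_mul, map_prod]
    rw [Tr, aeval_monomial, Finsupp.prod_fintype _ _ (by simp)]
    congr 1
    · change constantCoeff (C (C (coeff s P))) = _
      simp
    · refine prod_congr rfl fun h _ => ?_
      simp
  · rw [if_neg h, if_neg (fun h' => h (he s hsP h'))]

theorem slice_main (P : MvPolynomial (Fin m × Fin 3) ℤ) (hP : P ≠ 0) (d : Fin m → ℕ) (hMH : MH d P)
    (B : ℝ) (hB : ∀ s, |((coeff s P : ℤ) : ℝ)| ≤ B) (u v : Fin m → Fin 3 → ℤ)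
    (hne : ∀ h, u h 1 * v h 2 - u h 2 * v h 1 ≠ 0) (t : ℝ)
    (hI : ∀ s, coeff s (Sub (fun h => Bmat (u h) (v h)) P) ≠ 0 → t ≤ ∑ h, (s (h, 2) : ℝ) / d h) :
    ∃ p : MvPolynomial (Fin m) ℤ, p ≠ 0 ∧ (∀ s, |((coeff s p : ℤ) : ℝ)| ≤ B) ∧
      (∀ s, coeff s p ≠ 0 → ∀ h, s h ≤ d h) ∧
      ∀ k, coeff k (Tr (fun h => - (((u h 2 * v h 0 - u h 0 * v h 2 : ℤ) : ℚ) /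
        ((u h 1 * v h 2 - u h 2 * v h 1 : ℤ) : ℚ))) (map (Int.castRingHom ℚ) p)) ≠ 0 →
        t ≤ ∑ h, (k h : ℝ) / d h := by
  classical
  obtain ⟨e, he⟩ : ∃ e, Minimal (· ∈ P.support.image (sl 2)) e := by
    obtain ⟨s, hs⟩ := support_nonempty.mpr hP
    exact Finset.exists_minimal ⟨_, mem_image_of_mem _ hs⟩
  have hmin : ∀ s, coeff s P ≠ 0 → sl 2 s ≤ e → sl 2 s = e := by
    intro s hs hle
    exact le_antisymm hle (he.2 (mem_image_of_mem _ (mem_support_iff.mpr hs)) hle)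
  obtain ⟨s0, hs0, hs0e⟩ := mem_image.mp he.1
  set p : MvPolynomial (Fin m) ℤ := ∑ s ∈ P.support with sl 2 s = e, monomial (sl 0 s) (coeff s P) with hp
  have hInd := (MH_iff d P).mp hMH
  have hsum : ∀ s, coeff s P ≠ 0 → ∀ h, s (h, 0) + s (h, 1) + s (h, 2) = d h := by
    intro s hs h
    have := mem_Del.mp (Fintype.mem_piFinset.mp (hInd s hs) h)
    rwa [Fin.sum_univ_three] at this
  have hinj : ∀ s s', coeff s P ≠ 0 → coeff s' P ≠ 0 → sl 2 s = e → sl 2 s' = e → sl 0 s = sl 0 s' → s = s' := by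
    intro s s' hs hs' h2 h2' h0
    ext ⟨h, i⟩
    have a0 := DFunLike.congr_fun h0 h
    have a2 := DFunLike.congr_fun (h2.trans h2'.symm) h
    have b := hsum s hs h
    have b' := hsum s' hs' h
    simp only [sl_apply] at a0 a2
    fin_cases i <;> simp only [Fin.zero_eta, Fin.mk_one, Fin.reduceFinMk] <;> omega
  have hc : ∀ s, coeff s P ≠ 0 → sl 2 s = e → coeff (sl 0 s) p = coeff s P := by
    intro s hs h2
    rw [hp, coeff_sum, sum_eq_single s]
    · simp
    · intro b hb hbs
      rw [mem_filter, mem_support_iff] at hb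
      rw [coeff_monomial, if_neg]
      intro h
      exact hbs (hinj b s hb.1 hs hb.2 h2 h)
    · intro h
      exact absurd (mem_filter.mpr ⟨mem_support_iff.mpr hs, h2⟩) h
  have hc0 : ∀ k, coeff k p ≠ 0 → ∃ s, coeff s P ≠ 0 ∧ sl 2 s = e ∧ sl 0 s = k := by
    intro k hk
    by_contra hcon
    push Not at hcon
    apply hk
    rw [hp, coeff_sum]
    refine sum_eq_zero fun s hs => ?_
    rw [mem_filter, mem_support_iff] at hs
    rw [coeff_monomial, if_neg (hcon s hs.1 hs.2)]
  refine ⟨p, ?_, ?_, ?_, ?_⟩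
  · intro h0
    have := hc s0 (mem_support_iff.mp hs0) hs0e
    rw [h0, coeff_zero] at this
    exact mem_support_iff.mp hs0 this.symm
  · intro k
    by_cases hk : coeff k p = 0
    · rw [hk]; simpa using (abs_nonneg _).trans (hB 0)
    · obtain ⟨s, hs, h2, h0⟩ := hc0 k hk
      rw [← h0, hc s hs h2]; exact hB s
  · intro k hk h
    obtain ⟨s, hs, h2, h0⟩ := hc0 k hk
    have := hsum s hs h
    rw [← h0, sl_apply]; omega
  · set PQ := map (Int.castRingHom ℚ) P with hPQ
    have hcPQ : ∀ s, coeff s PQ ≠ 0 → coeff s P ≠ 0 := by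
      intro s hs h
      apply hs; rw [hPQ, coeff_map, h]; simp
    have hsupp : PQ.support = P.support :=
      support_map_of_injective _ Int.cast_injective
    have h1 : map (Int.castRingHom ℚ) p = ∑ s ∈ PQ.support with sl 2 s = e, monomial (sl 0 s) (coeff s PQ) := by
      rw [hp, map_sum, hsupp]
      refine sum_congr rfl fun s _ => ?_
      rw [map_monomial, hPQ, coeff_map]
    rw [h1, ← coeff_Psi _ (fun h => ((u h 0 * v h 1 - u h 1 * v h 0 : ℤ) : ℚ) /
        ((u h 1 * v h 2 - u h 2 * v h 1 : ℤ) : ℚ)) PQ e (fun s hs => hmin s (hcPQ s hs))]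
    have h2 := Phi_Sub (fun h i => (u h i : ℚ)) (fun h i => (v h i : ℚ))
      (fun h => ((u h 1 * v h 2 - u h 2 * v h 1 : ℤ) : ℚ)) (by intro h; push_cast; ring)
      (by intro h; exact_mod_cast hne h) PQ
    have h3 := Phi_Idx (fun h i => (u h i : ℚ)) (fun h i => (v h i : ℚ))
      (fun h => ((u h 1 * v h 2 - u h 2 * v h 1 : ℤ) : ℚ)) (fun h => (d h : ℝ)) (fun h => Nat.cast_nonneg _) t
      (Sub (fun h => Bmat (fun i => (u h i : ℚ)) (fun i => (v h i : ℚ))) PQ) (by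
        intro s hs
        apply hI
        intro h
        apply hs
        have := Sub_map (Int.castRingHom ℚ) (fun h => Bmat (u h) (v h)) P
        simp only [Bmat_map] at this
        change coeff s (Sub (fun h => Bmat (fun i => (Int.castRingHom ℚ) (u h i)) (fun i => (Int.castRingHom ℚ) (v h i))) (map (Int.castRingHom ℚ) P)) = 0
        rw [← this, coeff_map, h]; simp) e
    rw [h2] at h3
    push_cast
    push_cast at h3
    exact h3

end slice
end RS

namespace RS
open Finset MvPolynomial

/-- absolute value as a seminorm -/
noncomputable def NR : RingSeminorm ℝ := normRingSeminorm ℝ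

theorem NR_apply (x : ℝ) : NR x = |x| := rfl
theorem NR_one : NR 1 ≤ 1 := by rw [NR_apply]; simp

theorem wnorm_congr_le {σ : Type*} [Fintype σ] {S : Type*} [CommRing S] (N : RingSeminorm S)
    (x y : σ → ℝ) (P : MvPolynomial σ S) (K : ℝ)
    (h : ∀ s, coeff s P ≠ 0 → ∏ i, x i ^ s i ≤ K * ∏ i, y i ^ s i) : wnorm N x P ≤ K * wnorm N y P := by
  unfold wnorm
  rw [mul_sum]
  refine sum_le_sum fun s hs => ?_
  have := mul_le_mul_of_nonneg_left (h s (mem_support_iff.mp hs)) (apply_nonneg N (coeff s P))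
  linarith

theorem MH_map {m : ℕ} {R R' : Type*} [CommRing R] [CommRing R'] (f : R →+* R') (d : Fin m → ℕ) (P : MvPolynomial (Fin m × Fin 3) R)
    (h : MH d P) : MH d (map f P) := by
  rw [MH_iff] at h ⊢
  intro s hs
  apply h
  intro h0
  apply hs
  rw [coeff_map, h0, map_zero]

theorem sum_of_MH {m : ℕ} {R : Type*} [CommRing R] (d : Fin m → ℕ) (P : MvPolynomial (Fin m × Fin 3) R)
    (h : MH d P) (s) (hs : coeff s P ≠ 0) : ∑ p, s p = ∑ h, d h := by
  have := sum_fs ((MH_iff d P).mp h s hs)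
  rwa [fs_curry] at this

/-- l1 norm bound -/
theorem wnorm_const_le {m : ℕ} (d : Fin m → ℕ) (P : MvPolynomial (Fin m × Fin 3) ℤ) (hMH : MH d P) (B : ℝ)
    (hB : ∀ s, |((coeff s P : ℤ) : ℝ)| ≤ B) (K : ℝ) (hK : 0 ≤ K) :
    wnorm NR (fun _ => K) (map (Int.castRingHom ℝ) P) ≤ B * (4 * K) ^ (∑ h, d h) := by
  have hB0 : 0 ≤ B := (abs_nonneg _).trans (hB 0)
  have hMH' := MH_map (Int.castRingHom ℝ) d P hMH
  set Q := map (Int.castRingHom ℝ) P with hQ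
  have hcard : Q.support.card ≤ (Ind d).card := by
    apply card_le_card_of_injOn (fun s h i => s (h, i))
    · intro s hs
      exact (MH_iff d Q).mp hMH' s (mem_support_iff.mp hs)
    · intro s _ s' _ h
      rw [← fs_curry s, ← fs_curry s']
      exact congrArg fs h
  have hcard' : (Q.support.card : ℝ) ≤ 4 ^ (∑ h, d h) := by exact_mod_cast hcard.trans (card_Ind_le d)
  calc wnorm NR (fun _ => K) Q ≤ ∑ s ∈ Q.support, B * K ^ (∑ h, d h) := by
        unfold wnorm
        refine sum_le_sum fun s hs => ?_
        rw [prod_pow_eq_pow_sum, sum_of_MH d Q hMH' s (mem_support_iff.mp hs)]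
        refine mul_le_mul_of_nonneg_right ?_ (by positivity)
        rw [NR_apply, hQ, coeff_map]
        exact hB s
    _ = Q.support.card * (B * K ^ (∑ h, d h)) := by rw [sum_const, nsmul_eq_mul]
    _ ≤ 4 ^ (∑ h, d h) * (B * K ^ (∑ h, d h)) := mul_le_mul_of_nonneg_right hcard' (by positivity)
    _ = _ := by rw [mul_pow]; ring

theorem good_exponent {m : ℕ} (d : Fin m → ℕ) (hd : ∀ h, 0 < d h) (c : Fin 3 → ℝ) (lam : Fin m → ℝ) (Lam η ε : ℝ)
    (hL0 : 0 ≤ Lam) (hη : 0 ≤ η)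
    (hL1 : ∀ h, Lam ≤ d h * lam h) (hL2 : ∀ h, d h * lam h ≤ Lam * (1 + η))
    (hδ : (ε + η) * ∑ i, |c i| ≤ -(∑ i, c i) / 6)
    (s : Fin m → Fin 3 → ℕ) (hs : s ∈ Ind d) (hg : Good d ε s) :
    ∑ h, ∑ i, c i * lam h * s h i ≤ - (Lam * m * (-(∑ i, c i)) / 6) := by
  have key : ∀ i, ∑ h, c i * lam h * s h i ≤ c i * Lam * (m / 3) + |c i| * Lam * (ε + η) * m := by
    intro i
    have e1 : ∑ h, c i * lam h * s h i = c i * ∑ h, (d h * lam h) * ((s h i : ℝ) / d h) := by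
      rw [mul_sum]
      refine sum_congr rfl fun h _ => ?_
      have : (d h : ℝ) ≠ 0 := by exact_mod_cast (hd h).ne'
      field_simp
    set T := ∑ h, (d h * lam h) * ((s h i : ℝ) / d h) with hT
    set U := ∑ h, (s h i : ℝ) / d h with hU
    have hU1 := hg i
    rw [← hU] at hU1
    have hT1 : Lam * U ≤ T := by
      rw [hT, hU, mul_sum]
      exact sum_le_sum fun h _ => mul_le_mul_of_nonneg_right (hL1 h) (by positivity)
    have hle1 : ∀ h, (s h i : ℝ) / d h ≤ 1 := by
      intro h
      have hdp : (0 : ℝ) < d h := by exact_mod_cast hd h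
      rw [div_le_one hdp]
      have := mem_Del.mp (Fintype.mem_piFinset.mp hs h)
      rw [← this]
      exact_mod_cast single_le_sum (f := s h) (fun _ _ => Nat.zero_le _) (mem_univ i)
    have hT2 : T ≤ Lam * U + Lam * η * m := by
      have : T ≤ ∑ h : Fin m, (Lam * ((s h i : ℝ) / d h) + Lam * η) := by
        rw [hT]
        refine sum_le_sum fun h _ => ?_
        have h1 := mul_le_mul_of_nonneg_right (hL2 h) (by positivity : 0 ≤ (s h i : ℝ) / d h)
        have h2 := mul_le_mul_of_nonneg_left (hle1 h) (mul_nonneg hL0 hη)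
        linarith
      rw [sum_add_distrib, ← mul_sum] at this
      simp only [sum_const, card_univ, Fintype.card_fin, nsmul_eq_mul] at this
      linarith
    have hdiff : |T - Lam * (m / 3)| ≤ Lam * (ε + η) * m := by
      rw [abs_le] at hU1 ⊢
      have a1 := mul_le_mul_of_nonneg_left hU1.1 hL0
      have a2 := mul_le_mul_of_nonneg_left hU1.2 hL0
      have a3 : 0 ≤ Lam * η * m := by positivity
      constructor <;> linarith
    rw [e1]
    have h5 : c i * (T - Lam * (m / 3)) ≤ |c i| * (Lam * (ε + η) * m) := by
      refine (le_abs_self _).trans ?_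
      rw [abs_mul]
      exact mul_le_mul_of_nonneg_left hdiff (abs_nonneg _)
    linarith
  rw [sum_comm]
  refine (sum_le_sum fun i _ => key i).trans ?_
  rw [sum_add_distrib, ← sum_mul, ← sum_mul, ← sum_mul, ← sum_mul, ← sum_mul]
  have := mul_le_mul_of_nonneg_left hδ (by positivity : 0 ≤ Lam * m)
  linarith

theorem small_coeff {m : ℕ} (d : Fin m → ℕ) (hd : ∀ h, 0 < d h)
    (P : MvPolynomial (Fin m × Fin 3) ℤ) (hMH : MH d P) (B : ℝ)
    (hB : ∀ s, |((coeff s P : ℤ) : ℝ)| ≤ B) (G : Matrix (Fin 3) (Fin 3) ℝ) (g0 : Fin 3 → ℝ)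
    (c : Fin 3 → ℝ) (cs : ℝ) (hcs : ∀ i, |c i| ≤ cs)
    (lam : Fin m → ℝ) (hlam : ∀ h, 0 ≤ lam h) (Lam η ε t : ℝ)
    (hL0 : 0 ≤ Lam) (hη : 0 ≤ η) (hη1 : η ≤ 1)
    (hL1 : ∀ h, Lam ≤ d h * lam h) (hL2 : ∀ h, d h * lam h ≤ Lam * (1 + η))
    (hδ : (ε + η) * ∑ i, |c i| ≤ -(∑ i, c i) / 6) (ht : 2 * cs * t ≤ m * (-(∑ i, c i)) / 12)
    (u v : Fin m → Fin 3 → ℤ) (lu lv : Fin m → Fin 3 → ℝ)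
    (hu : ∀ h i, ∑ j, G i j * lu h j = u h i) (hv : ∀ h i, ∑ j, G i j * lv h j = v h i)
    (hg0 : ∀ i, ∑ j, G i j * g0 j = if i = 0 then 1 else 0)
    (Cc : ℝ) (hCc : 0 ≤ Cc) (hlu : ∀ h i, |lu h i| ≤ Cc * Real.exp (c i * lam h))
    (hlv : ∀ h i, |lv h i| ≤ Cc * Real.exp (c i * lam h))
    (C3 : ℝ) (hC3 : ∀ i, 2 * Cc + |g0 i| ≤ C3)
    (hbad : ∀ s ∈ Ind d, ¬ Good d ε s →
      coeff (fs s) (Sub (fun _ => G) (map (Int.castRingHom ℝ) P)) = 0)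
    (hfin : B * (4 * (C1of NR G)) ^ (∑ h, d h) * C3 ^ (∑ h, d h) < Real.exp (Lam * m * (-(∑ i, c i)) / 12)) :
    ∀ s, coeff s (Sub (fun h => Bmat (u h) (v h)) P) ≠ 0 → t ≤ ∑ h, (s (h, 2) : ℝ) / d h := by
  intro s hs
  by_contra hcon
  push Not at hcon
  have hcs0 : 0 ≤ cs := (abs_nonneg _).trans (hcs 0)
  have hC30 : 0 ≤ C3 := by
    have h1 := hC3 0
    have h2 := abs_nonneg (g0 0)
    linarith
  set PR := map (Int.castRingHom ℝ) P with hPR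
  set Q := Sub (fun _ => G) PR with hQ
  set L : Fin m → Matrix (Fin 3) (Fin 3) ℝ := fun h i j =>
    if j = 0 then lu h i else if j = 1 then lv h i else g0 i with hL
  have hMHQ : MH d Q := MH_Sub d _ _ (MH_map _ d P hMH)
  have hGL : ∀ h, G * L h = Bmat (fun i => (u h i : ℝ)) (fun i => (v h i : ℝ)) := by
    intro h
    ext i j
    rw [Matrix.mul_apply]
    fin_cases j
    · simpa [Bmat, hL] using hu h i
    · simpa [Bmat, hL] using hv h i
    · simpa [Bmat, hL] using hg0 i
  have hBR : Sub L Q = map (Int.castRingHom ℝ) (Sub (fun h => Bmat (u h) (v h)) P) := by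
    rw [hQ, Sub_Sub, Sub_map]
    congr 2
    ext1 h
    rw [hGL, Bmat_map]
    rfl
  have hge1 : 1 ≤ |coeff s (Sub L Q)| := by
    rw [hBR, coeff_map]
    have : (1:ℤ) ≤ |coeff s (Sub (fun h => Bmat (u h) (v h)) P)| := Int.one_le_abs hs
    simp only [eq_intCast]
    exact_mod_cast this
  set x : Fin m × Fin 3 → ℝ := fun p => if p.2 = 2 then Real.exp (-(cs * lam p.1)) else 1 with hx
  have hx0 : ∀ p, 0 ≤ x p := by
    intro p; simp only [hx]; split_ifs <;> positivity
  -- lower bound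
  have hlow := coeff_le_wnorm NR x hx0 (Sub L Q) s
  have hprodx : ∏ p, x p ^ s p = Real.exp (-(cs * ∑ h, lam h * s (h, 2))) := by
    rw [Fintype.prod_prod_type, mul_sum, ← sum_neg_distrib, Real.exp_sum]
    refine prod_congr rfl fun h _ => ?_
    rw [Fin.prod_univ_three]
    simp only [hx, if_true, (by decide : (0 : Fin 3) ≠ 2), (by decide : (1 : Fin 3) ≠ 2), if_false, one_pow, one_mul]
    rw [← Real.exp_nat_mul]; ring_nf
  have hexp : cs * ∑ h, lam h * s (h, 2) ≤ Lam * m * (-(∑ i, c i)) / 12 := by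
    have h1 : ∑ h, lam h * s (h, 2) ≤ Lam * 2 * ∑ h, (s (h, 2) : ℝ) / d h := by
      rw [mul_sum]
      refine sum_le_sum fun h _ => ?_
      have hdp : (0 : ℝ) < d h := by exact_mod_cast hd h
      have h2 : d h * lam h ≤ Lam * 2 := (hL2 h).trans (mul_le_mul_of_nonneg_left (by linarith) hL0)
      have h3 := mul_le_mul_of_nonneg_right h2 (by positivity : 0 ≤ (s (h, 2) : ℝ) / d h)
      refine le_trans (le_of_eq ?_) h3
      field_simp
    have h2 : cs * ∑ h, lam h * s (h, 2) ≤ cs * (Lam * 2 * t) :=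
      mul_le_mul_of_nonneg_left (h1.trans (mul_le_mul_of_nonneg_left hcon.le (by linarith))) hcs0
    have h3 := mul_le_mul_of_nonneg_left ht hL0
    linarith
  have hlow2 : Real.exp (-(Lam * m * (-(∑ i, c i)) / 12)) ≤ wnorm NR x (Sub L Q) := by
    refine le_trans ?_ hlow
    rw [hprodx, NR_apply]
    calc _ ≤ Real.exp (-(cs * ∑ h, lam h * s (h, 2))) := Real.exp_le_exp.mpr (by linarith)
      _ = 1 * Real.exp (-(cs * ∑ h, lam h * s (h, 2))) := by ring
      _ ≤ _ := mul_le_mul_of_nonneg_right hge1 (by positivity)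
  -- upper bound
  have hup1 := wnorm_Sub_le NR NR_one x hx0 L Q
  set x' : Fin m × Fin 3 → ℝ := fun p => ∑ j, NR (L p.1 p.2 j) * x (p.1, j) with hx'
  have hx'0 : ∀ p, 0 ≤ x' p := fun p => sum_nonneg fun j _ => mul_nonneg (apply_nonneg _ _) (hx0 _)
  have hx'le : ∀ p, x' p ≤ C3 * Real.exp (c p.2 * lam p.1) := by
    rintro ⟨h, i⟩
    simp only [hx', Fin.sum_univ_three, hL, hx, NR_apply, if_true, (by decide : (0 : Fin 3) ≠ 2),
      (by decide : (1 : Fin 3) ≠ 2), (by decide : (2 : Fin 3) ≠ 0), (by decide : (2 : Fin 3) ≠ 1),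
      (by decide : (1 : Fin 3) ≠ 0), if_false, mul_one]
    have h1 : Real.exp (-(cs * lam h)) ≤ Real.exp (c i * lam h) := by
      apply Real.exp_le_exp.mpr
      have := mul_le_mul_of_nonneg_right ((neg_le_neg (hcs i)).trans (neg_abs_le (c i))) (hlam h)
      linarith
    have h2 := mul_le_mul_of_nonneg_left h1 (abs_nonneg (g0 i))
    have h3 := mul_le_mul_of_nonneg_right (hC3 i) (Real.exp_nonneg (c i * lam h))
    have h4 := hlu h i
    have h5 := hlv h i
    linarith
  have hup2 : wnorm NR x' Q ≤ (C3 ^ (∑ h, d h) * Real.exp (-(Lam * m * (-(∑ i, c i)) / 6))) * wnorm NR (fun _ => 1) Q := by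
    apply wnorm_congr_le
    intro k hk
    simp only [one_pow, prod_const_one, mul_one]
    have hkI := (MH_iff d Q).mp hMHQ k hk
    have hkG : Good d ε (fun h i => k (h, i)) := by
      by_contra hc
      have := hbad _ hkI hc
      rw [fs_curry] at this
      exact hk this
    have hge := good_exponent d hd c lam Lam η ε hL0 hη hL1 hL2 hδ _ hkI hkG
    calc ∏ p, x' p ^ k p ≤ ∏ p, (C3 * Real.exp (c p.2 * lam p.1)) ^ k p :=
          prod_le_prod (fun p _ => pow_nonneg (hx'0 p) _) fun p _ => pow_le_pow_left₀ (hx'0 p) (hx'le p) _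
      _ = C3 ^ (∑ h, d h) * Real.exp (∑ h, ∑ i, c i * lam h * k (h, i)) := by
          simp only [mul_pow, prod_mul_distrib]
          rw [prod_pow_eq_pow_sum, sum_of_MH d Q hMHQ k hk]
          congr 1
          rw [Fintype.prod_prod_type, Real.exp_sum]
          refine prod_congr rfl fun h _ => ?_
          rw [Real.exp_sum]
          refine prod_congr rfl fun i _ => ?_
          rw [← Real.exp_nat_mul]; ring_nf
      _ ≤ _ := mul_le_mul_of_nonneg_left (Real.exp_le_exp.mpr hge) (pow_nonneg hC30 _)
  have hup3 : wnorm NR (fun _ => 1) Q ≤ B * (4 * (C1of NR G)) ^ (∑ h, d h) := by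
    refine (wnorm_Sub_le NR NR_one (fun _ => 1) (fun _ => zero_le_one) (fun _ => G) PR).trans ?_
    have hG1 := one_le_C1of NR G
    refine le_trans ?_ (wnorm_const_le d P hMH B hB (C1of NR G) (by linarith))
    refine le_trans (wnorm_congr_le NR _ (fun _ => C1of NR G) _ 1 ?_) (le_of_eq (one_mul _))
    intro k _
    rw [one_mul]
    refine prod_le_prod (fun p _ => pow_nonneg (sum_nonneg fun j _ => by simp [apply_nonneg]) _) fun p _ => ?_
    refine pow_le_pow_left₀ (sum_nonneg fun j _ => by simp [apply_nonneg]) ?_ _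
    have := single_le_sum (f := fun i => ∑ j, NR (G i j)) (fun i _ => sum_nonneg fun j _ => apply_nonneg NR _) (mem_univ p.2)
    have this : ∑ j, NR (G p.2 j) ≤ ∑ i, ∑ j, NR (G i j) := this
    unfold C1of
    have e : ∑ j, NR ((fun _ : Fin m => G) p.1 p.2 j) * 1 = ∑ j, NR (G p.2 j) := by simp only [mul_one]
    rw [e]
    linarith
  set E := Real.exp (Lam * m * (-(∑ i, c i)) / 12) with hE
  have hEpos : 0 < E := Real.exp_pos _
  have hE2 : Real.exp (-(Lam * m * (-(∑ i, c i)) / 6)) = E⁻¹ * E⁻¹ := by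
    rw [hE, ← Real.exp_neg, ← Real.exp_add]; ring_nf
  have hE1 : Real.exp (-(Lam * m * (-(∑ i, c i)) / 12)) = E⁻¹ := by
    rw [hE, ← Real.exp_neg]
  rw [hE1] at hlow2
  rw [hE2] at hup2
  have hall : E⁻¹ ≤ (C3 ^ (∑ h, d h) * (E⁻¹ * E⁻¹)) * (B * (4 * (C1of NR G)) ^ (∑ h, d h)) := by
    refine hlow2.trans (hup1.trans (hup2.trans ?_))
    exact mul_le_mul_of_nonneg_left hup3 (by positivity)
  have h7 : (C3 ^ (∑ h, d h) * (E⁻¹ * E⁻¹)) * (B * (4 * (C1of NR G)) ^ (∑ h, d h)) < E⁻¹ := by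
    calc _ = (B * (4 * (C1of NR G)) ^ (∑ h, d h) * C3 ^ (∑ h, d h)) * (E⁻¹ * E⁻¹) := by ring
      _ < E * (E⁻¹ * E⁻¹) := mul_lt_mul_of_pos_right hfin (by positivity)
      _ = E⁻¹ := by field_simp
  linarith

end RS

namespace RS
open Finset MvPolynomial

theorem T1 {S : Type*} [CommRing S] [Nontrivial S] [Module.Free ℤ S] [Module.Finite ℤ S] (φ : S →+* ℝ)
    (Γ : Matrix (Fin 3) (Fin 3) S) (g0 : Fin 3 → ℝ)
    (hg0 : ∀ i, ∑ j, φ (Γ i j) * g0 j = if i = 0 then 1 else 0)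
    (c : Fin 3 → ℝ) (hc : ∑ i, c i < 0) (Cc : ℝ) (hCc : 0 ≤ Cc) (ρ : ℝ) (hρ : 0 < ρ)
    (H : ∀ X : ℝ, ∃ lam ≥ X, ∃ u v : Fin 3 → ℤ, ∃ lu lv : Fin 3 → ℝ,
      (∀ i, ∑ j, φ (Γ i j) * lu j = u i) ∧ (∀ i, ∑ j, φ (Γ i j) * lv j = v i) ∧
      (∀ i, |lu i| ≤ Cc * Real.exp (c i * lam)) ∧ (∀ i, |lv i| ≤ Cc * Real.exp (c i * lam)) ∧
      u 1 * v 2 - u 2 * v 1 ≠ 0 ∧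
      Real.exp (ρ * lam) ≤ ((((u 2 * v 0 - u 0 * v 2 : ℤ) : ℚ) / ((u 1 * v 2 - u 2 * v 1 : ℤ) : ℚ)).den : ℝ)) :
    False := by
  obtain ⟨N, K, _, _, f, h1, hinj, hf⟩ := exists_norm S
  set δ := -∑ i, c i with hδ
  have hδ0 : 0 < δ := by linarith
  set cs := ∑ i, |c i| with hcs
  have hδcs : δ ≤ cs := by
    rw [hδ, hcs, ← sum_neg_distrib]
    exact sum_le_sum fun i _ => neg_le_abs (c i)
  have hcs0 : 0 < cs := by linarith
  set ε := δ / (12 * cs) with hε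
  have hε0 : 0 < ε := by positivity
  have hε1 : ε ≤ 1 := by
    rw [hε, div_le_one (by positivity)]; linarith
  have hεcs : (ε + ε) * cs ≤ δ / 6 := by
    rw [hε]; field_simp; norm_num
  set t := δ / (24 * cs) with ht
  have ht0 : 0 < t := by positivity
  obtain ⟨m, hm0, hmK⟩ : ∃ m : ℕ, 0 < m ∧ 6 * (Fintype.card K : ℝ) ≤ ε ^ 2 * m := by
    obtain ⟨m, hm⟩ := exists_nat_ge (6 * (Fintype.card K : ℝ) / ε ^ 2)
    refine ⟨m + 1, by omega, ?_⟩
    rw [div_le_iff₀ (by positivity)] at hm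
    push_cast
    nlinarith [sq_nonneg ε]
  have hm1 : (1:ℝ) ≤ m := by exact_mod_cast hm0
  obtain ⟨ω, hω, hroth⟩ := roth m t ht0
  set G := Γ.map φ with hG
  set C1 := C1of N Γ with hC1
  have hC1' : 1 ≤ C1 := one_le_C1of N Γ
  set D1 := C1of NR G with hD1
  have hD1' : 1 ≤ D1 := one_le_C1of NR G
  set C3 := 1 + 2 * Cc + ∑ i, |g0 i| with hC3
  have hsg : 0 ≤ ∑ i, |g0 i| := sum_nonneg fun i _ => abs_nonneg _
  have hC3' : 1 ≤ C3 := by rw [hC3]; linarith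
  set K1 := (4 * C1) * (4 * D1) * C3 with hK1
  have hK1' : 1 ≤ K1 := by
    have a : 1 ≤ (4 * C1) * (4 * D1) := one_le_mul_of_one_le_of_one_le (by linarith) (by linarith)
    exact one_le_mul_of_one_le_of_one_le a hC3'
  have hlogK1 : 0 ≤ Real.log K1 := Real.log_nonneg hK1'
  have hlogC1 : 0 ≤ Real.log (4 * C1) := Real.log_nonneg (by linarith)
  -- choose X0
  obtain ⟨X0, hX01, hX02, hX03⟩ : ∃ X0 : ℝ, 1 ≤ X0 ∧ 24 * Real.log K1 < X0 * δ ∧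
      2 * m * (Real.log (4 * C1) + 1) ≤ X0 * (ω * ρ) := by
    refine ⟨1 + (24 * Real.log K1 / δ) + 2 * m * (Real.log (4 * C1) + 1) / (ω * ρ), ?_, ?_, ?_⟩
    · have a : 0 ≤ 24 * Real.log K1 / δ := by positivity
      have b : 0 ≤ 2 * m * (Real.log (4 * C1) + 1) / (ω * ρ) := by positivity
      linarith
    · have b : 0 ≤ 2 * m * (Real.log (4 * C1) + 1) / (ω * ρ) := by positivity
      rw [add_mul, add_mul, div_mul_cancel₀ _ hδ0.ne']
      nlinarith
    · have a : 0 ≤ 24 * Real.log K1 / δ := by positivity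
      have hp : 0 < ω * ρ := by positivity
      rw [add_mul, div_mul_cancel₀ _ hp.ne']
      nlinarith
  have hX00 : 0 < X0 := by linarith
  choose lamF hlamF uF vF luF lvF hu hv hlu hlv hne hden using H
  set A := max 1 (2 / ω) with hA
  have hA1 : 1 ≤ A := le_max_left _ _
  have hA2 : 2 / ω ≤ A := le_max_right _ _
  let Xs : ℕ → ℝ := fun n => Nat.rec X0 (fun _ x => max X0 (A * lamF x)) n
  have hXs0 : ∀ n, X0 ≤ Xs n := by
    intro n
    cases n with
    | zero => exact le_refl _
    | succ n => exact le_max_left _ _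
  let μ : ℕ → ℝ := fun n => lamF (Xs n)
  have hμ0 : ∀ n, X0 ≤ μ n := fun n => (hXs0 n).trans (hlamF _)
  have hμs : ∀ n, A * μ n ≤ μ (n+1) := fun n => (le_max_right _ _).trans (hlamF (Xs (n+1)))
  have hμmono : Monotone μ := monotone_nat_of_le_succ fun n => by
    have := hμs n
    have h2 := hμ0 n
    nlinarith
  have hμlt : ∀ a b, a < b → A * μ a ≤ μ b := fun a b hab => (hμs a).trans (hμmono hab)
  let x : Fin m → ℝ := fun h => Xs (m - 1 - h)
  let lam : Fin m → ℝ := fun h => lamF (x h)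
  have hlamX : ∀ h, X0 ≤ lam h := fun h => hμ0 _
  have hlam0 : ∀ h, 0 < lam h := fun h => hX00.trans_le (hlamX h)
  have hlamlt : ∀ i j, i < j → A * lam j ≤ lam i := by
    intro i j hij
    apply hμlt
    have := j.2
    have : (i:ℕ) < j := hij
    omega
  set Lam := (∑ h, lam h) / ε with hLam
  have hsl : ∀ h, lam h ≤ ∑ h, lam h := fun h =>
    single_le_sum (f := lam) (fun i _ => (hlam0 i).le) (mem_univ h)
  have hLamp : 0 < Lam := by
    have := (hlam0 ⟨0, hm0⟩).trans_le (hsl ⟨0, hm0⟩)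
    positivity
  have hlamLam : ∀ h, lam h ≤ ε * Lam := by
    intro h
    rw [hLam, mul_div_cancel₀ _ hε0.ne']
    exact hsl h
  let d : Fin m → ℕ := fun h => ⌈Lam / lam h⌉₊
  have hd0 : ∀ h, 0 < d h := fun h => Nat.ceil_pos.mpr (div_pos hLamp (hlam0 h))
  have hL1 : ∀ h, Lam ≤ d h * lam h := by
    intro h
    rw [← div_le_iff₀ (hlam0 h)]
    exact Nat.le_ceil _
  have hL2 : ∀ h, d h * lam h ≤ Lam * (1 + ε) := by
    intro h
    have a : (d h : ℝ) < Lam / lam h + 1 := Nat.ceil_lt_add_one (div_pos hLamp (hlam0 h)).le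
    have b := mul_le_mul_of_nonneg_right a.le (hlam0 h).le
    rw [add_mul, div_mul_cancel₀ _ (hlam0 h).ne'] at b
    have := hlamLam h
    linarith
  have hL3 : ∀ h, d h * lam h ≤ 2 * Lam := fun h => (hL2 h).trans (by nlinarith)
  have hdX : ∀ h, (d h : ℝ) * X0 ≤ 2 * Lam := fun h =>
    (mul_le_mul_of_nonneg_left (hlamX h) (Nat.cast_nonneg _)).trans (hL3 h)
  have hsd : (∑ h, (d h : ℝ)) * X0 ≤ 2 * Lam * m := by
    rw [sum_mul]
    refine (sum_le_sum fun h _ => hdX h).trans ?_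
    simp [mul_comm]
  have hsd' : ((∑ h, d h : ℕ) : ℝ) = ∑ h, (d h : ℝ) := by push_cast; rfl
  have hsd0 : 0 ≤ ∑ h, (d h : ℝ) := sum_nonneg fun h _ => Nat.cast_nonneg _
  have hdω : ∀ i j, i < j → (d i : ℝ) ≤ ω * d j := by
    intro i j hij
    have a := hL3 i
    have b := hL1 j
    have e := hlamlt i j hij
    have e2 : 2 / ω * lam j ≤ lam i := (mul_le_mul_of_nonneg_right hA2 (hlam0 j).le).trans e
    have e3 : (d i : ℝ) * (2 / ω * lam j) ≤ 2 * (d j * lam j) :=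
      (mul_le_mul_of_nonneg_left e2 (Nat.cast_nonneg _)).trans (by linarith)
    have e4 : (d i : ℝ) * (2 / ω * lam j) = (d i / ω) * (2 * lam j) := by ring
    have e5 : (d i / ω : ℝ) * (2 * lam j) ≤ d j * (2 * lam j) := by rw [← e4]; linarith
    have e6 := le_of_mul_le_mul_right e5 (by linarith [hlam0 j])
    rw [div_le_iff₀ hω] at e6
    linarith
  obtain ⟨P, hP0, hMH, hPB, hPbad⟩ := siegel N h1 f hinj hf Γ hm0 ε hε0 hmK d hd0
  set B := (4 * C1) ^ (∑ h, d h) with hB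
  have hB1 : 1 ≤ B := one_le_pow₀ (by linarith)
  have hI := small_coeff d hd0 P hMH B hPB G g0 c cs
    (fun i => single_le_sum (f := fun i => |c i|) (fun _ _ => abs_nonneg _) (mem_univ i)) lam (fun h => (hlam0 h).le)
    Lam ε ε t hLamp.le hε0.le hε1 hL1 hL2 hεcs (by
      rw [ht]
      have : 2 * cs * (δ / (24 * cs)) = δ / 12 := by field_simp; norm_num
      rw [this]
      have := mul_le_mul_of_nonneg_right hm1 hδ0.le
      linarith)
    (fun h => uF (x h)) (fun h => vF (x h)) (fun h => luF (x h)) (fun h => lvF (x h))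
    (fun h i => hu (x h) i) (fun h i => hv (x h) i) hg0 Cc hCc (fun h i => hlu (x h) i) (fun h i => hlv (x h) i)
    C3 (fun i => by
      have := single_le_sum (f := fun i => |g0 i|) (fun _ _ => abs_nonneg _) (mem_univ i)
      have this : |g0 i| ≤ ∑ i, |g0 i| := this
      linarith)
    (by
      intro s hs hg
      have := hPbad s hs hg
      have e := congrArg φ this
      rw [← coeff_map, Sub_map, MvPolynomial.map_map, map_zero] at e
      have e' : φ.comp (Int.castRingHom S) = Int.castRingHom ℝ := RingHom.ext_int _ _
      rw [e'] at e
      exact e)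
    (by
      rw [hB, ← mul_pow, ← mul_pow]
      have hK1p : 0 < K1 := by linarith
      rw [← hK1, ← Real.log_lt_iff_lt_exp (by positivity), Real.log_pow, hsd', ← hδ]
      have a := mul_le_mul_of_nonneg_right hsd hlogK1
      have b := mul_lt_mul_of_pos_left hX02 (by positivity : 0 < Lam * m)
      have : (∑ h, (d h : ℝ)) * Real.log K1 * X0 < (Lam * m * δ / 12) * X0 := by linarith
      exact lt_of_mul_lt_mul_right this hX00.le)
  obtain ⟨p, hp0, hpB, hpd, hpI⟩ := slice_main P hP0 d hMH B hPB (fun h => uF (x h)) (fun h => vF (x h))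
    (fun h => hne (x h)) t hI
  let r : Fin m → ℚ := fun h => -(((uF (x h) 2 * vF (x h) 0 - uF (x h) 0 * vF (x h) 2 : ℤ) : ℚ) /
        ((uF (x h) 1 * vF (x h) 2 - uF (x h) 2 * vF (x h) 1 : ℤ) : ℚ))
  have hrden : ∀ h, Real.exp (ρ * lam h) ≤ (r h).den := by
    intro h
    have := hden (x h)
    simp only [r, Rat.neg_den]
    exact this
  obtain ⟨k, hk, hkt⟩ := hroth d hd0 hdω (fun h => (r h).num) (fun h => (r h).den) (fun h => (r h).den_pos)
    (fun h => by
      rw [Int.isCoprime_iff_gcd_eq_one]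
      exact (r h).reduced) B hB1 (by
      intro h
      have hlogq : ρ * lam h ≤ Real.log ((r h).den) := by
        rw [Real.le_log_iff_exp_le (by exact_mod_cast (r h).den_pos)]
        exact hrden h
      have e1 : Real.log B + ∑ h, (d h : ℝ) = (∑ h, (d h : ℝ)) * (Real.log (4 * C1) + 1) := by
        rw [hB, Real.log_pow, hsd']; ring
      rw [e1]
      have e2 : ω * (ρ * Lam) ≤ ω * (d h * Real.log ((r h).den)) := by
        apply mul_le_mul_of_nonneg_left _ hω.le
        have a := mul_le_mul_of_nonneg_left hlogq (Nat.cast_nonneg (d h) : (0:ℝ) ≤ d h)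
        have b := mul_le_mul_of_nonneg_left (hL1 h) hρ.le
        linarith
      refine le_trans ?_ e2
      have a := mul_le_mul_of_nonneg_right hsd (by linarith : 0 ≤ Real.log (4 * C1) + 1)
      have b := mul_le_mul_of_nonneg_left hX03 hLamp.le
      have : (∑ h, (d h : ℝ)) * (Real.log (4 * C1) + 1) * X0 ≤ (ω * (ρ * Lam)) * X0 := by linarith
      exact le_of_mul_le_mul_right this hX00) p hp0 hpB hpd
  have hk' := hpI k (by
    convert hk using 5 with h
    exact (Rat.num_div_den (r h)).symm)
  linarith

end RS

namespace RS
open Finset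

/-- cross product -/
def cr (u v : Fin 3 → ℤ) : Fin 3 → ℤ :=
  ![u 1 * v 2 - u 2 * v 1, u 2 * v 0 - u 0 * v 2, u 0 * v 1 - u 1 * v 0]

theorem cr_perm (u v : Fin 3 → ℤ) (i j : Fin 3) (hij : i ≠ j) (hi : cr u v i ≠ 0) :
    ∃ τ : Equiv.Perm (Fin 3), τ 0 = i ∧
      u (τ 1) * v (τ 2) - u (τ 2) * v (τ 1) ≠ 0 ∧
      ((u (τ 2) * v (τ 0) - u (τ 0) * v (τ 2) : ℤ) : ℚ) / ((u (τ 1) * v (τ 2) - u (τ 2) * v (τ 1) : ℤ) : ℚ)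
       = (cr u v j : ℚ) / (cr u v i : ℚ) := by
  have aux : ∀ a b c d : ℤ, c = -a → d = -b → (a : ℚ) / b = (c : ℚ) / d := by
    intro a b c d h1 h2
    rw [h1, h2]; push_cast; rw [neg_div_neg_eq]
  have aux2 : ∀ a b c d : ℤ, c = a → d = b → (a : ℚ) / b = (c : ℚ) / d := by
    intro a b c d h1 h2
    rw [h1, h2]
  fin_cases i <;> fin_cases j <;> simp [cr] at hi hij ⊢
  · refine ⟨1, rfl, hi, rfl⟩
  · refine ⟨Equiv.swap 1 2, by decide, ?_, ?_⟩
    · simp [Equiv.swap_apply_of_ne_of_ne]; intro h; apply hi; linarith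
    · simp [Equiv.swap_apply_of_ne_of_ne]
      have := aux (u 1 * v 0 - u 0 * v 1) (u 2 * v 1 - u 1 * v 2) (u 0 * v 1 - u 1 * v 0) (u 1 * v 2 - u 2 * v 1) (by ring) (by ring)
      push_cast at this
      exact this
  · refine ⟨Equiv.swap 0 1, by decide, ?_, ?_⟩
    · simp [Equiv.swap_apply_of_ne_of_ne]; intro h; apply hi; linarith
    · simp [Equiv.swap_apply_of_ne_of_ne]
      have := aux (u 2 * v 1 - u 1 * v 2) (u 0 * v 2 - u 2 * v 0) (u 1 * v 2 - u 2 * v 1) (u 2 * v 0 - u 0 * v 2) (by ring) (by ring)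
      push_cast at this
      exact this
  · refine ⟨finRotate 3, by decide, ?_, ?_⟩
    · simpa [show finRotate 3 0 = 1 from by decide, show finRotate 3 1 = 2 from by decide, show finRotate 3 2 = 0 from by decide] using hi
    · simp [show finRotate 3 0 = 1 from by decide, show finRotate 3 1 = 2 from by decide, show finRotate 3 2 = 0 from by decide]
  · refine ⟨(finRotate 3)⁻¹, by decide, ?_, ?_⟩
    · simpa [show (finRotate 3)⁻¹ 0 = 2 from by decide, show (finRotate 3)⁻¹ 1 = 0 from by decide, show (finRotate 3)⁻¹ 2 = 1 from by decide] using hi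
    · simp only [show (finRotate 3)⁻¹ 0 = 2 from by decide, show (finRotate 3)⁻¹ 1 = 0 from by decide, show (finRotate 3)⁻¹ 2 = 1 from by decide]
  · refine ⟨Equiv.swap 0 2, by decide, ?_, ?_⟩
    · simp [Equiv.swap_apply_of_ne_of_ne]; intro h; apply hi; linarith
    · simp [Equiv.swap_apply_of_ne_of_ne]
      have := aux (u 0 * v 2 - u 2 * v 0) (u 1 * v 0 - u 0 * v 1) (u 2 * v 0 - u 0 * v 2) (u 0 * v 1 - u 1 * v 0) (by ring) (by ring)
      push_cast at this
      exact this

theorem T2 (β : ℝ) (hβ : IsIntegral ℤ β) (a : ℝ) (ha : a ≠ 0) (G : Matrix (Fin 3) (Fin 3) ℝ)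
    (hG : ∀ i j, a * G i j ∈ Algebra.adjoin ℤ {β})
    (hinv : ∀ k, ∃ g : Fin 3 → ℝ, ∀ i, ∑ j, G i j * g j = if i = k then 1 else 0)
    (c : Fin 3 → ℝ) (hc : ∑ i, c i < 0) (Cc : ℝ) (hCc : 0 ≤ Cc) (ρ : ℝ) (hρ : 0 < ρ)
    (H : ∀ X : ℝ, ∃ lam ≥ X, ∃ u v : Fin 3 → ℤ, ∃ lu lv : Fin 3 → ℝ,
      (∀ i, ∑ j, G i j * lu j = u i) ∧ (∀ i, ∑ j, G i j * lv j = v i) ∧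
      (∀ i, |lu i| ≤ Cc * Real.exp (c i * lam)) ∧ (∀ i, |lv i| ≤ Cc * Real.exp (c i * lam)) ∧
      ∃ i j, cr u v i ≠ 0 ∧ Real.exp (ρ * lam) ≤ (((cr u v j : ℚ) / (cr u v i : ℚ)).den : ℝ)) :
    False := by
  let S := Algebra.adjoin ℤ {β}
  haveI : Module.Finite ℤ S := Module.Finite.iff_fg.mpr hβ.fg_adjoin_singleton
  haveI : Module.Free ℤ S := inferInstance
  -- pigeonhole
  have H2 : ∃ τ : Equiv.Perm (Fin 3), ∀ X : ℝ, ∃ lam ≥ X, ∃ u v : Fin 3 → ℤ, ∃ lu lv : Fin 3 → ℝ,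
      (∀ i, ∑ j, G i j * lu j = u i) ∧ (∀ i, ∑ j, G i j * lv j = v i) ∧
      (∀ i, |lu i| ≤ Cc * Real.exp (c i * lam)) ∧ (∀ i, |lv i| ≤ Cc * Real.exp (c i * lam)) ∧
      u (τ 1) * v (τ 2) - u (τ 2) * v (τ 1) ≠ 0 ∧
      Real.exp (ρ * lam) ≤ ((((u (τ 2) * v (τ 0) - u (τ 0) * v (τ 2) : ℤ) : ℚ) / ((u (τ 1) * v (τ 2) - u (τ 2) * v (τ 1) : ℤ) : ℚ)).den : ℝ) := by
    by_contra hcon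
    push Not at hcon
    choose X hX using hcon
    obtain ⟨lam, hlam, u, v, lu, lv, h1, h2, h3, h4, i, j, hi, hden⟩ := H (1 + ∑ τ, |X τ|)
    have hs : ∀ τ, |X τ| ≤ ∑ τ, |X τ| := fun τ =>
      single_le_sum (f := fun τ => |X τ|) (fun _ _ => abs_nonneg _) (mem_univ τ)
    have hlam1 : 1 ≤ lam := by
      have := (abs_nonneg _).trans (hs 1)
      linarith
    have hij : i ≠ j := by
      rintro rfl
      rw [div_self (by exact_mod_cast hi)] at hden
      have : 1 < Real.exp (ρ * lam) := Real.one_lt_exp_iff.mpr (by positivity)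
      simp at hden
      nlinarith
    obtain ⟨τ, _, hne, hr⟩ := cr_perm u v i j hij hi
    have := hX τ lam (by have := (le_abs_self _).trans (hs τ); linarith) u v lu lv h1 h2 h3 h4 hne
    rw [hr] at this
    linarith
  obtain ⟨τ, hτ⟩ := H2
  obtain ⟨g, hg⟩ := hinv (τ 0)
  have hsum : ∀ i, ∀ l : Fin 3 → ℝ, ∑ j, (a * G i j) * (l j / a) = ∑ j, G i j * l j := by
    intro i l
    refine sum_congr rfl fun j _ => ?_
    field_simp
  refine T1 (S := S) (algebraMap S ℝ) (fun i j => ⟨a * G (τ i) j, hG _ _⟩) (fun j => g j / a) ?_ c hc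
    (Cc / |a|) (by positivity) ρ hρ ?_
  · intro i
    change ∑ j, (a * G (τ i) j) * (g j / a) = _
    rw [hsum, hg]
    simp
  · intro X
    obtain ⟨lam, hlam, u, v, lu, lv, h1, h2, h3, h4, h5, h6⟩ := hτ X
    refine ⟨lam, hlam, u ∘ τ, v ∘ τ, fun j => lu j / a, fun j => lv j / a, ?_, ?_, ?_, ?_, h5, h6⟩
    · intro i
      change ∑ j, (a * G (τ i) j) * (lu j / a) = _
      rw [hsum, h1]; rfl
    · intro i
      change ∑ j, (a * G (τ i) j) * (lv j / a) = _
      rw [hsum, h2]; rfl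
    · intro i
      rw [abs_div, div_mul_eq_mul_div]
      exact div_le_div_of_nonneg_right (h3 i) (abs_nonneg _)
    · intro i
      rw [abs_div, div_mul_eq_mul_div]
      exact div_le_div_of_nonneg_right (h4 i) (abs_nonneg _)

/-- Bezout form of primitivity -/
def Prim (x : Fin 3 → ℤ) : Prop := ∃ b : Fin 3 → ℤ, b 0 * x 0 + b 1 * x 1 + b 2 * x 2 = 1

theorem Prim.par {x y : Fin 3 → ℤ} (hx : Prim x) (h : cr x y = 0) : ∃ k : ℤ, ∀ i, y i = k * x i := by
  obtain ⟨b, hb⟩ := hx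
  have h0 := congrFun h 0
  have h1 := congrFun h 1
  have h2 := congrFun h 2
  simp [cr] at h0 h1 h2
  refine ⟨b 0 * y 0 + b 1 * y 1 + b 2 * y 2, fun i => ?_⟩
  fin_cases i <;> simp only [Fin.zero_eta, Fin.mk_one, Fin.reduceFinMk]
  · linear_combination -(y 0) * hb + (b 2) * h1 - (b 1) * h2
  · linear_combination -(y 1) * hb + (b 0) * h2 - (b 2) * h0
  · linear_combination -(y 2) * hb + (b 1) * h0 - (b 0) * h1

theorem dvd_den_mul (a b : ℤ) (hb : b ≠ 0) : b ∣ (((a : ℚ) / b).den : ℤ) * a := by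
  set r := (a : ℚ) / b with hr
  have h1 : (r.num : ℚ) = r * r.den := (Rat.mul_den_eq_num r).symm
  refine ⟨r.num, ?_⟩
  have hb' : (b : ℚ) ≠ 0 := by exact_mod_cast hb
  have : ((r.den : ℚ)) * a = b * r.num := by
    rw [h1, hr]; field_simp
  exact_mod_cast this

theorem Prim.den {x : Fin 3 → ℤ} (hx : Prim x) (i : Fin 3) (hi : x i ≠ 0) :
    ∃ j, |x i| ≤ (((x j : ℚ) / (x i : ℚ)).den : ℤ) ^ 2 := by
  obtain ⟨b, hb⟩ := hx
  have main : ∀ j k : Fin 3, (∃ bi bj bk : ℤ, bi * x i + bj * x j + bk * x k = 1) →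
      ∃ j, |x i| ≤ (((x j : ℚ) / (x i : ℚ)).den : ℤ) ^ 2 := by
    rintro j k ⟨bi, bj, bk, hbb⟩
    set dj := (((x j : ℚ) / (x i : ℚ)).den : ℤ) with hdj
    set dk := (((x k : ℚ) / (x i : ℚ)).den : ℤ) with hdk
    have hjpos : 0 < dj := Int.natCast_pos.mpr (Rat.den_pos _)
    have hkpos : 0 < dk := Int.natCast_pos.mpr (Rat.den_pos _)
    have h1 : x i ∣ dj * x j := dvd_den_mul _ _ hi
    have h2 : x i ∣ dk * x k := dvd_den_mul _ _ hi
    have h3 : x i ∣ dj * dk := by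
      have : dj * dk = x i * (bi * dj * dk) + (dj * x j) * (bj * dk) + (dk * x k) * (bk * dj) := by
        linear_combination -(dj * dk) * hbb
      rw [this]
      exact dvd_add (dvd_add (dvd_mul_right _ _) (h1.mul_right _)) (h2.mul_right _)
    have h4 : |x i| ≤ dj * dk := by
      rw [← abs_of_pos (mul_pos hjpos hkpos)]
      rw [← abs_dvd_abs] at h3
      exact Int.le_of_dvd (abs_pos.mpr (mul_pos hjpos hkpos).ne') h3
    rcases le_total dj dk with h | h
    · exact ⟨k, by rw [← hdk]; nlinarith⟩
    · exact ⟨j, by rw [← hdj]; nlinarith⟩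
  fin_cases i
  · exact main 1 2 ⟨b 0, b 1, b 2, hb⟩
  · exact main 0 2 ⟨b 1, b 0, b 2, by rw [← hb]; simp; ring⟩
  · exact main 0 1 ⟨b 2, b 0, b 1, by rw [← hb]; simp; ring⟩

end RS

namespace RS
open Finset

theorem dirich (θ1 θ2 : ℝ) (Q N : ℕ) (hQ : 1 ≤ Q) (hN : 1 ≤ N) :
    ∃ w : Fin 3 → ℤ, (w 0 ≠ 0 ∨ w 1 ≠ 0) ∧ |w 0| < Q ∧ |w 1| ≤ N ∧
      |θ1 * w 0 + θ2 * w 1 + w 2| ≤ 1 / ((Q : ℝ) * N) := by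
  have hQN : (0 : ℝ) < (Q : ℝ) * N := by positivity
  let f : ℕ × ℕ → ℕ := fun p => ⌊(Q : ℝ) * N * Int.fract (θ1 * p.1 + θ2 * p.2)⌋₊
  obtain ⟨p, hp, p', hp', hne, heq⟩ : ∃ p ∈ range Q ×ˢ range (N + 1), ∃ p' ∈ range Q ×ˢ range (N + 1),
      p ≠ p' ∧ f p = f p' := by
    refine exists_ne_map_eq_of_card_lt_of_maps_to (t := range (Q * N)) ?_ ?_
    · simp; nlinarith
    · intro p _
      have : (Q : ℝ) * N * Int.fract (θ1 * p.1 + θ2 * p.2) < Q * N := by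
        have := Int.fract_lt_one (θ1 * p.1 + θ2 * p.2)
        nlinarith
      simp only [coe_range, Set.mem_Iio, f]
      rw [Nat.floor_lt (mul_nonneg hQN.le (Int.fract_nonneg _))]
      push_cast; exact this
  simp only [mem_product, mem_range] at hp hp'
  set A := θ1 * p.1 + θ2 * p.2 with hA
  set B := θ1 * p'.1 + θ2 * p'.2 with hB
  refine ⟨![(p.1 : ℤ) - p'.1, (p.2 : ℤ) - p'.2, -(⌊A⌋ - ⌊B⌋)], ?_, ?_, ?_, ?_⟩
  · simp only [Matrix.cons_val_zero, Matrix.cons_val_one]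
    by_contra h
    push Not at h
    apply hne
    ext
    · omega
    · omega
  · simp only [Matrix.cons_val_zero]
    rw [abs_lt]; omega
  · change |(p.2 : ℤ) - p'.2| ≤ N
    rw [abs_le]; omega
  · simp
    have e : θ1 * ((p.1 : ℝ) - p'.1) + θ2 * ((p.2 : ℝ) - p'.2) + (⌊B⌋ - ⌊A⌋ : ℝ) = Int.fract A - Int.fract B := by
      unfold Int.fract
      rw [hA, hB]; ring
    rw [e]
    have h1 : (Q : ℝ) * N * Int.fract A < f p + 1 := Nat.lt_floor_add_one _
    have h2 : (Q : ℝ) * N * Int.fract B < f p' + 1 := Nat.lt_floor_add_one _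
    have h3 : (f p : ℝ) ≤ (Q : ℝ) * N * Int.fract A := Nat.floor_le (mul_nonneg hQN.le (Int.fract_nonneg _))
    have h4 : (f p' : ℝ) ≤ (Q : ℝ) * N * Int.fract B := Nat.floor_le (mul_nonneg hQN.le (Int.fract_nonneg _))
    have h5 : (f p : ℝ) = f p' := by exact_mod_cast heq
    have : (Q : ℝ) * N * |Int.fract A - Int.fract B| ≤ 1 := by
      rw [← abs_of_pos hQN, ← abs_mul, abs_le]
      constructor <;> linarith
    have h6 : |Int.fract A - Int.fract B| ≤ 1 / ((Q : ℝ) * N) := by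
      rw [le_div_iff₀ hQN]; linarith
    rw [one_div, mul_inv, mul_comm] at h6
    exact h6

/-- `z` is orthogonal to `x` -/
def Orth (x z : Fin 3 → ℤ) : Prop := z 0 * x 0 + z 1 * x 1 + z 2 * x 2 = 0

theorem orth_cr (x w : Fin 3 → ℤ) : Orth x (cr x w) := by
  simp [Orth, cr]; ring

theorem dualpt (θ1 θ2 K : ℝ) (hK : 0 ≤ K) (x : Fin 3 → ℤ) (hx : Prim x) (Q N : ℕ) (hQ : 1 ≤ Q) (hx0 : x 0 = Q)
    (hx1 : |x 1| ≤ x 0) (hL : |θ1 * x 0 + θ2 * x 1 + x 2| ≤ K / (Q : ℝ) ^ 3) (hQN : Q ≤ N) (hN : N ^ 2 ≤ Q ^ 3) :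
    ∃ z : Fin 3 → ℤ, z ≠ 0 ∧ Orth x z ∧ |z 2| ≤ 2 * Q * N ∧
      |z 0 - θ1 * z 2| ≤ (K + 1) / N ∧ |z 1 - θ2 * z 2| ≤ (K + 1) / N := by
  have hN1 : 1 ≤ N := hQ.trans hQN
  obtain ⟨w, hw, hw0, hw1, hLw⟩ := dirich θ1 θ2 Q N hQ hN1
  have hQr : (1 : ℝ) ≤ Q := by exact_mod_cast hQ
  have hNr : (1 : ℝ) ≤ N := by exact_mod_cast hN1
  have hQN' : (Q : ℝ) ≤ N := by exact_mod_cast hQN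
  have hN' : (N : ℝ) ^ 2 ≤ (Q : ℝ) ^ 3 := by exact_mod_cast hN
  have hx1r : |(x 1 : ℝ)| ≤ Q := by
    rw [hx0] at hx1; exact_mod_cast hx1
  have hw0r : |(w 0 : ℝ)| ≤ Q := by
    exact_mod_cast hw0.le
  have hw1r : |(w 1 : ℝ)| ≤ N := by exact_mod_cast hw1
  set Lx := θ1 * x 0 + θ2 * x 1 + x 2 with hLx
  set Lw := θ1 * w 0 + θ2 * w 1 + w 2 with hLw'
  have hx0r : (x 0 : ℝ) = Q := by rw [hx0]; simp
  refine ⟨cr x w, ?_, orth_cr x w, ?_, ?_, ?_⟩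
  · intro h
    obtain ⟨k, hk⟩ := hx.par h
    have h0 := hk 0
    have h1 := hk 1
    rw [h0, hx0, abs_mul, Nat.abs_cast] at hw0
    have hk0 : k = 0 := by
      by_contra hk
      have := Int.one_le_abs hk
      have hQz : (0 : ℤ) < Q := by exact_mod_cast hQ
      nlinarith
    subst hk0
    simp [h0, h1] at hw
  · simp only [cr, Matrix.cons_val]
    have h1 : |x 0 * w 1| ≤ Q * N := by
      rw [abs_mul, hx0, Nat.abs_cast]; gcongr
    have h2 : |x 1 * w 0| ≤ Q * N := by
      rw [abs_mul]
      have : |w 0| ≤ N := hw0.le.trans (by exact_mod_cast hQN)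
      rw [hx0] at hx1
      gcongr
    have := abs_sub (x 0 * w 1) (x 1 * w 0)
    linarith
  · have e : ((cr x w 0 : ℤ) : ℝ) - θ1 * (cr x w 2 : ℤ) = x 1 * Lw - w 1 * Lx := by
      simp [cr]; ring
    rw [e]
    have h1 : |x 1 * Lw| ≤ 1 / N := by
      rw [abs_mul]
      calc |(x 1 : ℝ)| * |Lw| ≤ Q * (1 / (Q * N)) := by gcongr
        _ = 1 / N := by field_simp
    have h2 : |w 1 * Lx| ≤ K / N := by
      rw [abs_mul]
      calc |(w 1 : ℝ)| * |Lx| ≤ N * (K / Q ^ 3) := by gcongr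
        _ ≤ N * (K / N ^ 2) := by gcongr
        _ = K / N := by field_simp
    have := abs_sub (x 1 * Lw) (w 1 * Lx)
    rw [add_div]; linarith
  · have e : ((cr x w 1 : ℤ) : ℝ) - θ2 * (cr x w 2 : ℤ) = w 0 * Lx - x 0 * Lw := by
      simp [cr]; ring
    rw [e]
    have h1 : |x 0 * Lw| ≤ 1 / N := by
      rw [abs_mul, hx0r, Nat.abs_cast]
      calc (Q : ℝ) * |Lw| ≤ Q * (1 / (Q * N)) := by gcongr
        _ = 1 / N := by field_simp
    have h2 : |w 0 * Lx| ≤ K / N := by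
      rw [abs_mul]
      calc |(w 0 : ℝ)| * |Lx| ≤ N * (K / Q ^ 3) := by gcongr; linarith
        _ ≤ N * (K / N ^ 2) := by gcongr
        _ = K / N := by field_simp
    have := abs_sub (w 0 * Lx) (x 0 * Lw)
    rw [add_div]; linarith

theorem exists_prim (z : Fin 3 → ℤ) (hz : z ≠ 0) : ∃ g : ℤ, 0 < g ∧ ∃ t, Prim t ∧ ∀ i, z i = g * t i := by
  set g1 : ℤ := (Int.gcd (z 0) (z 1) : ℤ) with hg1
  set g : ℤ := (Int.gcd g1 (z 2) : ℤ) with hg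
  have hb1 := Int.gcd_eq_gcd_ab (z 0) (z 1)
  have hb2 := Int.gcd_eq_gcd_ab g1 (z 2)
  rw [← hg1] at hb1
  rw [← hg] at hb2
  have d2 : g ∣ z 2 := Int.gcd_dvd_right _ _
  have d1 : g ∣ g1 := Int.gcd_dvd_left _ _
  have d0 : g1 ∣ z 0 := Int.gcd_dvd_left _ _
  have d01 : g1 ∣ z 1 := Int.gcd_dvd_right _ _
  obtain ⟨t2, h2⟩ := d2
  obtain ⟨t0, h0⟩ := d1.trans d0
  obtain ⟨t1, h1⟩ := d1.trans d01
  have hg0 : g ≠ 0 := by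
    intro h
    apply hz
    ext i
    rw [h] at h0 h1 h2
    fin_cases i <;> simp [h0, h1, h2]
  have hgp : 0 < g := lt_of_le_of_ne (by positivity) hg0.symm
  refine ⟨g, hgp, ![t0, t1, t2], ?_, ?_⟩
  · refine ⟨![Int.gcdA g1 (z 2) * Int.gcdA (z 0) (z 1), Int.gcdA g1 (z 2) * Int.gcdB (z 0) (z 1), Int.gcdB g1 (z 2)], ?_⟩
    simp only [Matrix.cons_val]
    apply mul_left_cancel₀ hg0
    linear_combination -hb2 - Int.gcdA g1 (z 2) * hb1 - Int.gcdA g1 (z 2) * Int.gcdA (z 0) (z 1) * h0 - Int.gcdA g1 (z 2) * Int.gcdB (z 0) (z 1) * h1 - Int.gcdB g1 (z 2) * h2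
  · intro i
    fin_cases i <;> simp [h0, h1, h2]

end RS

namespace RS
open Finset

theorem step1 (θ1 θ2 K : ℝ) (hK : 1 ≤ K) (x : Fin 3 → ℤ) (hx : Prim x) (q : ℝ) (hq : 8 ≤ q)
    (hq2 : 2 * (K + 1) < q)
    (Q : ℕ) (hx0 : x 0 = Q) (hQq : (Q : ℝ) = q ^ 8) (hx1 : |x 1| ≤ x 0)
    (hL : |θ1 * x 0 + θ2 * x 1 + x 2| ≤ K / (Q : ℝ) ^ 3) :
    ∃ z : Fin 3 → ℤ, Prim z ∧ Orth x z ∧ z 2 ≠ 0 ∧ |(z 2 : ℝ)| ≤ 2 * q ^ 20 ∧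
      |z 0 - θ1 * z 2| ≤ 2 * (K + 1) / q ^ 12 ∧ |z 1 - θ2 * z 2| ≤ 2 * (K + 1) / q ^ 12 := by
  have hq0 : 0 < q := by linarith
  have hq1 : 1 ≤ q := by linarith
  have hQ1 : 1 ≤ Q := by
    have : (1 : ℝ) ≤ Q := by rw [hQq]; exact one_le_pow₀ hq1
    exact_mod_cast this
  set N := ⌊q ^ 12⌋₊ with hN
  have hq12 : 1 ≤ q ^ 12 := one_le_pow₀ hq1
  have hNle : (N : ℝ) ≤ q ^ 12 := Nat.floor_le (by positivity)
  have hNge : q ^ 12 / 2 ≤ N := by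
    have h1 : q ^ 12 < N + 1 := Nat.lt_floor_add_one _
    have h2 : (1 : ℝ) ≤ N := by
      have : 1 ≤ N := Nat.le_floor (by simpa using hq12)
      exact_mod_cast this
    linarith
  have hQN : Q ≤ N := Nat.le_floor (by rw [hQq]; exact pow_le_pow_right₀ hq1 (by norm_num))
  have hN2 : N ^ 2 ≤ Q ^ 3 := by
    have : (N : ℝ) ^ 2 ≤ (Q : ℝ) ^ 3 := by
      rw [hQq]
      calc (N : ℝ) ^ 2 ≤ (q ^ 12) ^ 2 := by gcongr
        _ = (q ^ 8) ^ 3 := by ring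
    exact_mod_cast this
  obtain ⟨z, hz, ho, hz2, he0, he1⟩ := dualpt θ1 θ2 K (by linarith) x hx Q N hQ1 hx0 hx1 hL hQN hN2
  obtain ⟨g, hg, t, ht, hzt⟩ := exists_prim z hz
  have hbd : (K + 1) / N ≤ 2 * (K + 1) / q ^ 12 := by
    calc (K + 1) / N ≤ (K + 1) / (q ^ 12 / 2) := by gcongr
      _ = _ := by field_simp
  have hgr : (1 : ℝ) ≤ g := by exact_mod_cast hg
  have hscale : ∀ r : ℝ, |r| ≤ |g * r| := by
    intro r
    rw [abs_mul, abs_of_pos (by linarith : (0 : ℝ) < g)]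
    nlinarith [abs_nonneg r]
  have h0 : |t 0 - θ1 * t 2| ≤ 2 * (K + 1) / q ^ 12 := by
    refine (hscale _).trans (le_trans ?_ hbd)
    rw [show (g : ℝ) * (t 0 - θ1 * t 2) = z 0 - θ1 * z 2 by rw [hzt 0, hzt 2]; push_cast; ring]
    exact he0
  have h1 : |t 1 - θ2 * t 2| ≤ 2 * (K + 1) / q ^ 12 := by
    refine (hscale _).trans (le_trans ?_ hbd)
    rw [show (g : ℝ) * (t 1 - θ2 * t 2) = z 1 - θ2 * z 2 by rw [hzt 1, hzt 2]; push_cast; ring]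
    exact he1
  have hlt : 2 * (K + 1) / q ^ 12 < 1 := by
    rw [div_lt_one (by positivity)]
    calc 2 * (K + 1) < q := hq2
      _ = q ^ 1 := by ring
      _ ≤ q ^ 12 := pow_le_pow_right₀ hq1 (by norm_num)
  refine ⟨t, ht, ?_, ?_, ?_, h0, h1⟩
  · unfold Orth at ho ⊢
    rw [hzt 0, hzt 1, hzt 2] at ho
    apply mul_left_cancel₀ hg.ne'
    linear_combination ho
  · intro h2
    rw [h2] at h0 h1
    simp only [Int.cast_zero, mul_zero, sub_zero] at h0 h1
    have a0 : |t 0| < 1 := by exact_mod_cast h0.trans_lt hlt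
    have a1 : |t 1| < 1 := by exact_mod_cast h1.trans_lt hlt
    rw [Int.abs_lt_one_iff] at a0 a1
    obtain ⟨b, hb⟩ := ht
    simp [a0, a1, h2] at hb
  · have : |(z 2 : ℝ)| ≤ 2 * Q * N := by exact_mod_cast hz2
    refine (hscale _).trans ?_
    rw [show (g : ℝ) * t 2 = z 2 by rw [hzt 2]; push_cast; ring]
    refine this.trans ?_
    rw [hQq]
    calc 2 * q ^ 8 * N ≤ 2 * q ^ 8 * q ^ 12 := by gcongr
      _ = _ := by ring

theorem caseI (θ1 θ2 K A : ℝ) (D : ℕ) (hK : 1 ≤ K) (hA : 0 < A)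
    (hLi : ∀ z : Fin 3 → ℤ, z 2 ≠ 0 → 1 ≤ |(z 2 : ℝ)| ^ D * (|z 0 - θ1 * z 2| * A))
    (x : Fin 3 → ℤ) (hx : Prim x) (q : ℝ) (hq : 8 ≤ q) (hq3 : 2 * (K + 1) * A ≤ q)
    (Q : ℕ) (hx0 : x 0 = Q) (hQq : (Q : ℝ) = q ^ 8) (hx1 : |x 1| ≤ x 0)
    (hL : |θ1 * x 0 + θ2 * x 1 + x 2| ≤ K / (Q : ℝ) ^ 3)
    (z : Fin 3 → ℤ) (hz : Prim z) (ho : Orth x z) (hz2 : z 2 ≠ 0) (hz2u : |(z 2 : ℝ)| ≤ q ^ 17)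
    (he0 : |z 0 - θ1 * z 2| ≤ 2 * (K + 1) / q ^ 12) (he1 : |z 1 - θ2 * z 2| ≤ 2 * (K + 1) / q ^ 12) :
    ∃ w : Fin 3 → ℤ, |(w 0 : ℝ)| ≤ q ^ 8 ∧ |(w 1 : ℝ)| ≤ 2 * q ^ 9 ∧
      |θ1 * w 0 + θ2 * w 1 + w 2| ≤ (3 * K + 2) / q ^ 20 ∧
      ∃ j, cr x w 2 ≠ 0 ∧ q ≤ (((cr x w j : ℚ) / (cr x w 2 : ℚ)).den : ℝ) ^ (2 * (D + 1)) := by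
  have hq0 : 0 < q := by linarith
  have hq1 : 1 ≤ q := by linarith
  have hQ0 : (0 : ℝ) < Q := by rw [hQq]; positivity
  have hQz : (0 : ℤ) < Q := by exact_mod_cast hQ0
  obtain ⟨b, hb⟩ := hx
  set k := cr z b 0 / x 0 with hk
  set w : Fin 3 → ℤ := fun i => cr z b i - k * x i with hw
  have hcr : cr x w = z := by
    unfold Orth at ho
    ext i
    fin_cases i <;> simp [cr, hw]
    · linear_combination (z 0) * hb - (b 0) * ho
    · linear_combination (z 1) * hb - (b 1) * ho
    · linear_combination (z 2) * hb - (b 2) * ho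
  have hw0 : w 0 = cr z b 0 % x 0 := by
    simp only [hw, hk]
    rw [Int.emod_def]; ring
  have hw0n : 0 ≤ w 0 := by rw [hw0]; exact Int.emod_nonneg _ (by omega)
  have hw0l : w 0 < x 0 := by rw [hw0]; exact Int.emod_lt_of_pos _ (by omega)
  have hw0r : |(w 0 : ℝ)| ≤ q ^ 8 := by
    rw [← hQq]
    have : |w 0| ≤ Q := by rw [abs_of_nonneg hw0n]; omega
    exact_mod_cast this
  have hx0r : (x 0 : ℝ) = q ^ 8 := by rw [hx0, ← hQq]; simp
  have hx1r : |(x 1 : ℝ)| ≤ q ^ 8 := by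
    rw [← hx0r]; exact_mod_cast hx1
  set Lx := θ1 * x 0 + θ2 * x 1 + x 2 with hLx
  set Lw := θ1 * w 0 + θ2 * w 1 + w 2 with hLw'
  have ez2 : (z 2 : ℝ) = x 0 * w 1 - x 1 * w 0 := by
    rw [← hcr]; simp [cr]
  have ez1 : (z 1 : ℝ) - θ2 * z 2 = w 0 * Lx - x 0 * Lw := by
    rw [← hcr]; simp [cr]; ring
  clear_value w
  refine ⟨w, hw0r, ?_, ?_, ?_⟩
  · have h1 : q ^ 8 * |(w 1 : ℝ)| ≤ q ^ 8 * (2 * q ^ 9) := by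
      calc q ^ 8 * |(w 1 : ℝ)| = |(z 2 : ℝ) + x 1 * w 0| := by
            rw [ez2, sub_add_cancel, abs_mul, hx0r, abs_of_pos (by positivity : (0 : ℝ) < q ^ 8)]
        _ ≤ |(z 2 : ℝ)| + |(x 1 : ℝ)| * |(w 0 : ℝ)| := by
            rw [← abs_mul]; exact abs_add_le _ _
        _ ≤ q ^ 17 + q ^ 8 * q ^ 8 := by gcongr
        _ ≤ q ^ 17 + q * (q ^ 8 * q ^ 8) := by
            have : 0 ≤ q ^ 8 * q ^ 8 := by positivity
            nlinarith
        _ = _ := by ring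
    exact le_of_mul_le_mul_left h1 (by positivity)
  · have h1 : q ^ 8 * |Lw| ≤ q ^ 8 * ((3 * K + 2) / q ^ 20) := by
      calc q ^ 8 * |Lw| = |w 0 * Lx - (z 1 - θ2 * z 2)| := by
            rw [ez1, sub_sub_cancel, abs_mul, hx0r, abs_of_pos (by positivity : (0 : ℝ) < q ^ 8)]
        _ ≤ |(w 0 : ℝ)| * |Lx| + |z 1 - θ2 * z 2| := by
            rw [← abs_mul]; exact abs_sub _ _
        _ ≤ q ^ 8 * (K / (q ^ 8) ^ 3) + 2 * (K + 1) / q ^ 12 := by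
            rw [hQq] at hL
            gcongr
        _ = (K / q ^ 4 + 2 * (K + 1)) / q ^ 12 := by field_simp
        _ ≤ (K + 2 * (K + 1)) / q ^ 12 := by
            gcongr
            exact div_le_self (by linarith) (one_le_pow₀ hq1)
        _ = _ := by field_simp; ring
    exact le_of_mul_le_mul_left h1 (by positivity)
  · obtain ⟨j, hj⟩ := hz.den 2 hz2
    rw [hcr]
    refine ⟨j, hz2, ?_⟩
    set d := ((z j : ℚ) / (z 2 : ℚ)).den
    have hj' : |(z 2 : ℝ)| ≤ (d : ℝ) ^ 2 := by exact_mod_cast hj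
    have hz1 : (1 : ℝ) ≤ |(z 2 : ℝ)| := by exact_mod_cast Int.one_le_abs hz2
    have h1 : q ≤ |(z 2 : ℝ)| ^ D := by
      have h2 : 1 ≤ |(z 2 : ℝ)| ^ D * (2 * (K + 1) / q ^ 12 * A) := (hLi z hz2).trans (by gcongr)
      have h3 : 2 * (K + 1) / q ^ 12 * A ≤ 1 / q := by
        rw [div_mul_eq_mul_div, div_le_div_iff₀ (by positivity) hq0]
        calc 2 * (K + 1) * A * q ≤ q * q := by gcongr
          _ = q ^ 2 := by ring
          _ ≤ 1 * q ^ 12 := by rw [one_mul]; exact pow_le_pow_right₀ hq1 (by norm_num)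
      have h4 : 1 ≤ |(z 2 : ℝ)| ^ D * (1 / q) := h2.trans (by gcongr)
      rw [mul_one_div, le_div_iff₀ hq0] at h4
      linarith
    calc q ≤ |(z 2 : ℝ)| ^ D := h1
      _ ≤ |(z 2 : ℝ)| ^ (D + 1) := pow_le_pow_right₀ hz1 (by omega)
      _ ≤ ((d : ℝ) ^ 2) ^ (D + 1) := by gcongr
      _ = _ := by rw [pow_mul]

theorem cr_cr_orth (x z z' : Fin 3 → ℤ) (h : Orth x z) (h' : Orth x z') : cr x (cr z z') = 0 := by
  unfold Orth at h h'
  ext i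
  fin_cases i <;> simp [cr]
  · linear_combination (z 0) * h' - (z' 0) * h
  · linear_combination (z 1) * h' - (z' 1) * h
  · linear_combination (z 2) * h' - (z' 2) * h

theorem caseII (θ1 θ2 K : ℝ) (hK : 1 ≤ K)
    (x : Fin 3 → ℤ) (hx : Prim x) (q : ℝ) (hq : 8 ≤ q)
    (Q : ℕ) (hx0 : x 0 = Q) (hQq : (Q : ℝ) = q ^ 8) (hx1 : |x 1| ≤ x 0)
    (hL : |θ1 * x 0 + θ2 * x 1 + x 2| ≤ K / (Q : ℝ) ^ 3)
    (z : Fin 3 → ℤ) (hz : Prim z) (ho : Orth x z) (hz2 : z 2 ≠ 0) (hz2l : q ^ 17 ≤ |(z 2 : ℝ)|)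
    (hz2u : |(z 2 : ℝ)| ≤ 2 * q ^ 20)
    (he0 : |z 0 - θ1 * z 2| ≤ 2 * (K + 1) / q ^ 12) (he1 : |z 1 - θ2 * z 2| ≤ 2 * (K + 1) / q ^ 12) :
    ∃ y ≥ q, ∃ z z' : Fin 3 → ℤ, |(z 2 : ℝ)| ≤ y ^ 17 ∧ |(z' 2 : ℝ)| ≤ y ^ 17 ∧
      |z 0 - θ1 * z 2| ≤ 8 * (K + 1) / y ^ 9 ∧ |z 1 - θ2 * z 2| ≤ 8 * (K + 1) / y ^ 9 ∧
      |z' 0 - θ1 * z' 2| ≤ 8 * (K + 1) / y ^ 9 ∧ |z' 1 - θ2 * z' 2| ≤ 8 * (K + 1) / y ^ 9 ∧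
      ∃ j, cr z z' 0 ≠ 0 ∧ y ^ 2 ≤ (((cr z z' j : ℚ) / (cr z z' 0 : ℚ)).den : ℝ) := by
  have hq0 : 0 < q := by linarith
  have hq1 : 1 ≤ q := by linarith
  have hQ0 : (0 : ℝ) < Q := by rw [hQq]; positivity
  have hQ1 : 1 ≤ Q := by exact_mod_cast hQ0
  set T := |(z 2 : ℝ)| with hT
  have hT0 : 0 < T := by positivity
  obtain ⟨y, hy0, hy⟩ : ∃ y : ℝ, 0 < y ∧ y ^ 17 = T := by
    refine ⟨T ^ ((1 : ℝ) / (17 : ℕ)), by positivity, ?_⟩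
    rw [one_div]
    exact Real.rpow_inv_natCast_pow hT0.le (by norm_num)
  have hyq : q ≤ y := le_of_pow_le_pow_left₀ (n := 17) (by norm_num) hy0.le (by rw [hy]; exact hz2l)
  have hyq2 : y ≤ q ^ 2 := by
    refine le_of_pow_le_pow_left₀ (n := 17) (by norm_num) (by positivity) ?_
    rw [hy]
    calc T ≤ 2 * q ^ 20 := hz2u
      _ ≤ q * q ^ 20 := by gcongr; linarith
      _ = q ^ 21 := by ring
      _ ≤ q ^ 34 := pow_le_pow_right₀ hq1 (by norm_num)
      _ = _ := by ring
  set N := ⌊T / (4 * q ^ 8)⌋₊ with hN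
  have hNle : (N : ℝ) ≤ T / (4 * q ^ 8) := Nat.floor_le (by positivity)
  have hr : 2 * q ^ 8 ≤ T / (4 * q ^ 8) := by
    rw [le_div_iff₀ (by positivity)]
    calc 2 * q ^ 8 * (4 * q ^ 8) = 8 * q ^ 16 := by ring
      _ ≤ q * q ^ 16 := by gcongr
      _ = q ^ 17 := by ring
      _ ≤ T := hz2l
  have hq8 : 1 ≤ q ^ 8 := one_le_pow₀ hq1
  have hNge : T / (8 * q ^ 8) ≤ N := by
    have h1 : T / (4 * q ^ 8) < N + 1 := Nat.lt_floor_add_one _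
    have h2 : (1 : ℝ) ≤ N := by
      have : 1 ≤ N := Nat.le_floor (by push_cast; linarith)
      exact_mod_cast this
    have : T / (8 * q ^ 8) = T / (4 * q ^ 8) / 2 := by field_simp; norm_num
    linarith
  have hQN : Q ≤ N := Nat.le_floor (by rw [hQq]; linarith)
  have hN2 : N ^ 2 ≤ Q ^ 3 := by
    have : (N : ℝ) ^ 2 ≤ (Q : ℝ) ^ 3 := by
      rw [hQq]
      have : (N : ℝ) ≤ q ^ 12 := by
        refine hNle.trans ?_
        rw [div_le_iff₀ (by positivity)]
        calc T ≤ 2 * q ^ 20 := hz2u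
          _ ≤ 4 * q ^ 20 := by nlinarith [pow_pos hq0 20]
          _ = _ := by ring
      calc (N : ℝ) ^ 2 ≤ (q ^ 12) ^ 2 := by gcongr
        _ = (q ^ 8) ^ 3 := by ring
    exact_mod_cast this
  obtain ⟨z', hz', ho', hz2', he0', he1'⟩ := dualpt θ1 θ2 K (by linarith) x hx Q N hQ1 hx0 hx1 hL hQN hN2
  have hbd' : (K + 1) / N ≤ 8 * (K + 1) / y ^ 9 := by
    calc (K + 1) / N ≤ (K + 1) / (T / (8 * q ^ 8)) := by gcongr
      _ = 8 * (K + 1) * q ^ 8 / T := by field_simp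
      _ ≤ 8 * (K + 1) * y ^ 8 / T := by gcongr
      _ = 8 * (K + 1) / y ^ 9 := by rw [← hy]; field_simp
  have hbd : 2 * (K + 1) / q ^ 12 ≤ 8 * (K + 1) / y ^ 9 := by
    calc 2 * (K + 1) / q ^ 12 = 4 * (K + 1) * q ^ 8 / (2 * q ^ 20) := by field_simp; norm_num
      _ ≤ 4 * (K + 1) * q ^ 8 / T := by gcongr
      _ ≤ 8 * (K + 1) * y ^ 8 / T := by gcongr; norm_num
      _ = 8 * (K + 1) / y ^ 9 := by rw [← hy]; field_simp
  have hz2r : |(z' 2 : ℝ)| ≤ T / 2 := by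
    have : |(z' 2 : ℝ)| ≤ 2 * Q * N := by exact_mod_cast hz2'
    refine this.trans ?_
    rw [hQq]
    calc 2 * q ^ 8 * N ≤ 2 * q ^ 8 * (T / (4 * q ^ 8)) := by gcongr
      _ = T / 2 := by field_simp; norm_num
  obtain ⟨κ, hκ⟩ := hx.par (cr_cr_orth x z z' ho ho')
  have hκ0 : κ ≠ 0 := by
    rintro rfl
    have h0 : cr z z' = 0 := by ext i; simp [hκ i]
    obtain ⟨k, hk⟩ := hz.par h0
    have hk0 : k = 0 := by
      by_contra hk0
      have h1 : (1 : ℝ) ≤ |(k : ℝ)| := by exact_mod_cast Int.one_le_abs hk0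
      rw [hk 2] at hz2r
      push_cast at hz2r
      rw [abs_mul, ← hT] at hz2r
      nlinarith
    apply hz'
    ext i
    simp [hk i, hk0]
  have hx00 : x 0 ≠ 0 := by rw [hx0]; exact_mod_cast (by omega : Q ≠ 0)
  obtain ⟨j, hj⟩ := hx.den 0 hx00
  refine ⟨y, hyq, z, z', hy.ge, hz2r.trans (by rw [hy]; linarith), he0.trans hbd, he1.trans hbd,
    he0'.trans hbd', he1'.trans hbd', j, ?_, ?_⟩
  · rw [hκ]; exact mul_ne_zero hκ0 hx00
  · rw [hκ, hκ]
    push_cast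
    rw [mul_div_mul_left _ _ (by exact_mod_cast hκ0 : (κ : ℚ) ≠ 0)]
    set d := ((x j : ℚ) / (x 0 : ℚ)).den
    have hj' : |(x 0 : ℝ)| ≤ (d : ℝ) ^ 2 := by exact_mod_cast hj
    rw [hx0] at hj'
    simp only [Int.cast_natCast, Nat.abs_cast] at hj'
    rw [hQq] at hj'
    have : q ^ 4 ≤ d := by
      refine le_of_pow_le_pow_left₀ (n := 2) (by norm_num) (by positivity) ?_
      rw [← pow_mul]; exact hj'
    calc y ^ 2 ≤ (q ^ 2) ^ 2 := by gcongr
      _ = q ^ 4 := by ring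
      _ ≤ d := this

end RS

namespace RS
open Finset

theorem exp_nat_log (y : ℝ) (hy : 0 < y) (n : ℕ) : Real.exp ((n : ℝ) * Real.log y) = y ^ n := by
  rw [Real.exp_nat_mul, Real.exp_log hy]

theorem exp_neg_nat_log (y : ℝ) (hy : 0 < y) (n : ℕ) : Real.exp (-(n : ℝ) * Real.log y) = (y ^ n)⁻¹ := by
  rw [neg_mul, Real.exp_neg, exp_nat_log y hy]

theorem liou (α : ℝ) (hα : Irrational α) (halg : IsAlgebraic ℤ α) :
    ∃ A : ℝ, 0 < A ∧ ∃ D : ℕ, ∀ z : Fin 3 → ℤ, z 2 ≠ 0 → 1 ≤ |(z 2 : ℝ)| ^ D * (|z 0 - α * z 2| * A) := by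
  obtain ⟨f, hf0, hf⟩ := halg
  obtain ⟨A, hA, h⟩ := Liouville.exists_pos_real_of_irrational_root hα hf0
    (by rw [Polynomial.eval_map_algebraMap]; exact hf)
  refine ⟨A, hA, f.natDegree, ?_⟩
  have key : ∀ (p : ℤ) (b : ℤ), 0 < b → 1 ≤ (b : ℝ) ^ f.natDegree * (|p - α * b| * A) := by
    intro p b hb
    obtain ⟨n, rfl⟩ : ∃ n : ℕ, b = n + 1 := ⟨(b - 1).toNat, by omega⟩
    have := h p n
    push_cast
    refine this.trans ?_
    have e : α - p / ((n : ℝ) + 1) = -(p - α * (n + 1)) / (n + 1) := by field_simp; ring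
    rw [e, abs_div, abs_neg, abs_of_pos (by positivity : (0 : ℝ) < n + 1)]
    gcongr
    exact div_le_self (abs_nonneg _) (by linarith [Nat.cast_nonneg (α := ℝ) n])
  intro z hz
  rcases lt_or_gt_of_ne hz with hz | hz
  · have := key (-(z 0)) (-(z 2)) (by omega)
    push_cast at this
    rw [abs_of_neg (by exact_mod_cast hz : (z 2 : ℝ) < 0)]
    refine this.trans_eq ?_
    rw [show -(z 0 : ℝ) - α * -(z 2 : ℝ) = -(z 0 - α * z 2) by ring, abs_neg]
  · have := key (z 0) (z 2) hz
    rwa [abs_of_pos (by exact_mod_cast hz : (0 : ℝ) < z 2)]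

theorem geom (α : ℝ) (hirr : Irrational α) (halg : IsAlgebraic ℤ α) (K : ℝ) (hK : 1 ≤ K)
    (H : ∀ X : ℝ, ∃ x : Fin 3 → ℤ, Prim x ∧ X ≤ x 0 ∧ |x 1| ≤ x 0 ∧
      |α * x 0 + (α ^ 2 - α) * x 1 + x 2| * (x 0 : ℝ) ^ 3 ≤ K) : False := by
  obtain ⟨A, hA, D, hLi⟩ := liou α hirr halg
  set θ2 := α ^ 2 - α with hθ2
  -- dichotomy
  have H2 : ∀ q0 : ℝ, ∃ q ≥ q0, 8 ≤ q ∧ ∃ x : Fin 3 → ℤ, |(x 0 : ℝ)| ≤ q ^ 8 ∧ |(x 1 : ℝ)| ≤ q ^ 8 ∧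
      |α * x 0 + θ2 * x 1 + x 2| ≤ K / q ^ 24 ∧
      ((∃ w : Fin 3 → ℤ, |(w 0 : ℝ)| ≤ q ^ 8 ∧ |(w 1 : ℝ)| ≤ 2 * q ^ 9 ∧
      |α * w 0 + θ2 * w 1 + w 2| ≤ (3 * K + 2) / q ^ 20 ∧
      ∃ j, cr x w 2 ≠ 0 ∧ q ≤ (((cr x w j : ℚ) / (cr x w 2 : ℚ)).den : ℝ) ^ (2 * (D + 1))) ∨
      (∃ y ≥ q, ∃ z z' : Fin 3 → ℤ, |(z 2 : ℝ)| ≤ y ^ 17 ∧ |(z' 2 : ℝ)| ≤ y ^ 17 ∧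
      |z 0 - α * z 2| ≤ 8 * (K + 1) / y ^ 9 ∧ |z 1 - θ2 * z 2| ≤ 8 * (K + 1) / y ^ 9 ∧
      |z' 0 - α * z' 2| ≤ 8 * (K + 1) / y ^ 9 ∧ |z' 1 - θ2 * z' 2| ≤ 8 * (K + 1) / y ^ 9 ∧
      ∃ j, cr z z' 0 ≠ 0 ∧ y ^ 2 ≤ (((cr z z' j : ℚ) / (cr z z' 0 : ℚ)).den : ℝ))) := by
    intro q0
    set q1 := |q0| + 8 + (2 * (K + 1) + 1) + 2 * (K + 1) * A with hq1
    have hpos : 0 ≤ 2 * (K + 1) * A := by positivity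
    have hq10 : 0 < q1 := by have := abs_nonneg q0; linarith
    obtain ⟨x, hx, hX, hx1, hL⟩ := H (q1 ^ 8)
    have hx00 : 0 < (x 0 : ℝ) := lt_of_lt_of_le (by positivity) hX
    have hx0z : 0 < x 0 := by exact_mod_cast hx00
    obtain ⟨q, hq0', hq8⟩ : ∃ q : ℝ, 0 < q ∧ q ^ 8 = x 0 := by
      refine ⟨(x 0 : ℝ) ^ ((1 : ℝ) / (8 : ℕ)), by positivity, ?_⟩
      rw [one_div]
      exact Real.rpow_inv_natCast_pow hx00.le (by norm_num)
    have hqq1 : q1 ≤ q := le_of_pow_le_pow_left₀ (n := 8) (by norm_num) hq0'.le (by rw [hq8]; exact hX)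
    have hab := abs_nonneg q0
    have hab2 := le_abs_self q0
    have hq : 8 ≤ q := by linarith
    obtain ⟨Q, hQ⟩ : ∃ Q : ℕ, x 0 = Q := ⟨(x 0).toNat, by omega⟩
    have hQq : (Q : ℝ) = q ^ 8 := by rw [hq8, hQ]; simp
    have hL' : |α * x 0 + θ2 * x 1 + x 2| ≤ K / (Q : ℝ) ^ 3 := by
      rw [le_div_iff₀ (by rw [hQq]; positivity), hQq, hq8]
      exact hL
    refine ⟨q, by linarith, hq, x, ?_, ?_, ?_, ?_⟩
    · rw [hq8, abs_of_pos hx00]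
    · rw [hq8]; exact_mod_cast hx1
    · rw [hQq, ← pow_mul] at hL'; exact hL'
    · obtain ⟨z, hz, ho, hz2, hz2u, he0, he1⟩ := step1 α θ2 K hK x hx q hq (by linarith) Q hQ hQq hx1 hL'
      rcases le_total |(z 2 : ℝ)| (q ^ 17) with h | h
      · left
        exact caseI α θ2 K A D hK hA hLi x hx q hq (by linarith) Q hQ hQq hx1 hL' z hz ho hz2 h he0 he1
      · right
        exact caseII α θ2 K hK x hx q hq Q hQ hQq hx1 hL' z hz ho hz2 h hz2u he0 he1
  -- integrality
  obtain ⟨a0, ha0, hintg⟩ := halg.exists_integral_multiple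
  set β : ℝ := a0 • α with hβ
  have hβ' : β = a0 * α := by simp [hβ]
  have hβm : β ∈ Algebra.adjoin ℤ {β} := Algebra.subset_adjoin rfl
  have ha0m : (a0 : ℝ) ∈ Algebra.adjoin ℤ {β} := by
    have := Subalgebra.algebraMap_mem (Algebra.adjoin ℤ {β}) a0
    simpa using this
  have ha0r : (a0 : ℝ) ≠ 0 := by exact_mod_cast ha0
  have m1 : (a0 : ℝ) ^ 2 * α ∈ Algebra.adjoin ℤ {β} := by
    have := mul_mem ha0m hβm
    rwa [show (a0 : ℝ) * β = (a0 : ℝ) ^ 2 * α by rw [hβ']; ring] at this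
  have m2 : (a0 : ℝ) ^ 2 * θ2 ∈ Algebra.adjoin ℤ {β} := by
    have := sub_mem (mul_mem hβm hβm) (mul_mem ha0m hβm)
    rwa [show β * β - (a0 : ℝ) * β = (a0 : ℝ) ^ 2 * θ2 by rw [hβ', hθ2]; ring] at this
  have m0 : (a0 : ℝ) ^ 2 ∈ Algebra.adjoin ℤ {β} := pow_mem ha0m 2
  by_cases hI : ∀ q0 : ℝ, ∃ q ≥ q0, 8 ≤ q ∧ ∃ x : Fin 3 → ℤ, |(x 0 : ℝ)| ≤ q ^ 8 ∧ |(x 1 : ℝ)| ≤ q ^ 8 ∧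
      |α * x 0 + θ2 * x 1 + x 2| ≤ K / q ^ 24 ∧
      (∃ w : Fin 3 → ℤ, |(w 0 : ℝ)| ≤ q ^ 8 ∧ |(w 1 : ℝ)| ≤ 2 * q ^ 9 ∧
      |α * w 0 + θ2 * w 1 + w 2| ≤ (3 * K + 2) / q ^ 20 ∧
      ∃ j, cr x w 2 ≠ 0 ∧ q ≤ (((cr x w j : ℚ) / (cr x w 2 : ℚ)).den : ℝ) ^ (2 * (D + 1)))
  · refine T2 β hintg ((a0 : ℝ) ^ 2) (pow_ne_zero _ ha0r) !![1, 0, 0; 0, 1, 0; -α, -θ2, 1] ?_ ?_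
      ![(8 : ℕ), (9 : ℕ), -(20 : ℕ)] ?_ (3 * K + 2) (by linarith) (1 / (2 * (D + 1) : ℕ)) (by positivity) ?_
    · intro i j
      fin_cases i <;> fin_cases j <;> simp [m0, m1, m2]
    · intro k
      fin_cases k
      · exact ⟨![1, 0, α], fun i => by fin_cases i <;> simp [Fin.sum_univ_three]⟩
      · exact ⟨![0, 1, θ2], fun i => by fin_cases i <;> simp [Fin.sum_univ_three]⟩
      · exact ⟨![0, 0, 1], fun i => by fin_cases i <;> simp [Fin.sum_univ_three]⟩
    · simp [Fin.sum_univ_three]; norm_num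
    · intro X
      obtain ⟨q, hq0, hq8, x, hx0, hx1, hLx, w, hw0, hw1, hLw, j, hc2, hden⟩ := hI (Real.exp X)
      have hqp : 0 < q := by linarith
      have hq1 : 1 ≤ q := by linarith
      refine ⟨Real.log q, (Real.le_log_iff_exp_le hqp).mpr hq0, x, w,
        ![x 0, x 1, α * x 0 + θ2 * x 1 + x 2], ![w 0, w 1, α * w 0 + θ2 * w 1 + w 2], ?_, ?_, ?_, ?_, 2, j, hc2, ?_⟩
      · intro i; fin_cases i <;> simp [Fin.sum_univ_three]
        ring
      · intro i; fin_cases i <;> simp [Fin.sum_univ_three]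
        ring
      · intro i
        fin_cases i <;> simp only [Fin.zero_eta, Fin.mk_one, Fin.reduceFinMk, Matrix.cons_val] <;>
          simp only [exp_nat_log q hqp, exp_neg_nat_log q hqp]
        · refine hx0.trans ?_
          have : 0 < q ^ 8 := by positivity
          nlinarith
        · refine hx1.trans ?_
          have : 0 < q ^ 9 := by positivity
          have : q ^ 8 ≤ q ^ 9 := pow_le_pow_right₀ hq1 (by norm_num)
          nlinarith
        · refine hLx.trans ?_
          rw [← div_eq_mul_inv]
          gcongr
          · linarith
          · norm_num
      · intro i
        fin_cases i <;> simp only [Fin.zero_eta, Fin.mk_one, Fin.reduceFinMk, Matrix.cons_val] <;>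
          simp only [exp_nat_log q hqp, exp_neg_nat_log q hqp]
        · refine hw0.trans ?_
          have : 0 < q ^ 8 := by positivity
          nlinarith
        · refine hw1.trans ?_
          have : 0 < q ^ 9 := by positivity
          nlinarith
        · refine hLw.trans ?_
          rw [← div_eq_mul_inv]
      · refine le_of_pow_le_pow_left₀ (n := 2 * (D + 1)) (by omega) (by positivity) ?_
        refine le_trans (le_of_eq ?_) hden
        rw [← Real.exp_nat_mul, ← mul_assoc, mul_one_div_cancel (by positivity), one_mul, Real.exp_log hqp]
  · push Not at hI
    obtain ⟨q2, hI⟩ := hI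
    refine T2 β hintg ((a0 : ℝ) ^ 2) (pow_ne_zero _ ha0r) !![α, 1, 0; θ2, 0, 1; 1, 0, 0] ?_ ?_
      ![(17 : ℕ), -(9 : ℕ), -(9 : ℕ)] ?_ (8 * (K + 1)) (by linarith) (2 : ℕ) (by norm_num) ?_
    · intro i j
      fin_cases i <;> fin_cases j <;> simp [m0, m1, m2]
    · intro k
      fin_cases k
      · exact ⟨![0, 1, 0], fun i => by fin_cases i <;> simp [Fin.sum_univ_three]⟩
      · exact ⟨![0, 0, 1], fun i => by fin_cases i <;> simp [Fin.sum_univ_three]⟩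
      · exact ⟨![1, -α, -θ2], fun i => by fin_cases i <;> simp [Fin.sum_univ_three]⟩
    · simp [Fin.sum_univ_three]; norm_num
    · intro X
      obtain ⟨q, hq0, hq8, x, hx0, hx1, hLx, h | h⟩ := H2 (max q2 (Real.exp X))
      · exfalso
        obtain ⟨w, h1, h2, h3, j, h4, h5⟩ := h
        exact absurd h5 (not_le.mpr (hI q ((le_max_left _ _).trans hq0) hq8 x hx0 hx1 hLx w h1 h2 h3 j h4))
      · obtain ⟨y, hy, z, z', hz2, hz2', e0, e1, e0', e1', j, hc, hden⟩ := h
        have hyp : 0 < y := by linarith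
        have hX : Real.exp X ≤ y := ((le_max_right _ _).trans hq0).trans hy
        refine ⟨Real.log y, (Real.le_log_iff_exp_le hyp).mpr hX, z, z',
          ![z 2, z 0 - α * z 2, z 1 - θ2 * z 2], ![z' 2, z' 0 - α * z' 2, z' 1 - θ2 * z' 2], ?_, ?_, ?_, ?_, 0, j, hc, ?_⟩
        · intro i; fin_cases i <;> simp [Fin.sum_univ_three]
        · intro i; fin_cases i <;> simp [Fin.sum_univ_three]
        · intro i
          fin_cases i <;> simp only [Fin.zero_eta, Fin.mk_one, Fin.reduceFinMk, Matrix.cons_val] <;>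
            simp only [exp_nat_log y hyp, exp_neg_nat_log y hyp]
          · refine hz2.trans ?_
            have : 0 < y ^ 17 := by positivity
            nlinarith
          · rw [← div_eq_mul_inv]; exact e0
          · rw [← div_eq_mul_inv]; exact e1
        · intro i
          fin_cases i <;> simp only [Fin.zero_eta, Fin.mk_one, Fin.reduceFinMk, Matrix.cons_val] <;>
            simp only [exp_nat_log y hyp, exp_neg_nat_log y hyp]
          · refine hz2'.trans ?_
            have : 0 < y ^ 17 := by positivity
            nlinarith
          · rw [← div_eq_mul_inv]; exact e0'
          · rw [← div_eq_mul_inv]; exact e1'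
        · rw [exp_nat_log y hyp]; exact hden

end RS

namespace RS
open Finset

section CF
variable (a : ℕ → ℕ)

theorem cfQ_pos (hpos : ∀ i, 0 < a i) : ∀ n, 0 < cfQ a n
  | 0 => by simp [cfQ]
  | 1 => by simpa [cfQ] using hpos 0
  | n + 2 => by
    have := cfQ_pos hpos n
    simp only [cfQ]; omega

theorem cfQ_succ (hpos : ∀ i, 0 < a i) (n : ℕ) : cfQ a n ≤ cfQ a (n + 1) := by
  cases n with
  | zero => exact hpos 0
  | succ n =>
    change _ ≤ a (n + 1) * cfQ a (n + 1) + cfQ a n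
    nlinarith [hpos (n + 1), cfQ_pos a hpos n, cfQ_pos a hpos (n + 1)]

theorem cfQ_mono (hpos : ∀ i, 0 < a i) : Monotone (cfQ a) := monotone_nat_of_le_succ (cfQ_succ a hpos)

theorem cfQ_ge (hpos : ∀ i, 0 < a i) : ∀ n, n ≤ cfQ a n
  | 0 => by simp
  | 1 => hpos 0
  | n + 2 => by
    have h1 := cfQ_ge hpos (n + 1)
    have h2 := cfQ_pos a hpos n
    simp only [cfQ]
    nlinarith [hpos (n + 1)]

theorem cfP_le (hpos : ∀ i, 0 < a i) : ∀ n, cfP a n ≤ cfQ a n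
  | 0 => by simp [cfP, cfQ]
  | 1 => hpos 0
  | n + 2 => by
    have h1 := cfP_le hpos (n + 1)
    have h2 := cfP_le hpos n
    simp only [cfP, cfQ]
    gcongr

theorem cf_det (n : ℕ) : (cfP a (n + 1) : ℝ) * cfQ a n - cfP a n * cfQ a (n + 1) = (-1) ^ n := by
  induction n with
  | zero => simp [cfP, cfQ]
  | succ n ih =>
    simp only [cfP, cfQ]
    push_cast
    rw [pow_succ, ← ih]
    ring

/-- remainders -/
noncomputable def dl (α : ℝ) (n : ℕ) : ℝ := cfQ a n * α - cfP a n

theorem dl_rec (α : ℝ) (n : ℕ) : dl a α (n + 2) = a (n + 1) * dl a α (n + 1) + dl a α n := by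
  simp only [dl, cfP, cfQ]; push_cast; ring


theorem dl_sign (hpos : ∀ i, 0 < a i) (α : ℝ)
    (hα : Filter.Tendsto (fun ℓ => (cfP a ℓ : ℝ) / (cfQ a ℓ : ℝ)) Filter.atTop (nhds α)) (n : ℕ) : 0 < (-1) ^ n * dl a α n := by
  have hq : ∀ n, (0 : ℝ) < cfQ a n := fun n => by exact_mod_cast cfQ_pos a hpos n
  -- the sequence along the parity class
  let s : ℕ → ℝ := fun k => (-1) ^ n * ((cfP a (n + 2 * k) : ℝ) / cfQ a (n + 2 * k))
  have hs : ∀ k, s k < s (k + 1) := by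
    intro k
    set m := n + 2 * k with hm
    have e : s (k + 1) - s k = a (m + 1) / (cfQ a m * cfQ a (m + 2)) := by
      have hd := cf_det a m
      have h1 : (cfP a (m + 2) : ℝ) * cfQ a m - cfP a m * cfQ a (m + 2) = a (m + 1) * (-1) ^ m := by
        rw [← hd]; simp only [cfP, cfQ]; push_cast; ring
      have h2 : ((-1 : ℝ)) ^ m = (-1) ^ n := by
        rw [hm, pow_add, pow_mul]; simp
      have h3 : ((-1 : ℝ)) ^ n * (-1) ^ n = 1 := by
        rw [← pow_add, ← two_mul, pow_mul]; simp
      change (-1) ^ n * ((cfP a (m + 2) : ℝ) / cfQ a (m + 2)) - (-1) ^ n * ((cfP a m : ℝ) / cfQ a m) = _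
      have := hq m
      have := hq (m + 2)
      rw [← mul_sub, div_sub_div _ _ (by positivity) (by positivity), mul_div_assoc', mul_comm (cfQ a m : ℝ)]
      congr 1
      rw [show (cfP a (m + 2) : ℝ) * cfQ a m - cfQ a (m + 2) * cfP a m = a (m + 1) * (-1) ^ m by rw [← h1]; ring, h2]
      linear_combination (a (m + 1) : ℝ) * h3
    have : (0 : ℝ) < a (m + 1) / (cfQ a m * cfQ a (m + 2)) := by
      have := hq m
      have := hq (m + 2)
      have : (0 : ℝ) < a (m + 1) := by exact_mod_cast hpos _
      positivity
    linarith
  have hmono : Monotone s := monotone_nat_of_le_succ fun k => (hs k).le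
  have ht : Filter.Tendsto s Filter.atTop (nhds ((-1) ^ n * α)) := by
    refine Filter.Tendsto.const_mul _ ?_
    refine hα.comp ?_
    refine Filter.tendsto_atTop_mono (fun k => ?_) Filter.tendsto_id
    simp only [id]; omega
  have h1 : s 0 < (-1) ^ n * α := (hs 0).trans_le (hmono.ge_of_tendsto ht 1)
  have h2 : s 0 = (-1) ^ n * ((cfP a n : ℝ) / cfQ a n) := rfl
  have h3 : (-1) ^ n * dl a α n = cfQ a n * ((-1) ^ n * α - s 0) := by
    rw [h2, dl]
    have := (hq n).ne'
    field_simp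
  rw [h3]
  exact mul_pos (hq n) (by linarith)

theorem dl_abs (hpos : ∀ i, 0 < a i) (α : ℝ)
    (hα : Filter.Tendsto (fun ℓ => (cfP a ℓ : ℝ) / (cfQ a ℓ : ℝ)) Filter.atTop (nhds α)) (n : ℕ) : |dl a α n| = (-1) ^ n * dl a α n := by
  rw [← abs_of_pos (dl_sign a hpos α hα n), abs_mul]; simp

theorem dl_ne (hpos : ∀ i, 0 < a i) (α : ℝ)
    (hα : Filter.Tendsto (fun ℓ => (cfP a ℓ : ℝ) / (cfQ a ℓ : ℝ)) Filter.atTop (nhds α)) (n : ℕ) : dl a α n ≠ 0 := by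
  intro h
  have := dl_sign a hpos α hα n
  rw [h] at this; simp at this

theorem dl_bound (hpos : ∀ i, 0 < a i) (α : ℝ)
    (hα : Filter.Tendsto (fun ℓ => (cfP a ℓ : ℝ) / (cfQ a ℓ : ℝ)) Filter.atTop (nhds α)) (n : ℕ) : |dl a α n| * cfQ a (n + 1) ≤ 1 := by
  have h1 := dl_sign a hpos α hα (n + 1)
  have hd := cf_det a n
  have h3 : ((-1 : ℝ)) ^ n * (-1) ^ n = 1 := by
    rw [← pow_add, ← two_mul, pow_mul]; simp
  have e : |dl a α n| * cfQ a (n + 1) + ((-1) ^ (n + 1) * dl a α (n + 1)) * cfQ a n = 1 := by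
    rw [dl_abs a hpos α hα, pow_succ]
    simp only [dl]
    refine Eq.trans ?_ h3
    linear_combination ((-1) ^ n) * hd
  have : 0 ≤ ((-1) ^ (n + 1) * dl a α (n + 1)) * cfQ a n := by positivity
  linarith

theorem cf_irr (hpos : ∀ i, 0 < a i) (α : ℝ)
    (hα : Filter.Tendsto (fun ℓ => (cfP a ℓ : ℝ) / (cfQ a ℓ : ℝ)) Filter.atTop (nhds α)) : Irrational α := by
  rw [irrational_iff_ne_rational]
  intro P R hR h
  obtain ⟨n, hn⟩ : ∃ n : ℕ, |(R : ℝ)| < n := exists_nat_gt _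
  have h1 := dl_bound a hpos α hα n
  have h2 := dl_ne a hpos α hα n
  have hR' : (R : ℝ) ≠ 0 := by exact_mod_cast hR
  have e : R * dl a α n = ((cfQ a n * P - cfP a n * R : ℤ) : ℝ) := by
    rw [dl, h]; push_cast; field_simp
  have h3 : (cfQ a n * P - cfP a n * R : ℤ) ≠ 0 := by
    intro h0
    rw [h0] at e
    simp at e
    exact e.elim hR h2
  have h4 : (1 : ℝ) ≤ |R * dl a α n| := by
    rw [e]; exact_mod_cast Int.one_le_abs h3
  rw [abs_mul] at h4
  have h5 : (n : ℝ) ≤ cfQ a (n + 1) := by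
    have := cfQ_ge a hpos (n + 1)
    exact_mod_cast (by omega)
  have h6 : 0 < |dl a α n| := abs_pos.mpr h2
  nlinarith

/-- complete quotients -/
noncomputable def Eq' (a : ℕ → ℕ) (α : ℝ) : ℕ → ℝ
  | 0 => α
  | n + 1 => - dl a α (n + 1) / dl a α n

theorem Eq_rec (hpos : ∀ i, 0 < a i) (α : ℝ)
    (hα : Filter.Tendsto (fun ℓ => (cfP a ℓ : ℝ) / (cfQ a ℓ : ℝ)) Filter.atTop (nhds α)) (n : ℕ) : Eq' a α (n + 1) = 1 / Eq' a α n - a n := by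
  have hne := dl_ne a hpos α hα
  cases n with
  | zero =>
    have h0 : dl a α 0 = α := by simp [dl, cfP, cfQ]
    have := hne 0
    rw [h0] at this
    simp only [Eq', h0]
    simp only [dl, cfP, cfQ]
    push_cast
    field_simp
    ring
  | succ n =>
    simp only [Eq']
    rw [dl_rec]
    have h1 := hne n
    have h2 := hne (n + 1)
    field_simp
    ring

theorem Eq_pos (hpos : ∀ i, 0 < a i) (α : ℝ)
    (hα : Filter.Tendsto (fun ℓ => (cfP a ℓ : ℝ) / (cfQ a ℓ : ℝ)) Filter.atTop (nhds α)) (n : ℕ) : 0 < Eq' a α n := by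
  cases n with
  | zero =>
    have := dl_sign a hpos α hα 0
    simpa [dl, cfP, cfQ, Eq'] using this
  | succ n =>
    have h1 := dl_sign a hpos α hα n
    have h2 := dl_sign a hpos α hα (n + 1)
    simp only [Eq']
    have h3 : ((-1 : ℝ)) ^ n ≠ 0 := by positivity
    have : -dl a α (n + 1) / dl a α n = ((-1) ^ (n + 1) * dl a α (n + 1)) / ((-1) ^ n * dl a α n) := by
      have := dl_ne a hpos α hα n
      rw [pow_succ]
      field_simp
    rw [this]
    positivity

theorem Eq_lt (hpos : ∀ i, 0 < a i) (α : ℝ)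
    (hα : Filter.Tendsto (fun ℓ => (cfP a ℓ : ℝ) / (cfQ a ℓ : ℝ)) Filter.atTop (nhds α)) (n : ℕ) : Eq' a α n < 1 := by
  have h1 := Eq_rec a hpos α hα n
  have h2 := Eq_pos a hpos α hα n
  have h3 := Eq_pos a hpos α hα (n + 1)
  have h4 : (1 : ℝ) ≤ a n := by exact_mod_cast hpos n
  have h5 : 1 < 1 / Eq' a α n := by linarith
  rwa [lt_div_iff₀ h2, one_mul] at h5

theorem Eq_floor (hpos : ∀ i, 0 < a i) (α : ℝ)
    (hα : Filter.Tendsto (fun ℓ => (cfP a ℓ : ℝ) / (cfQ a ℓ : ℝ)) Filter.atTop (nhds α)) (n : ℕ) : (a n : ℤ) = ⌊1 / Eq' a α n⌋ := by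
  have h1 := Eq_rec a hpos α hα n
  symm
  rw [Int.floor_eq_iff]
  have h3 := Eq_pos a hpos α hα (n + 1)
  have h4 := Eq_lt a hpos α hα (n + 1)
  push_cast
  constructor <;> linarith

theorem Eq_per (hpos : ∀ i, 0 < a i) (α : ℝ)
    (hα : Filter.Tendsto (fun ℓ => (cfP a ℓ : ℝ) / (cfQ a ℓ : ℝ)) Filter.atTop (nhds α)) (r : ℕ) (h : Eq' a α r = Eq' a α 0) (n : ℕ) : Eq' a α (n + r) = Eq' a α n := by
  induction n with
  | zero => simpa using h
  | succ n ih =>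
    have hf : (a (n + r) : ℤ) = a n := by
      rw [Eq_floor a hpos α hα, Eq_floor a hpos α hα n, ih]
    have hf' : a (n + r) = a n := by exact_mod_cast hf
    rw [show n + 1 + r = n + r + 1 by omega, Eq_rec a hpos α hα, Eq_rec a hpos α hα, ih, hf']

theorem F_ne (hpos : ∀ i, 0 < a i) (α : ℝ)
    (hα : Filter.Tendsto (fun ℓ => (cfP a ℓ : ℝ) / (cfQ a ℓ : ℝ)) Filter.atTop (nhds α)) (hper : ¬ EventuallyPeriodic a) (s : ℕ) : dl a α s * α + dl a α (s + 1) ≠ 0 := by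
  intro h
  apply hper
  refine ⟨0, s + 1, by omega, fun n _ => ?_⟩
  have h1 : Eq' a α (s + 1) = Eq' a α 0 := by
    simp only [Eq']
    rw [div_eq_iff (dl_ne a hpos α hα s)]
    linarith
  have := Eq_per a hpos α hα (s + 1) h1 n
  have hf : (a (n + (s + 1)) : ℤ) = a n := by
    rw [Eq_floor a hpos α hα, Eq_floor a hpos α hα n, this]
  exact_mod_cast hf

theorem cf_rep (s : ℕ) (hrep : ∀ i < s + 1, a (i + (s + 1)) = a i) : ∀ m, m ≤ s + 1 →
    cfQ a (s + 1 + m) = cfQ a (s + 1) * cfQ a m + cfQ a s * cfP a m ∧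
    cfP a (s + 1 + m) = cfP a (s + 1) * cfQ a m + cfP a s * cfP a m
  | 0, _ => by simp [cfQ, cfP]
  | 1, _ => by
    have h0 := hrep 0 (by omega)
    rw [Nat.zero_add] at h0
    constructor
    · change a (s + 1) * cfQ a (s + 1) + cfQ a s = cfQ a (s + 1) * a 0 + cfQ a s * 1
      rw [h0]; ring
    · change a (s + 1) * cfP a (s + 1) + cfP a s = cfP a (s + 1) * a 0 + cfP a s * 1
      rw [h0]; ring
  | m + 2, hm => by
    obtain ⟨h1, h2⟩ := cf_rep s hrep (m + 1) (by omega)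
    obtain ⟨h3, h4⟩ := cf_rep s hrep m (by omega)
    have h0 := hrep (m + 1) (by omega)
    rw [show m + 1 + (s + 1) = s + 1 + m + 1 by omega] at h0
    constructor
    · change a (s + 1 + m + 1) * cfQ a (s + 1 + (m + 1)) + cfQ a (s + 1 + m) = _
      rw [h0, h1, h3]
      simp only [cfQ, cfP]; ring
    · change a (s + 1 + m + 1) * cfP a (s + 1 + (m + 1)) + cfP a (s + 1 + m) = _
      rw [h0, h2, h4]
      simp only [cfQ, cfP]; ring

theorem F_bound (hpos : ∀ i, 0 < a i) (α : ℝ)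
    (hα : Filter.Tendsto (fun ℓ => (cfP a ℓ : ℝ) / (cfQ a ℓ : ℝ)) Filter.atTop (nhds α)) (s : ℕ) (hrep : ∀ i < s + 1, a (i + (s + 1)) = a i) :
    |dl a α s * α + dl a α (s + 1)| * (cfQ a (s + 1) : ℝ) ^ 3 ≤ 2 := by
  obtain ⟨h1, h2⟩ := cf_rep a s hrep (s + 1) le_rfl
  set F := dl a α s * α + dl a α (s + 1) with hF
  have hq : (0 : ℝ) < cfQ a (s + 1) := by exact_mod_cast cfQ_pos a hpos (s + 1)
  have b1 := dl_bound a hpos α hα s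
  have b2 := dl_bound a hpos α hα (s + 1)
  have b3 := dl_bound a hpos α hα (s + 1 + (s + 1))
  have e : (cfQ a (s + 1) : ℝ) * F = dl a α (s + 1 + (s + 1)) + dl a α (s + 1) * dl a α s := by
    rw [hF]
    simp only [dl, h1, h2]
    push_cast
    ring
  have m2 : (cfQ a (s + 1) : ℝ) ≤ cfQ a (s + 1 + 1) := by exact_mod_cast cfQ_succ a hpos (s + 1)
  have m3 : (cfQ a (s + 1) : ℝ) ^ 2 ≤ cfQ a (s + 1 + (s + 1) + 1) := by
    have t1 := cfQ_succ a hpos (s + 1 + (s + 1))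
    have : cfQ a (s + 1) ^ 2 ≤ cfQ a (s + 1 + (s + 1) + 1) := by
      refine le_trans ?_ t1
      rw [h1, sq]; omega
    exact_mod_cast this
  have c2 : |dl a α (s + 1)| * cfQ a (s + 1) ≤ 1 := le_trans (by gcongr) b2
  have c3 : |dl a α (s + 1 + (s + 1))| * (cfQ a (s + 1) : ℝ) ^ 2 ≤ 1 := le_trans (by gcongr) b3
  have c4 : (|dl a α (s + 1)| * cfQ a (s + 1)) * (|dl a α s| * cfQ a (s + 1)) ≤ 1 :=
    mul_le_one₀ c2 (by positivity) b1
  calc |F| * (cfQ a (s + 1) : ℝ) ^ 3 = |(cfQ a (s + 1) : ℝ) * F| * (cfQ a (s + 1) : ℝ) ^ 2 := by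
        rw [abs_mul, abs_of_pos hq]; ring
    _ ≤ (|dl a α (s + 1 + (s + 1))| + |dl a α (s + 1)| * |dl a α s|) * (cfQ a (s + 1) : ℝ) ^ 2 := by
        rw [e, ← abs_mul]
        gcongr
        exact abs_add_le _ _
    _ = |dl a α (s + 1 + (s + 1))| * (cfQ a (s + 1) : ℝ) ^ 2 + (|dl a α (s + 1)| * cfQ a (s + 1)) * (|dl a α s| * cfQ a (s + 1)) := by ring
    _ ≤ 2 := by linarith

theorem cf_main (hpos : ∀ i, 0 < a i) (α : ℝ)
    (hα : Filter.Tendsto (fun ℓ => (cfP a ℓ : ℝ) / (cfQ a ℓ : ℝ)) Filter.atTop (nhds α)) (hper : ¬ EventuallyPeriodic a)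
    (hrep : ∀ n, ∃ s ≥ n, ∀ i < s + 1, a (i + (s + 1)) = a i) : Transcendental ℚ α := by
  intro halg
  have halg' : IsAlgebraic ℤ α := (IsFractionRing.isAlgebraic_iff ℤ ℚ ℝ).mpr halg
  let L : (Fin 3 → ℤ) → ℝ := fun x => α * x 0 + (α ^ 2 - α) * x 1 + x 2
  refine geom α (cf_irr a hpos α hα) halg' 16 (by norm_num) fun X => ?_
  by_contra hcon
  push Not at hcon
  obtain ⟨B, hB⟩ : ∃ B : ℕ, X < B := exists_nat_gt X
  have heps : ∀ S : Finset (Fin 3 → ℤ), ∃ ε > 0, ∀ t ∈ S, L t ≠ 0 → ε ≤ |L t| := by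
    intro S
    induction S using Finset.induction_on with
    | empty => exact ⟨1, one_pos, by simp⟩
    | insert t S _ ih =>
      obtain ⟨ε, hε, h⟩ := ih
      by_cases ht : L t = 0
      · refine ⟨ε, hε, fun t' ht' hL => ?_⟩
        rcases Finset.mem_insert.mp ht' with rfl | h'
        · exact absurd ht hL
        · exact h t' h' hL
      · refine ⟨min ε |L t|, lt_min hε (abs_pos.mpr ht), fun t' ht' hL => ?_⟩
        rcases Finset.mem_insert.mp ht' with rfl | h'
        · exact min_le_right _ _
        · exact (min_le_left _ _).trans (h t' h' hL)
  obtain ⟨ε, hε, hmin⟩ := heps (Fintype.piFinset fun _ => Finset.Icc (-(B : ℤ)) B)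
  obtain ⟨n, hn⟩ : ∃ n : ℕ, 2 / ε < n := exists_nat_gt _
  obtain ⟨s, hs, hr⟩ := hrep n
  have hFn := F_ne a hpos α hα hper s
  have hFb := F_bound a hpos α hα s hr
  set F := dl a α s * α + dl a α (s + 1) with hF
  let x : Fin 3 → ℤ := ![(cfQ a (s + 1) : ℤ) - cfP a s + cfQ a s, cfQ a s, -(cfP a (s + 1) : ℤ)]
  have hLx : L x = F := by
    simp only [L, x, hF, dl, Matrix.cons_val]
    push_cast
    ring
  have hqs := cfQ_pos a hpos s
  have hx0 : x ≠ 0 := by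
    intro h
    have := congrFun h 1
    simp [x] at this
    omega
  obtain ⟨g, hg, t, ht, hxt⟩ := exists_prim x hx0
  have hgr : (1 : ℝ) ≤ g := by exact_mod_cast hg
  have hLt : g * L t = F := by
    rw [← hLx]
    simp only [L, hxt]
    push_cast
    ring
  have hps := cfP_le a hpos s
  have hps1 := cfP_le a hpos (s + 1)
  have hqq := cfQ_succ a hpos s
  have e0 : g * t 0 = (cfQ a (s + 1) : ℤ) - cfP a s + cfQ a s := (hxt 0).symm
  have e1 : g * t 1 = (cfQ a s : ℤ) := (hxt 1).symm
  have e2 : g * t 2 = -(cfP a (s + 1) : ℤ) := (hxt 2).symm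
  have t0p : 0 < t 0 := by
    refine pos_of_mul_pos_right (a := g) ?_ hg.le
    rw [e0]; omega
  have t1 : |t 1| ≤ t 0 := by
    refine le_of_mul_le_mul_left (a := g) ?_ hg
    rw [← abs_of_pos hg, ← abs_mul, abs_of_pos hg, e0, e1, abs_le]; omega
  have t2 : |t 2| ≤ t 0 := by
    refine le_of_mul_le_mul_left (a := g) ?_ hg
    rw [← abs_of_pos hg, ← abs_mul, abs_of_pos hg, e0, e2, abs_le]; omega
  have hLtF : |L t| ≤ |F| := by
    rw [← hLt, abs_mul, abs_of_pos (by linarith : (0 : ℝ) < g)]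
    nlinarith [abs_nonneg (L t)]
  have hLtb : |L t| * (t 0 : ℝ) ^ 3 ≤ 16 := by
    have h1 : (t 0 : ℝ) ≤ 2 * cfQ a (s + 1) := by
      have : t 0 ≤ 2 * cfQ a (s + 1) := by
        have : t 0 ≤ g * t 0 := by nlinarith
        omega
      exact_mod_cast this
    have h0 : (0 : ℝ) < t 0 := by exact_mod_cast t0p
    calc |L t| * (t 0 : ℝ) ^ 3 ≤ |F| * (2 * cfQ a (s + 1)) ^ 3 := by gcongr
      _ = 8 * (|F| * (cfQ a (s + 1) : ℝ) ^ 3) := by ring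
      _ ≤ 16 := by linarith
  have hXt : (t 0 : ℝ) < X := by
    by_contra h
    exact absurd hLtb (not_le.mpr (hcon t ht (not_lt.mp h) t1))
  have ht0B : t 0 ≤ B := by
    have : (t 0 : ℝ) < B := hXt.trans hB
    exact_mod_cast this.le
  have hmem : t ∈ Fintype.piFinset fun _ : Fin 3 => Finset.Icc (-(B : ℤ)) B := by
    rw [Fintype.mem_piFinset]
    intro i
    rw [Finset.mem_Icc, ← abs_le]
    fin_cases i
    · exact (abs_of_pos t0p).le.trans ht0B
    · exact t1.trans ht0B
    · exact t2.trans ht0B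
  have hLt0 : L t ≠ 0 := by
    intro h
    rw [h, mul_zero] at hLt
    exact hFn hLt.symm
  have h1 := (hmin t hmem hLt0).trans hLtF
  have h2 : (n : ℝ) ≤ cfQ a (s + 1) := by
    have := cfQ_ge a hpos (s + 1)
    exact_mod_cast (by omega)
  have h3 : (1 : ℝ) ≤ cfQ a (s + 1) := by exact_mod_cast cfQ_pos a hpos (s + 1)
  have h4 : (cfQ a (s + 1) : ℝ) ≤ (cfQ a (s + 1) : ℝ) ^ 3 := le_self_pow₀ h3 (by norm_num)
  rw [div_lt_iff₀ hε] at hn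
  have h5 : (n : ℝ) * ε ≤ (cfQ a (s + 1) : ℝ) ^ 3 * |F| := by
    gcongr
    linarith
  linarith

end CF

end RS

theorem statement0 (a : ℕ → ℕ) (hpos : ∀ i, 0 < a i) (α : ℝ)
    (hα : Tendsto (fun ℓ => (cfP a ℓ : ℝ) / (cfQ a ℓ : ℝ)) atTop (𝓝 α))
    (w : ℚ) (hw : 2 ≤ w)
    (hcond : ConditionStar a (w : ℝ)) :
    Transcendental ℚ α := by
  obtain ⟨hper, V, hV, hmono, hbeg⟩ := hcond
  refine RS.cf_main a hpos α hα hper fun n => ?_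
  have hlen : n + 1 ≤ (V (n + 1)).length := hmono.le_apply
  obtain ⟨s, hs⟩ : ∃ s, (V (n + 1)).length = s + 1 := ⟨(V (n + 1)).length - 1, by omega⟩
  refine ⟨s, by omega, fun i hi => ?_⟩
  have h2 : (2 : ℝ) ≤ (w : ℝ) := by exact_mod_cast hw
  have hceil : 2 * (s + 1) ≤ ⌈(w : ℝ) * (V (n + 1)).length⌉₊ := by
    have : ((2 * (s + 1) : ℕ) : ℝ) ≤ ⌈(w : ℝ) * (V (n + 1)).length⌉₊ := by
      refine le_trans ?_ (Nat.le_ceil _)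
      rw [hs]
      push_cast
      gcongr
    exact_mod_cast this
  have b1 := hbeg (n + 1) i (by omega)
  have b2 := hbeg (n + 1) (i + (s + 1)) (by omega)
  rw [hs] at b1 b2
  rw [Nat.add_mod_right] at b2
  rw [b1] at b2
  exact (Option.some.inj b2).symm
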